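/- Let T_n be a tree chosen uniformly at random among all labelled trees on the vertex set {1,…,n}. Then the sequence of random variables (β(T_n) − E[β(T_n)]) / sqrt(Var[β(T_n)]) converges in distribution, as n → ∞, to a standard normal random variable. -/

import Mathlib

open scoped Classical BigOperators
open Filter Topology

noncomputable section

namespace MetricDimPaper

/-- `R` is a resolving set of `G`: every pair of distinct vertices is distinguished by its
vector of (extended, possibly infinite) distances to the vertices of `R`. -/
def Resolves {V : Type*} (G : SimpleGraph V) (R : Set V) : Prop :=
  ∀ u v : V, u ≠ v → ∃ w ∈ R, G.edist u w ≠ G.edist v w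

/-- The metric dimension of a graph: the least cardinality of a resolving set, with the
convention that a single isolated vertex has metric dimension 1. -/
def metricDim {V : Type*} (G : SimpleGraph V) : ℕ :=
  if Nat.card V = 1 then 1
  else sInf {m : ℕ | ∃ R : Set V, R.ncard = m ∧ Resolves G R}

/-- A tree: a connected acyclic graph. -/
def IsTree {V : Type*} (G : SimpleGraph V) : Prop := G.Connected ∧ G.IsAcyclic

/-- degree of a vertex (as `Nat.card` of the neighbor set). -/
def ndeg {V : Type*} (G : SimpleGraph V) (v : V) : ℕ := (G.neighborSet v).ncard

/-- metric dimension as a real number -/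
def betaR {n : ℕ} (G : SimpleGraph (Fin n)) : ℝ := (metricDim G : ℝ)

def treeSet (n : ℕ) : Set (SimpleGraph (Fin n)) := {G | IsTree G}

def forestSet (n : ℕ) : Set (SimpleGraph (Fin n)) := {G | G.IsAcyclic}

/-- Expectation of `f` under the uniform distribution on the (finite) set `S` of graphs. -/
def unifExp {n : ℕ} (S : Set (SimpleGraph (Fin n))) (f : SimpleGraph (Fin n) → ℝ) : ℝ :=
  (∑ᶠ G ∈ S, f G) / (Nat.card ↥S)

/-- Variance of `f` under the uniform distribution on `S`. -/
def unifVar {n : ℕ} (S : Set (SimpleGraph (Fin n))) (f : SimpleGraph (Fin n) → ℝ) : ℝ :=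
  unifExp S (fun G => (f G - unifExp S f) ^ 2)

/-- Probability of the event `A` under the uniform distribution on `S`. -/
def unifPr {n : ℕ} (S A : Set (SimpleGraph (Fin n))) : ℝ :=
  (Nat.card ↥(S ∩ A) : ℝ) / (Nat.card ↥S)

/-- The probability weight of an individual graph in the Erdős–Rényi model `G(n,p)`. -/
def erWeight (n : ℕ) (p : ℝ) (G : SimpleGraph (Fin n)) : ℝ :=
  p ^ (Nat.card ↥G.edgeSet) * (1 - p) ^ (n.choose 2 - Nat.card ↥G.edgeSet)

/-- Expectation of `f` in the Erdős–Rényi model `G(n,p)`. -/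
def erExp (n : ℕ) (p : ℝ) (f : SimpleGraph (Fin n) → ℝ) : ℝ :=
  ∑ᶠ G : SimpleGraph (Fin n), erWeight n p G * f G

/-- Variance of `f` in the Erdős–Rényi model `G(n,p)`. -/
def erVar (n : ℕ) (p : ℝ) (f : SimpleGraph (Fin n) → ℝ) : ℝ :=
  erExp n p (fun G => (f G - erExp n p f) ^ 2)

/-- Probability of the event `A` in the Erdős–Rényi model `G(n,p)`. -/
def erPr (n : ℕ) (p : ℝ) (A : Set (SimpleGraph (Fin n))) : ℝ :=
  ∑ᶠ G ∈ A, erWeight n p G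

/-- The cumulative distribution function of the standard normal law. -/
def stdGaussianCDF (x : ℝ) : ℝ :=
  (Real.sqrt (2 * Real.pi))⁻¹ * ∫ t in Set.Iic x, Real.exp (-(t ^ 2) / 2)

/-- The normalized metric dimension `(β - E β)/sqrt (Var β)` for the uniform model on `S`. -/
def normβ {n : ℕ} (S : Set (SimpleGraph (Fin n))) (G : SimpleGraph (Fin n)) : ℝ :=
  (betaR G - unifExp S betaR) / Real.sqrt (unifVar S betaR)

/-- The normalized metric dimension `(β - E β)/sqrt (Var β)` for the `G(n,p)` model. -/
def erNormβ (n : ℕ) (p : ℝ) (G : SimpleGraph (Fin n)) : ℝ :=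
  (betaR G - erExp n p betaR) / Real.sqrt (erVar n p betaR)

section Forests

variable {V : Type*}

/-- The function equal to `f` on `A` and to `g` off `A`. -/
def glue (A : Finset V) (f g : V → V) (v : V) : V := if v ∈ A then f v else g v

lemma glue_mem {A : Finset V} {f g : V → V} {v : V} (h : v ∈ A) : glue A f g v = f v := if_pos h

lemma glue_notMem {A : Finset V} {f g : V → V} {v : V} (h : v ∉ A) : glue A f g v = g v :=
  if_neg h

variable [Fintype V]

/-- The vertices other than `v` that `f` sends to `v`. -/
def kids (f : V → V) (v : V) : Finset V := Finset.univ.filter fun x => x ≠ v ∧ f x = v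

lemma mem_kids {f : V → V} {v x : V} : x ∈ kids f v ↔ x ≠ v ∧ f x = v := by simp [kids]

/-- Parent functions of forests with set of roots `C` and set of other vertices `D`. -/
def forests (C D : Finset V) : Finset (V → V) :=
  Finset.univ.filter fun f => (∀ v ∉ D, f v = v) ∧ ∀ d ∈ D, ∃ k, f^[k] d ∈ C

/-- Functions from `H` to `C`, extended by the identity. -/
def mapsOn (H C : Finset V) : Finset (V → V) :=
  Finset.univ.filter fun f => (∀ v ∉ H, f v = v) ∧ ∀ d ∈ H, f d ∈ C

/-- Forests counted with weight `a` of the number of children for roots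
and weight `b` for the other vertices. -/
def forestSum (a b : ℕ → ℂ) (C D : Finset V) : ℂ :=
  ∑ f ∈ forests C D, (∏ c ∈ C, a (kids f c).card) * ∏ d ∈ D, b (kids f d).card

/-- Functions from `H` to `C` counted with weight `a` of the sizes of the fibres. -/
def mapSum (a : ℕ → ℂ) (H C : Finset V) : ℂ :=
  ∑ f ∈ mapsOn H C, ∏ c ∈ C, a (kids f c).card

lemma mem_forests {C D : Finset V} {f : V → V} :
    f ∈ forests C D ↔ (∀ v ∉ D, f v = v) ∧ ∀ d ∈ D, ∃ k, f^[k] d ∈ C := by simp [forests]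

lemma mem_mapsOn {C D : Finset V} {f : V → V} :
    f ∈ mapsOn D C ↔ (∀ v ∉ D, f v = v) ∧ ∀ d ∈ D, f d ∈ C := by simp [mapsOn]

lemma forests_mapsTo {C D : Finset V} (hCD : Disjoint C D) {f : V → V} (hf : f ∈ forests C D)
    {d : V} (hd : d ∈ D) : f d ∈ C ∪ D := by
  rw [mem_forests] at hf
  by_contra h
  simp only [Finset.mem_union, not_or] at h
  obtain ⟨k, hk⟩ := hf.2 d hd
  cases k with
  | zero => exact Finset.disjoint_left.1 hCD hk hd
  | succ k =>
    rw [Function.iterate_succ_apply, Function.iterate_fixed (hf.1 _ h.2)] at hk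
    exact h.1 hk

lemma forestSum_eq_sum_heads (a b : ℕ → ℂ) {C D : Finset V} (hCD : Disjoint C D) :
    forestSum a b C D = ∑ H ∈ D.powerset, mapSum a H C * forestSum b b H (D \ H) := by
  unfold forestSum
  rw [← Finset.sum_fiberwise_of_maps_to (s := forests C D) (t := D.powerset)
    (g := fun f => D.filter fun d => f d ∈ C) (fun f _ => by simp)]
  refine Finset.sum_congr rfl fun H hH => ?_
  rw [Finset.mem_powerset] at hH
  have hHC : ∀ x ∈ H, x ∉ C := fun x hx hc => Finset.disjoint_left.1 hCD hc (hH hx)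
  rw [mapSum, Finset.sum_mul_sum, ← Finset.sum_product']
  refine Finset.sum_nbij' (fun f => (glue H f id, glue (D \ H) f id))
    (fun p => glue H p.1 p.2) ?_ ?_ ?_ ?_ ?_
  · intro f hf
    simp only [Finset.mem_filter] at hf
    obtain ⟨hf, rfl⟩ := hf
    have hf' := mem_forests.1 hf
    simp only [Finset.mem_product, mem_mapsOn, mem_forests]
    refine ⟨⟨fun v hv => by simp [glue_notMem hv], fun d hd => ?_⟩,
      fun v hv => by simp [glue_notMem hv], ?_⟩
    · rw [glue_mem hd]; exact (Finset.mem_filter.1 hd).2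
    · have key : ∀ k, ∀ d ∈ D \ D.filter (fun d => f d ∈ C), f^[k] d ∈ C →
          ∃ j, (glue (D \ D.filter (fun d => f d ∈ C)) f id)^[j] d ∈
            D.filter (fun d => f d ∈ C) := by
        intro k
        induction k with
        | zero =>
          intro d hd hk
          exact absurd (Finset.mem_sdiff.1 hd).1 (Finset.disjoint_left.1 hCD hk)
        | succ k ih =>
          intro d hd hk
          have hdD := (Finset.mem_sdiff.1 hd).1
          have h1 : f d ∉ C := fun h => (Finset.mem_sdiff.1 hd).2 (Finset.mem_filter.2 ⟨hdD, h⟩)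
          have h2 : f d ∈ D := (Finset.mem_union.1 (forests_mapsTo hCD hf hdD)).resolve_left h1
          by_cases h3 : f d ∈ D.filter (fun d => f d ∈ C)
          · exact ⟨1, by simpa [glue_mem hd] using h3⟩
          · obtain ⟨j, hj⟩ := ih (f d) (Finset.mem_sdiff.2 ⟨h2, h3⟩) hk
            exact ⟨j + 1, by rwa [Function.iterate_succ_apply, glue_mem hd]⟩
      intro d hd
      obtain ⟨k, hk⟩ := hf'.2 d (Finset.mem_sdiff.1 hd).1
      exact key k d hd hk
  · rintro ⟨g, f⟩ h
    simp only [Finset.mem_product, mem_mapsOn] at h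
    obtain ⟨hg, hf⟩ := h
    have hdis : Disjoint H (D \ H) := Finset.disjoint_sdiff
    have hf' := mem_forests.1 hf
    have key : ∀ k, ∀ d ∈ D \ H, f^[k] d ∈ H → ∃ j, (glue H g f)^[j] d ∈ C := by
      intro k
      induction k with
      | zero => intro d hd hk; exact absurd hk (Finset.mem_sdiff.1 hd).2
      | succ k ih =>
        intro d hd hk
        have e : glue H g f d = f d := glue_notMem (Finset.mem_sdiff.1 hd).2
        by_cases h3 : f d ∈ H
        · refine ⟨2, ?_⟩
          simp only [Function.iterate_succ, Function.iterate_zero, Function.comp_apply, id, e,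
            glue_mem h3]
          exact hg.2 _ h3
        · have h2 := (Finset.mem_union.1 (forests_mapsTo hdis hf hd)).resolve_left h3
          obtain ⟨j, hj⟩ := ih (f d) h2 hk
          exact ⟨j + 1, by rwa [Function.iterate_succ_apply, e]⟩
    simp only [Finset.mem_filter, mem_forests]
    refine ⟨⟨fun v hv => ?_, fun d hd => ?_⟩, ?_⟩
    · rw [glue_notMem (fun h => hv (hH h))]
      exact hf'.1 v (fun h => hv (Finset.mem_sdiff.1 h).1)
    · by_cases hdH : d ∈ H
      · exact ⟨1, by simpa [glue_mem hdH] using hg.2 d hdH⟩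
      · have hd' := Finset.mem_sdiff.2 ⟨hd, hdH⟩
        obtain ⟨k, hk⟩ := hf'.2 d hd'
        exact key k d hd' hk
    · ext d
      simp only [Finset.mem_filter]
      constructor
      · rintro ⟨hd, hc⟩
        by_contra hdH
        rw [glue_notMem hdH] at hc
        have := forests_mapsTo hdis hf (Finset.mem_sdiff.2 ⟨hd, hdH⟩)
        rw [Finset.union_sdiff_of_subset hH] at this
        exact Finset.disjoint_left.1 hCD hc this
      · intro hd
        exact ⟨hH hd, by rw [glue_mem hd]; exact hg.2 d hd⟩
  · intro f hf
    simp only [Finset.mem_filter, mem_forests] at hf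
    funext v
    by_cases hv : v ∈ H
    · simp [glue_mem hv]
    · by_cases hv' : v ∈ D
      · simp [glue_notMem hv, glue_mem (Finset.mem_sdiff.2 ⟨hv', hv⟩)]
      · dsimp only
        rw [glue_notMem hv, glue_notMem (fun h => hv' (Finset.mem_sdiff.1 h).1), hf.1.1 v hv']
        rfl
  · rintro ⟨g, f⟩ h
    simp only [Finset.mem_product, mem_mapsOn, mem_forests] at h
    refine Prod.ext (funext fun v => ?_) (funext fun v => ?_)
    · by_cases hv : v ∈ H
      · simp [glue_mem hv]
      · simp [glue_notMem hv, h.1.1 v hv]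
    · by_cases hv : v ∈ D \ H
      · simp [glue_mem hv, glue_notMem (Finset.mem_sdiff.1 hv).2]
      · simp [glue_notMem hv, h.2.1 v hv]
  · intro f hf
    simp only [Finset.mem_filter] at hf
    obtain ⟨hf, rfl⟩ := hf
    have hf' := mem_forests.1 hf
    set H := D.filter (fun d => f d ∈ C) with hHdef
    rw [← Finset.prod_union Finset.disjoint_sdiff, Finset.union_sdiff_of_subset hH]
    congr 1
    · refine Finset.prod_congr rfl fun c hc => ?_
      congr 2
      ext x
      simp only [mem_kids]
      refine and_congr_right fun hx => ?_
      by_cases hxH : x ∈ H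
      · simp [glue_mem hxH]
      · simp only [glue_notMem hxH, id, hx, iff_false]
        intro h
        by_cases hxD : x ∈ D
        · exact hxH (Finset.mem_filter.2 ⟨hxD, h ▸ hc⟩)
        · exact hx ((hf'.1 x hxD).symm.trans h)
    · refine Finset.prod_congr rfl fun c hc => ?_
      congr 2
      ext x
      simp only [mem_kids]
      refine and_congr_right fun hx => ?_
      by_cases hxH : x ∈ D \ H
      · simp [glue_mem hxH]
      · simp only [glue_notMem hxH, id, hx, iff_false]
        intro h
        by_cases hxD : x ∈ D
        · have : x ∈ H := by simpa [hxD] using hxH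
          exact Finset.disjoint_left.1 hCD (h ▸ (Finset.mem_filter.1 this).2) hc
        · exact hx ((hf'.1 x hxD).symm.trans h)

end Forests

section ForestCounts

variable {V : Type*} [Fintype V]

lemma mapSum_insert (a : ℕ → ℂ) {H C : Finset V} {c : V} (hc : c ∉ C)
    (hH : Disjoint H (insert c C)) :
    mapSum a H (insert c C) = ∑ J ∈ H.powerset, a J.card * mapSum a (H \ J) C := by
  unfold mapSum
  rw [← Finset.sum_fiberwise_of_maps_to (s := mapsOn H (insert c C)) (t := H.powerset)
    (g := fun f => H.filter fun d => f d = c) (fun f _ => by simp)]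
  refine Finset.sum_congr rfl fun J hJ => ?_
  rw [Finset.mem_powerset] at hJ
  have hcH : c ∉ H := fun h => Finset.disjoint_left.1 hH h (Finset.mem_insert_self _ _)
  have hCH : ∀ x ∈ H, x ∉ C := fun x hx h =>
    Finset.disjoint_left.1 hH hx (Finset.mem_insert_of_mem h)
  rw [Finset.mul_sum]
  refine Finset.sum_nbij' (fun f => glue (H \ J) f id) (fun f => glue J (fun _ => c) f)
    ?_ ?_ ?_ ?_ ?_
  · intro f hf
    simp only [Finset.mem_filter, mem_mapsOn] at hf ⊢
    obtain ⟨⟨-, hf⟩, rfl⟩ := hf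
    refine ⟨fun v hv => by simp [glue_notMem hv], fun d hd => ?_⟩
    rw [glue_mem hd]
    rw [Finset.mem_sdiff, Finset.mem_filter] at hd
    exact (Finset.mem_insert.1 (hf d hd.1)).resolve_left fun h => hd.2 ⟨hd.1, h⟩
  · intro f hf
    simp only [Finset.mem_filter, mem_mapsOn] at hf ⊢
    refine ⟨⟨fun v hv => ?_, fun d hd => ?_⟩, ?_⟩
    · rw [glue_notMem (fun h => hv (hJ h))]
      exact hf.1 v fun h => hv (Finset.mem_sdiff.1 h).1
    · by_cases hdJ : d ∈ J
      · simp [glue_mem hdJ]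
      · rw [glue_notMem hdJ]
        exact Finset.mem_insert_of_mem (hf.2 d (Finset.mem_sdiff.2 ⟨hd, hdJ⟩))
    · ext d
      simp only [Finset.mem_filter]
      constructor
      · rintro ⟨hd, h⟩
        by_contra hdJ
        rw [glue_notMem hdJ] at h
        exact hc (h ▸ hf.2 d (Finset.mem_sdiff.2 ⟨hd, hdJ⟩))
      · intro hd
        exact ⟨hJ hd, glue_mem hd⟩
  · intro f hf
    simp only [Finset.mem_filter, mem_mapsOn] at hf
    obtain ⟨⟨hf1, hf2⟩, rfl⟩ := hf
    funext v
    by_cases hv : v ∈ H.filter fun d => f d = c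
    · rw [glue_mem hv, (Finset.mem_filter.1 hv).2]
    · rw [glue_notMem hv]
      by_cases hv' : v ∈ H
      · rw [glue_mem (Finset.mem_sdiff.2 ⟨hv', hv⟩)]
      · rw [glue_notMem (fun h => hv' (Finset.mem_sdiff.1 h).1), hf1 v hv', id]
  · intro f hf
    simp only [mem_mapsOn] at hf
    funext v
    by_cases hv : v ∈ H \ J
    · rw [glue_mem hv, glue_notMem (Finset.mem_sdiff.1 hv).2]
    · rw [glue_notMem hv, hf.1 v hv, id]
  · intro f hf
    simp only [Finset.mem_filter, mem_mapsOn] at hf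
    obtain ⟨⟨hf1, hf2⟩, rfl⟩ := hf
    rw [Finset.prod_insert hc]
    congr 1
    · congr 2
      ext x
      simp only [mem_kids, Finset.mem_filter]
      constructor
      · rintro ⟨hx, h⟩
        refine ⟨?_, h⟩
        by_contra hxH
        exact hx ((hf1 x hxH).symm.trans h)
      · rintro ⟨hx, h⟩
        exact ⟨fun e => hcH (e ▸ hx), h⟩
    · refine Finset.prod_congr rfl fun e he => ?_
      congr 2
      ext x
      simp only [mem_kids]
      refine and_congr_right fun hx => ?_
      by_cases hxH : x ∈ H \ H.filter fun d => f d = c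
      · simp [glue_mem hxH]
      · simp only [glue_notMem hxH, id, hx, iff_false]
        intro h
        by_cases hxD : x ∈ H
        · have : f x = c := by simpa [hxD] using hxH
          exact hc (this ▸ h ▸ he)
        · exact hx ((hf1 x hxD).symm.trans h)

/-- The exponential generating function of a sequence. -/
def egf (a : ℕ → ℂ) : PowerSeries ℂ := PowerSeries.mk fun k => a k / (k.factorial : ℂ)

lemma mapSum_eq (a : ℕ → ℂ) {C : Finset V} : ∀ {H : Finset V}, Disjoint H C →
    mapSum a H C = (H.card.factorial : ℂ) * PowerSeries.coeff H.card (egf a ^ C.card) := by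
  induction C using Finset.induction_on with
  | empty =>
    intro H _
    unfold mapSum
    rcases H.eq_empty_or_nonempty with rfl | ⟨x, hx⟩
    · have : mapsOn (∅ : Finset V) ∅ = {id} := by
        ext f
        simp only [mem_mapsOn, Finset.mem_singleton]
        exact ⟨fun h => funext fun v => h.1 v (by simp), fun h => by subst h; simp⟩
      simp [this]
    · have : mapsOn H ∅ = ∅ := by
        ext f
        simp only [mem_mapsOn, Finset.notMem_empty, iff_false]
        exact fun h => h.2 x hx
      have h0 : H.card ≠ 0 := Finset.card_ne_zero.2 ⟨x, hx⟩
      simp [this, PowerSeries.coeff_one, h0]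
  | insert c C hc ih =>
    intro H hH
    rw [mapSum_insert a hc hH, Finset.card_insert_of_notMem hc, pow_succ', PowerSeries.coeff_mul,
      Finset.Nat.sum_antidiagonal_eq_sum_range_succ
        (fun i j => PowerSeries.coeff i (egf a) * PowerSeries.coeff j (egf a ^ C.card)),
      Finset.mul_sum]
    have : ∀ J ∈ H.powerset, a J.card * mapSum a (H \ J) C = a J.card *
        (((H.card - J.card).factorial : ℂ) *
          PowerSeries.coeff (H.card - J.card) (egf a ^ C.card)) := by
      intro J hJ
      rw [Finset.mem_powerset] at hJ
      rw [ih (Finset.disjoint_of_subset_left Finset.sdiff_subset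
        (Finset.disjoint_of_subset_right (Finset.subset_insert _ _) hH)),
        Finset.card_sdiff_of_subset hJ]
    rw [Finset.sum_congr rfl this, Finset.sum_powerset_apply_card (fun j => a j *
        (((H.card - j).factorial : ℂ) * PowerSeries.coeff (H.card - j) (egf a ^ C.card)))]
    refine Finset.sum_congr rfl fun j hj => ?_
    have hj' : j ≤ H.card := Nat.lt_succ_iff.1 (Finset.mem_range.1 hj)
    rw [egf, PowerSeries.coeff_mk, nsmul_eq_mul, ← Nat.choose_mul_factorial_mul_factorial hj']
    push_cast
    have : (j.factorial : ℂ) ≠ 0 := by exact_mod_cast j.factorial_ne_zero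
    field_simp

lemma forestSum_empty (a b : ℕ → ℂ) (C : Finset V) : forestSum a b C ∅ = a 0 ^ C.card := by
  have : forests C ∅ = {id} := by
    ext f
    simp only [mem_forests, Finset.mem_singleton]
    exact ⟨fun h => funext fun v => h.1 v (by simp), fun h => by subst h; simp⟩
  have h2 : ∀ c : V, kids id c = ∅ := fun c => by
    ext x
    simp [mem_kids]
  simp [forestSum, this, h2]

lemma forestSum_of_isEmpty (a b : ℕ → ℂ) {D : Finset V} (hD : D.Nonempty) :
    forestSum a b ∅ D = 0 := by
  have : forests (∅ : Finset V) D = ∅ := by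
    obtain ⟨x, hx⟩ := hD
    ext f
    simp only [mem_forests, Finset.notMem_empty, iff_false, not_and]
    exact fun _ h => by simpa using h x hx
  simp [forestSum, this]

/-- A recursion for numbers of forests in terms of the number of children of the roots. -/
lemma forestSum_eq_sum_range (a b : ℕ → ℂ) {C D : Finset V} (hCD : Disjoint C D)
    (φ : ℕ → ℕ → ℂ) (hφ : ∀ H ⊆ D, mapSum a H C ≠ 0 →
      forestSum b b H (D \ H) = φ H.card (D.card - H.card)) :
    forestSum a b C D = (D.card.factorial : ℂ) * ∑ h ∈ Finset.range (D.card + 1),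
      PowerSeries.coeff h (egf a ^ C.card) * (φ h (D.card - h) / (D.card - h).factorial) := by
  rw [forestSum_eq_sum_heads a b hCD]
  have : ∀ H ∈ D.powerset, mapSum a H C * forestSum b b H (D \ H) =
      ((H.card.factorial : ℂ) * PowerSeries.coeff H.card (egf a ^ C.card)) *
        φ H.card (D.card - H.card) := by
    intro H hH
    rw [Finset.mem_powerset] at hH
    rw [← mapSum_eq a (Finset.disjoint_of_subset_left hH hCD.symm)]
    by_cases h0 : mapSum a H C = 0
    · simp [h0]
    · rw [hφ H hH h0]
  rw [Finset.sum_congr rfl this, Finset.sum_powerset_apply_card (fun j =>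
    ((j.factorial : ℂ) * PowerSeries.coeff j (egf a ^ C.card)) * φ j (D.card - j)),
    Finset.mul_sum]
  refine Finset.sum_congr rfl fun j hj => ?_
  have hj' : j ≤ D.card := Nat.lt_succ_iff.1 (Finset.mem_range.1 hj)
  rw [nsmul_eq_mul, ← Nat.choose_mul_factorial_mul_factorial hj']
  push_cast
  have : ((D.card - j).factorial : ℂ) ≠ 0 := by exact_mod_cast (D.card - j).factorial_ne_zero
  field_simp

/-- The number of children of a vertex of a path. -/
def pathWeight (k : ℕ) : ℂ := if k ≤ 1 then 1 else 0

lemma egf_one : egf (fun _ => 1) = PowerSeries.exp ℂ := by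
  ext k
  simp [egf, PowerSeries.coeff_exp]

lemma egf_pathWeight : egf pathWeight = 1 + PowerSeries.X := by
  ext k
  rw [egf, PowerSeries.coeff_mk, map_add, PowerSeries.coeff_one, PowerSeries.coeff_X, pathWeight]
  rcases k with _ | _ | k <;> simp

lemma coeff_egf_one_pow (h c : ℕ) :
    PowerSeries.coeff h (egf (fun _ => 1) ^ c) = (c : ℂ) ^ h / h.factorial := by
  rw [egf_one, PowerSeries.exp_pow_eq_rescale_exp, PowerSeries.coeff_rescale,
    PowerSeries.coeff_exp]
  simp [div_eq_mul_inv]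

lemma coeff_egf_pathWeight_pow (h c : ℕ) :
    PowerSeries.coeff h (egf pathWeight ^ c) = (c.choose h : ℂ) := by
  have : ((1 + PowerSeries.X : PowerSeries ℂ)) ^ c =
      (((1 + Polynomial.X) ^ c : Polynomial ℂ) : PowerSeries ℂ) := by
    push_cast; rfl
  rw [egf_pathWeight, this, Polynomial.coeff_coe, Polynomial.coeff_one_add_X_pow]

lemma forestSum_pathWeight {D : Finset V} : ∀ {C : Finset V}, Disjoint C D →
    forestSum pathWeight pathWeight C D =
      (D.card.factorial : ℂ) * ((C.card + D.card - 1).choose D.card : ℂ) := by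
  induction D using Finset.strongInduction with
  | H D ih =>
    intro C hCD
    rcases D.eq_empty_or_nonempty with rfl | hD
    · simp [forestSum_empty, pathWeight]
    have hd : 1 ≤ D.card := hD.card_pos
    rw [forestSum_eq_sum_range pathWeight pathWeight hCD
      (fun h k => k.factorial * ((h + k - 1).choose k : ℂ))]
    · congr 1
      rw [show C.card + D.card - 1 = C.card + (D.card - 1) by omega, Nat.add_choose_eq,
        Finset.Nat.sum_antidiagonal_eq_sum_range_succ
          (fun i j => C.card.choose i * (D.card - 1).choose j)]
      push_cast
      refine Finset.sum_congr rfl fun h hh => ?_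
      have hh' : h ≤ D.card := Nat.lt_succ_iff.1 (Finset.mem_range.1 hh)
      have : ((D.card - h).factorial : ℂ) ≠ 0 := by
        exact_mod_cast (D.card - h).factorial_ne_zero
      rw [coeff_egf_pathWeight_pow, mul_div_cancel_left₀ _ this, Nat.add_sub_of_le hh']
    · intro H hH h0
      rcases H.eq_empty_or_nonempty with rfl | hne
      · simp [forestSum_of_isEmpty _ _ hD,
          Nat.choose_eq_zero_of_lt (show D.card - 1 < D.card by omega)]
      · rw [ih (D \ H) (Finset.sdiff_ssubset hH hne) Finset.disjoint_sdiff,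
          Finset.card_sdiff_of_subset hH]

lemma forestSum_leg (u : ℕ → ℂ) {C D : Finset V} (hCD : Disjoint C D) :
    forestSum u pathWeight C D = (D.card.factorial : ℂ) * ∑ h ∈ Finset.range (D.card + 1),
      PowerSeries.coeff h (egf u ^ C.card) * ((D.card - 1).choose (D.card - h) : ℂ) := by
  rw [forestSum_eq_sum_range u pathWeight hCD
      (fun h k => k.factorial * ((h + k - 1).choose k : ℂ))]
  · congr 1
    refine Finset.sum_congr rfl fun h hh => ?_
    have hh' : h ≤ D.card := Nat.lt_succ_iff.1 (Finset.mem_range.1 hh)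
    have : ((D.card - h).factorial : ℂ) ≠ 0 := by
      exact_mod_cast (D.card - h).factorial_ne_zero
    rw [mul_div_cancel_left₀ _ this, Nat.add_sub_of_le hh']
  · intro H hH _
    rw [forestSum_pathWeight Finset.disjoint_sdiff, Finset.card_sdiff_of_subset hH]

lemma forestSum_one {D : Finset V} : ∀ {C : Finset V}, Disjoint C D →
    ((C.card + D.card : ℕ) : ℂ) * forestSum (fun _ => 1) (fun _ => 1) C D =
      C.card * ((C.card + D.card : ℕ) : ℂ) ^ D.card := by
  induction D using Finset.strongInduction with
  | H D ih =>
    intro C hCD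
    rcases D.eq_empty_or_nonempty with rfl | hD
    · simp [forestSum_empty]
    obtain ⟨d, hd⟩ : ∃ d, D.card = d + 1 := ⟨D.card - 1, by have := hD.card_pos; omega⟩
    have hd0 : ((d + 1 : ℕ) : ℂ) ≠ 0 := by exact_mod_cast d.succ_ne_zero
    rw [forestSum_eq_sum_range _ _ hCD
      (fun h k => h * ((d + 1 : ℕ) : ℂ) ^ k / ((d + 1 : ℕ) : ℂ))]
    · rw [hd, pow_succ, mul_comm, ← mul_assoc]
      congr 1
      rw [Finset.sum_range_succ', Nat.cast_zero, zero_mul, zero_div, zero_div, mul_zero, add_zero,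
        Finset.mul_sum, Nat.cast_add C.card (d + 1), add_pow, Finset.mul_sum]
      refine Finset.sum_congr rfl fun k hk => ?_
      have hk' : k ≤ d := Nat.lt_succ_iff.1 (Finset.mem_range.1 hk)
      rw [coeff_egf_one_pow, Nat.add_sub_add_right, Nat.factorial_succ, Nat.factorial_succ,
        ← Nat.choose_mul_factorial_mul_factorial hk']
      have h1 : ((d - k).factorial : ℂ) ≠ 0 := by exact_mod_cast (d - k).factorial_ne_zero
      have h2 : (k.factorial : ℂ) ≠ 0 := by exact_mod_cast k.factorial_ne_zero
      have h3 : ((k + 1 : ℕ) : ℂ) ≠ 0 := by exact_mod_cast k.succ_ne_zero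
      push_cast at *
      field_simp
      ring
    · intro H hH _
      rcases H.eq_empty_or_nonempty with rfl | hne
      · simp [forestSum_of_isEmpty _ _ hD]
      · have h1 := ih (D \ H) (Finset.sdiff_ssubset hH hne) (C := H) Finset.disjoint_sdiff
        rw [Finset.card_sdiff_of_subset hH, Nat.add_sub_of_le (Finset.card_le_card hH), hd] at h1
        rw [hd, eq_div_iff hd0, mul_comm]
        exact h1

/-- Parent functions of rooted trees with vertex set `C`, extended by the identity. -/
def rootedOn (C : Finset V) : Finset (V → V) := C.biUnion fun r => forests {r} (C.erase r)

lemma card_rootedOn (C : Finset V) :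
    (C.card : ℂ) * ((rootedOn C).card : ℂ) = if C.card = 0 then 0 else (C.card : ℂ) ^ C.card := by
  rcases C.eq_empty_or_nonempty with rfl | hC
  · simp
  rw [if_neg hC.card_pos.ne', rootedOn, Finset.card_biUnion]
  · push_cast
    rw [Finset.mul_sum]
    have : ∀ r ∈ C, (C.card : ℂ) * ((forests {r} (C.erase r)).card : ℂ) =
        (C.card : ℂ) ^ (C.card - 1) := by
      intro r hr
      have h := forestSum_one (C := {r}) (D := C.erase r) (by simp)
      have hc := hC.card_pos
      simpa [forestSum, Finset.card_erase_of_mem hr, Nat.cast_sub hc] using h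
    rw [Finset.sum_congr rfl this, Finset.sum_const, nsmul_eq_mul, ← pow_succ',
      Nat.sub_add_cancel hC.card_pos]
  · intro r hr s hs hrs
    rw [Function.onFun, Finset.disjoint_left]
    intro f hf hg
    rw [mem_forests] at hf hg
    obtain ⟨k, hk⟩ := hg.2 r (Finset.mem_erase.2 ⟨hrs, hr⟩)
    rw [Function.iterate_fixed (hf.1 r (by simp))] at hk
    exact hrs (by simpa using hk)

end ForestCounts

section PathBranches

variable {V : Type*}

/-- The binomial inverse of `k ↦ y ^ (k - 1)`. -/
def legWeight (y : ℂ) (i : ℕ) : ℂ := (1 - 1 / y) * (-1) ^ i + (y - 1) ^ i / y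

lemma legWeight_zero (y : ℂ) : legWeight y 0 = 1 := by simp [legWeight]

lemma legWeight_one {y : ℂ} (hy : y ≠ 0) : legWeight y 1 = 0 := by
  simp only [legWeight]; field_simp; ring

lemma sum_powerset_legWeight {y : ℂ} (hy : y ≠ 0) (A : Finset V) :
    ∑ S ∈ A.powerset, legWeight y S.card = y ^ (A.card - 1) := by
  rw [Finset.sum_powerset_apply_card]
  have h := fun z : ℂ => add_pow z 1 A.card
  simp only [one_pow, mul_one] at h
  have e : ∀ j ∈ Finset.range (A.card + 1), A.card.choose j • legWeight y j =
      (1 - 1 / y) * ((-1) ^ j * (A.card.choose j : ℂ)) +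
        (y - 1) ^ j * (A.card.choose j : ℂ) / y := by
    intro j _
    rw [nsmul_eq_mul, legWeight]; ring
  rw [Finset.sum_congr rfl e, Finset.sum_add_distrib, ← Finset.mul_sum, ← Finset.sum_div, ← h, ← h]
  rcases A.card with _ | k
  · simp
  · simp only [neg_add_cancel, ne_eq, Nat.add_eq_zero_iff, one_ne_zero, and_false,
      not_false_eq_true, zero_pow, mul_zero, zero_add, sub_add_cancel, Nat.add_sub_cancel]
    rw [pow_succ]; field_simp

lemma iterate_mem {F : V → V} {C : Finset V} (hC : ∀ c ∈ C, F c ∈ C) {w : V} (hw : w ∈ C) :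
    ∀ k, F^[k] w ∈ C := by
  intro k
  induction k with
  | zero => exact hw
  | succ k ih => rw [Function.iterate_succ_apply']; exact hC _ ih

variable [Fintype V]

/-- `F` is the parent function of a tree with root `r`. -/
def IsRooted (F : V → V) (r : V) : Prop := F r = r ∧ ∀ w, ∃ k, F^[k] w = r

lemma mem_rootedOn_univ {F : V → V} : F ∈ rootedOn Finset.univ ↔ ∃ r, IsRooted F r := by
  simp only [rootedOn, Finset.mem_biUnion, Finset.mem_univ, true_and, mem_forests,
    Finset.mem_erase, and_true, Finset.mem_singleton, not_not, forall_eq, IsRooted]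
  refine exists_congr fun r => and_congr_right fun _ => ⟨fun h w => ?_, fun h w _ => h w⟩
  by_cases hw : w = r
  · exact ⟨0, hw⟩
  · exact h w hw

/-- The descendants of `x` form a path that avoids `v₀`. -/
def PathSub (F : V → V) (v₀ x : V) : Prop :=
  ∀ w, (∃ k, F^[k] w = x) → w ≠ v₀ ∧ (kids F w).card ≤ 1

/-- The children of `v` whose descendants form a path avoiding `v₀`. -/
def pathKids (F : V → V) (v₀ v : V) : Finset V := (kids F v).filter (PathSub F v₀)

/-- The tree approximation of the metric dimension, with the marked vertex `v₀`. -/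
def betaF (F : V → V) (v₀ : V) : ℕ := ∑ v, ((pathKids F v₀ v).card - 1)

/-- The vertices that remain after removing the branches at the vertices chosen by `p`. -/
def remaining (F : V → V) (p : V → Finset V) : Finset V :=
  Finset.univ.filter fun w => ∀ k, F^[k] w ∉ p (F^[k + 1] w)

lemma mem_remaining {F : V → V} {p : V → Finset V} {w : V} :
    w ∈ remaining F p ↔ ∀ k, F^[k] w ∉ p (F^[k + 1] w) := by
  simp only [remaining, Finset.mem_filter, Finset.mem_univ, true_and]

/-- The children of vertices of `C` that are not in `C`. -/
def outKids (F : V → V) (C : Finset V) (v : V) : Finset V := if v ∈ C then kids F v \ C else ∅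

lemma pow_betaF {y : ℂ} (hy : y ≠ 0) {F : V → V} {r : V} (hF : IsRooted F r) (v₀ : V) :
    y ^ betaF F v₀ = ∑ C : Finset V, if v₀ ∈ C ∧ ∀ c ∈ C, F c ∈ C then
      (∏ c ∈ C, legWeight y (kids F c \ C).card) * ∏ d ∈ Cᶜ, pathWeight (kids F d).card else 0 := by
  have h1 : y ^ betaF F v₀ = ∑ p ∈ (Fintype.piFinset fun v => (pathKids F v₀ v).powerset).filter
      (fun p => ∀ v, (p v).card ≠ 1), ∏ v, legWeight y (p v).card := by
    rw [betaF, ← Finset.prod_pow_eq_pow_sum, Finset.sum_filter_of_ne,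
      ← Finset.prod_univ_sum (fun v => (pathKids F v₀ v).powerset)
        (fun v S => legWeight y S.card)]
    · exact Finset.prod_congr rfl fun v _ => (sum_powerset_legWeight hy _).symm
    · intro p _ hp v hv
      exact hp (Finset.prod_eq_zero (Finset.mem_univ v) (by rw [hv, legWeight_one hy]))
  have h2 : (∑ C : Finset V, if v₀ ∈ C ∧ ∀ c ∈ C, F c ∈ C then
      (∏ c ∈ C, legWeight y (kids F c \ C).card) * ∏ d ∈ Cᶜ, pathWeight (kids F d).card else 0) =
      ∑ C ∈ Finset.univ.filter (fun C : Finset V => (v₀ ∈ C ∧ ∀ c ∈ C, F c ∈ C) ∧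
        (∀ c ∈ C, (kids F c \ C).card ≠ 1) ∧ ∀ d ∉ C, (kids F d).card ≤ 1),
        ∏ c ∈ C, legWeight y (kids F c \ C).card := by
    rw [Finset.sum_filter]
    refine Finset.sum_congr rfl fun C _ => ?_
    by_cases hC : v₀ ∈ C ∧ ∀ c ∈ C, F c ∈ C
    · rw [if_pos hC]
      by_cases h3 : ∀ c ∈ C, (kids F c \ C).card ≠ 1
      · by_cases h4 : ∀ d ∉ C, (kids F d).card ≤ 1
        · rw [if_pos ⟨hC, h3, h4⟩]
          rw [Finset.prod_eq_one (s := Cᶜ), mul_one]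
          intro d hd
          rw [pathWeight, if_pos (h4 d (Finset.mem_compl.1 hd))]
        · rw [if_neg (fun h => h4 h.2.2)]
          push Not at h4
          obtain ⟨d, hd, h⟩ := h4
          rw [Finset.prod_eq_zero (Finset.mem_compl.2 hd), mul_zero]
          rw [pathWeight, if_neg (by omega)]
      · rw [if_neg (fun h => h3 h.2.1)]
        push Not at h3
        obtain ⟨c, hc, h⟩ := h3
        rw [Finset.prod_eq_zero hc, zero_mul]
        rw [h, legWeight_one hy]
    · rw [if_neg hC, if_neg (fun h => hC h.1)]
  rw [h1, h2]
  have hpk : ∀ {p : V → Finset V}, (p ∈ (Fintype.piFinset fun v => (pathKids F v₀ v).powerset).filter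
      (fun p => ∀ v, (p v).card ≠ 1)) ↔
      (∀ v, ∀ x ∈ p v, (x ≠ v ∧ F x = v) ∧ PathSub F v₀ x) ∧ ∀ v, (p v).card ≠ 1 := by
    intro p
    rw [Finset.mem_filter, Fintype.mem_piFinset]
    refine and_congr_left fun _ => forall_congr' fun v => ?_
    rw [Finset.mem_powerset, Finset.subset_iff]
    simp [pathKids, mem_kids]
  have hrem : ∀ {p : V → Finset V}, ((∀ v, ∀ x ∈ p v, (x ≠ v ∧ F x = v) ∧ PathSub F v₀ x) ∧
      ∀ v, (p v).card ≠ 1) → outKids F (remaining F p) = p := by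
    rintro p ⟨hp1, hp2⟩
    funext v
    by_cases hv : v ∈ remaining F p
    · rw [outKids, if_pos hv]
      rw [mem_remaining] at hv
      ext x
      rw [Finset.mem_sdiff, mem_kids, mem_remaining]
      constructor
      · rintro ⟨⟨-, rfl⟩, h⟩
        by_contra hx
        refine h fun k => ?_
        cases k with
        | zero => exact hx
        | succ k => exact hv k
      · intro hx
        refine ⟨(hp1 v x hx).1, fun h => h 0 ?_⟩
        simpa [(hp1 v x hx).1.2] using hx
    · rw [outKids, if_neg hv]
      rw [mem_remaining] at hv
      push Not at hv
      obtain ⟨k, hk⟩ := hv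
      have h3 := ((hp1 _ _ hk).2 v ⟨k, rfl⟩).2
      have h4 : p v ⊆ kids F v := fun x hx => mem_kids.2 (hp1 v x hx).1
      have h5 := Finset.card_le_card h4
      have h6 := hp2 v
      exact (Finset.card_eq_zero.1 (by omega)).symm
  refine Finset.sum_nbij' (remaining F) (outKids F) ?_ ?_ ?_ ?_ ?_
  · intro p hp
    rw [hpk] at hp
    have ho := hrem hp
    obtain ⟨hp1, hp2⟩ := hp
    rw [Finset.mem_filter]
    refine ⟨Finset.mem_univ _, ⟨?_, ?_⟩, ?_, ?_⟩
    · rw [mem_remaining]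
      intro k hk
      exact ((hp1 _ _ hk).2 v₀ ⟨k, rfl⟩).1 rfl
    · intro c hc
      rw [mem_remaining] at hc ⊢
      exact fun k => hc (k + 1)
    · intro c hc
      have := congrFun ho c
      rw [outKids, if_pos hc] at this
      rw [this]
      exact hp2 c
    · intro d hd
      rw [mem_remaining] at hd
      push Not at hd
      obtain ⟨k, hk⟩ := hd
      exact ((hp1 _ _ hk).2 d ⟨k, rfl⟩).2
  · intro C hC
    rw [Finset.mem_filter] at hC
    obtain ⟨-, ⟨hv, hcl⟩, hC1, hC2⟩ := hC
    rw [hpk]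
    constructor
    · intro v x hx
      by_cases hvC : v ∈ C
      · rw [outKids, if_pos hvC, Finset.mem_sdiff, mem_kids] at hx
        refine ⟨hx.1, ?_⟩
        rintro w ⟨k, rfl⟩
        have hw : w ∉ C := fun h => hx.2 (iterate_mem hcl h k)
        exact ⟨fun h => hw (h ▸ hv), hC2 w hw⟩
      · rw [outKids, if_neg hvC] at hx
        exact absurd hx (Finset.notMem_empty _)
    · intro v
      by_cases hvC : v ∈ C
      · rw [outKids, if_pos hvC]; exact hC1 v hvC
      · rw [outKids, if_neg hvC]; simp
  · intro p hp
    exact hrem (hpk.1 hp)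
  · intro C hC
    rw [Finset.mem_filter] at hC
    obtain ⟨-, ⟨hv, hcl⟩, hC1, hC2⟩ := hC
    have hr : r ∈ C := by
      obtain ⟨k, hk⟩ := hF.2 v₀
      exact hk ▸ iterate_mem hcl hv k
    ext w
    rw [mem_remaining]
    constructor
    · intro h
      by_contra hw
      have hex : ∃ k, F^[k] w ∈ C := by
        obtain ⟨k, hk⟩ := hF.2 w
        exact ⟨k, hk ▸ hr⟩
      obtain ⟨j, hj⟩ : ∃ j, Nat.find hex = j + 1 := by
        refine Nat.exists_eq_succ_of_ne_zero fun h0 => ?_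
        have := Nat.find_spec hex
        rw [h0] at this
        exact hw this
      have e1 : F^[j + 1] w ∈ C := hj ▸ Nat.find_spec hex
      have e2 : F^[j] w ∉ C := Nat.find_min hex (by omega)
      apply h j
      rw [outKids, if_pos e1, Finset.mem_sdiff, mem_kids]
      refine ⟨⟨fun e => e2 (by rw [e]; exact e1), ?_⟩, e2⟩
      rw [Function.iterate_succ_apply']
    · intro hw k hk
      rw [outKids, if_pos (iterate_mem hcl hw _), Finset.mem_sdiff] at hk
      exact hk.2 (iterate_mem hcl hw _)
  · intro p hp
    have ho := hrem (hpk.1 hp)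
    rw [← Finset.prod_mul_prod_compl (remaining F p)]
    have h5 : ∏ v ∈ (remaining F p)ᶜ, legWeight y (p v).card = 1 := by
      refine Finset.prod_eq_one fun v hv => ?_
      have := congrFun ho v
      rw [outKids, if_neg (Finset.mem_compl.1 hv)] at this
      rw [← this, Finset.card_empty, legWeight_zero]
    rw [h5, mul_one]
    refine Finset.prod_congr rfl fun v hv => ?_
    have := congrFun ho v
    rw [outKids, if_pos hv] at this
    rw [this]

end PathBranches

section Decomposition

variable {V : Type*}

lemma iterate_glue_mem {C : Finset V} {f g : V → V} (hC : ∀ c ∈ C, f c ∈ C) {w : V} (hw : w ∈ C)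
    (k : ℕ) : (glue C f g)^[k] w = f^[k] w := by
  induction k generalizing w with
  | zero => rfl
  | succ k ih => rw [Function.iterate_succ_apply, Function.iterate_succ_apply, glue_mem hw,
      ih (hC w hw)]

lemma exists_iterate_mem_of_eqOn {C : Finset V} {f g : V → V} (hfg : ∀ v ∉ C, f v = g v) :
    ∀ (k : ℕ) (w : V), f^[k] w ∈ C → ∃ j, g^[j] w ∈ C := by
  intro k
  induction k with
  | zero => exact fun w h => ⟨0, h⟩
  | succ k ih =>
    intro w h
    by_cases hw : w ∈ C
    · exact ⟨0, hw⟩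
    · obtain ⟨j, hj⟩ := ih (f w) h
      exact ⟨j + 1, by rwa [Function.iterate_succ_apply, ← hfg w hw]⟩

variable [Fintype V]

lemma mem_rootedOn {C : Finset V} {F : V → V} :
    F ∈ rootedOn C ↔ ∃ r ∈ C, F r = r ∧ (∀ v ∉ C, F v = v) ∧ ∀ d ∈ C, ∃ k, F^[k] d = r := by
  simp only [rootedOn, Finset.mem_biUnion, mem_forests, Finset.mem_erase, Finset.mem_singleton]
  refine exists_congr fun r => and_congr_right fun hr => ⟨?_, ?_⟩
  · rintro ⟨h1, h2⟩
    refine ⟨h1 r (by simp), fun v hv => h1 v (fun h => hv h.2), fun d hd => ?_⟩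
    by_cases hdr : d = r
    · exact ⟨0, hdr⟩
    · exact h2 d ⟨hdr, hd⟩
  · rintro ⟨h1, h2, h3⟩
    refine ⟨fun v hv => ?_, fun d hd => h3 d hd.2⟩
    by_cases hvr : v = r
    · rw [hvr, h1]
    · exact h2 v (fun h => hv ⟨hvr, h⟩)

lemma rootedOn_mapsTo {C : Finset V} {F : V → V} (hF : F ∈ rootedOn C) : ∀ c ∈ C, F c ∈ C := by
  obtain ⟨r, hr, h1, h2, h3⟩ := mem_rootedOn.1 hF
  intro c hc
  by_contra h
  obtain ⟨k, hk⟩ := h3 c hc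
  cases k with
  | zero =>
    obtain rfl : c = r := hk
    exact h (h1.symm ▸ hr)
  | succ k =>
    rw [Function.iterate_succ_apply, Function.iterate_fixed (h2 _ h)] at hk
    exact h (hk ▸ hr)

lemma sum_rootedOn_closed (a b : ℕ → ℂ) {C : Finset V} (hC : C.Nonempty) :
    ∑ F ∈ (rootedOn Finset.univ).filter (fun F : V → V => ∀ c ∈ C, F c ∈ C),
      (∏ c ∈ C, a (kids F c \ C).card) * ∏ d ∈ Cᶜ, b (kids F d).card =
      (rootedOn C).card * forestSum a b C Cᶜ := by
  rw [forestSum, ← nsmul_eq_mul, ← Finset.sum_const, ← Finset.sum_product']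
  refine Finset.sum_nbij' (fun F => (glue C F id, glue Cᶜ F id)) (fun p => glue C p.1 p.2)
    ?_ ?_ ?_ ?_ ?_
  · intro F hF
    rw [Finset.mem_filter, mem_rootedOn_univ] at hF
    obtain ⟨⟨r, hr, hF⟩, hcl⟩ := hF
    have hrC : r ∈ C := by
      obtain ⟨c, hc⟩ := hC
      obtain ⟨k, hk⟩ := hF c
      exact hk ▸ iterate_mem hcl hc k
    rw [Finset.mem_product, mem_rootedOn, mem_forests]
    refine ⟨⟨r, hrC, ?_, fun v hv => ?_, fun d hd => ?_⟩, fun v hv => ?_, fun d hd => ?_⟩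
    · exact (glue_mem hrC).trans hr
    · exact glue_notMem hv
    · obtain ⟨k, hk⟩ := hF d
      exact ⟨k, by rw [iterate_glue_mem hcl hd, hk]⟩
    · exact glue_notMem hv
    · obtain ⟨k, hk⟩ := hF d
      refine exists_iterate_mem_of_eqOn (f := F) (fun v hv => ?_) k d (by rwa [hk])
      exact (glue_mem (Finset.mem_compl.2 hv)).symm
  · rintro ⟨g, f⟩ h
    simp only [Finset.mem_product] at h
    obtain ⟨hg, hf⟩ := h
    have hcl := rootedOn_mapsTo hg
    obtain ⟨r, hrC, hr, -, hg3⟩ := mem_rootedOn.1 hg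
    rw [mem_forests] at hf
    rw [Finset.mem_filter, mem_rootedOn_univ]
    refine ⟨⟨r, (glue_mem hrC).trans hr, fun w => ?_⟩, fun c hc => by
      rw [glue_mem hc]; exact hcl c hc⟩
    have h1 : ∃ j, (glue C g f)^[j] w ∈ C := by
      by_cases hw : w ∈ C
      · exact ⟨0, hw⟩
      · obtain ⟨k, hk⟩ := hf.2 w (Finset.mem_compl.2 hw)
        exact exists_iterate_mem_of_eqOn (fun v hv => (glue_notMem hv).symm) k w hk
    obtain ⟨j, hj⟩ := h1
    obtain ⟨k, hk⟩ := hg3 _ hj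
    exact ⟨k + j, by rw [Function.iterate_add_apply, iterate_glue_mem hcl hj, hk]⟩
  · intro F _
    funext v
    by_cases hv : v ∈ C
    · simp [glue_mem hv]
    · simp [glue_notMem hv, glue_mem (Finset.mem_compl.2 hv)]
  · rintro ⟨g, f⟩ h
    simp only [Finset.mem_product, mem_forests] at h
    obtain ⟨hg, hf, -⟩ := h
    obtain ⟨r, -, -, hg2, -⟩ := mem_rootedOn.1 hg
    refine Prod.ext (funext fun v => ?_) (funext fun v => ?_)
    · by_cases hv : v ∈ C
      · simp [glue_mem hv]
      · simp [glue_notMem hv, hg2 v hv]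
    · by_cases hv : v ∈ C
      · have : v ∉ Cᶜ := fun h => Finset.mem_compl.1 h hv
        simp [glue_notMem this, hf v this]
      · simp [glue_notMem hv, glue_mem (Finset.mem_compl.2 hv)]
  · intro F hF
    rw [Finset.mem_filter] at hF
    have hcl := hF.2
    congr 1
    · refine Finset.prod_congr rfl fun c hc => ?_
      congr 2
      ext x
      rw [Finset.mem_sdiff, mem_kids, mem_kids]
      by_cases hx : x ∈ C
      · have : x ∉ Cᶜ := fun h => Finset.mem_compl.1 h hx
        simp only [glue_notMem this, id, hx, not_true_eq_false, and_false, false_iff]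
        exact fun h => h.1 h.2
      · simp [glue_mem (Finset.mem_compl.2 hx), hx]
    · refine Finset.prod_congr rfl fun d hd => ?_
      congr 2
      ext x
      rw [mem_kids, mem_kids]
      by_cases hx : x ∈ C
      · have : x ∉ Cᶜ := fun h => Finset.mem_compl.1 h hx
        simp only [glue_notMem this, id]
        have h1 : F x ≠ d := fun h => Finset.mem_compl.1 hd (h ▸ hcl x hx)
        simp only [h1, and_false, false_iff]
        exact fun h => h.1 h.2
      · simp [glue_mem (Finset.mem_compl.2 hx)]

lemma sum_pow_betaF {y : ℂ} (hy : y ≠ 0) :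
    ∑ F ∈ rootedOn (Finset.univ : Finset V), ∑ v₀ : V, y ^ betaF F v₀ =
      ∑ C : Finset V, (C.card : ℂ) * (rootedOn C).card *
        forestSum (legWeight y) pathWeight C Cᶜ := by
  have h1 : ∀ F ∈ rootedOn (Finset.univ : Finset V), ∑ v₀ : V, y ^ betaF F v₀ =
      ∑ C : Finset V, if ∀ c ∈ C, F c ∈ C then
        (C.card : ℂ) * ((∏ c ∈ C, legWeight y (kids F c \ C).card) *
          ∏ d ∈ Cᶜ, pathWeight (kids F d).card) else 0 := by
    intro F hF
    obtain ⟨r, hr⟩ := mem_rootedOn_univ.1 hF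
    rw [Finset.sum_congr rfl fun v₀ _ => pow_betaF hy hr v₀, Finset.sum_comm]
    refine Finset.sum_congr rfl fun C _ => ?_
    split_ifs with h
    · rw [← nsmul_eq_mul, ← Finset.sum_const, ← Finset.univ_inter C, ← Finset.sum_ite_mem,
        Finset.univ_inter]
      exact Finset.sum_congr rfl fun v₀ _ => if_congr (and_iff_left h) rfl rfl
    · simp [h]
  rw [Finset.sum_congr rfl h1, Finset.sum_comm]
  refine Finset.sum_congr rfl fun C _ => ?_
  rcases C.eq_empty_or_nonempty with rfl | hC
  · simp
  · rw [← Finset.sum_filter, ← Finset.mul_sum, sum_rootedOn_closed _ _ hC, mul_assoc]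

end Decomposition

section LegSeries

/-- The power series `X / (1 - X)`. -/
def pathSeries : PowerSeries ℂ := PowerSeries.X * PowerSeries.mk 1

lemma hasSubst_pathSeries : PowerSeries.HasSubst pathSeries :=
  PowerSeries.HasSubst.of_constantCoeff_zero' (by simp [pathSeries])

lemma coeff_pathSeries_pow (h k : ℕ) : PowerSeries.coeff k (pathSeries ^ h) =
    if h ≤ k then ((k - 1).choose (k - h) : ℂ) else 0 := by
  rw [pathSeries, mul_pow, PowerSeries.coeff_X_pow_mul']
  split_ifs with hk
  · rcases h with _ | h
    · rcases k with _ | k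
      · simp
      · simp [PowerSeries.coeff_one]
    · rw [PowerSeries.mk_one_pow_eq_mk_choose_add, PowerSeries.coeff_mk]
      congr 1
      rw [show k - 1 = h + (k - (h + 1)) by omega, Nat.choose_symm_add]
  · rfl

/-- The exponential generating function of `legWeight`, composed with `X / (1 - X)`. -/
def legSeries (y : ℂ) : PowerSeries ℂ := (egf (legWeight y)).subst pathSeries

lemma coeff_legSeries_pow (y : ℂ) (m k : ℕ) :
    PowerSeries.coeff k (legSeries y ^ m) = ∑ h ∈ Finset.range (k + 1),
      PowerSeries.coeff h (egf (legWeight y) ^ m) * ((k - 1).choose (k - h) : ℂ) := by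
  rw [legSeries, ← PowerSeries.subst_pow hasSubst_pathSeries,
    PowerSeries.coeff_subst' hasSubst_pathSeries, finsum_eq_sum_of_support_subset
      (s := Finset.range (k + 1))]
  · refine Finset.sum_congr rfl fun h hh => ?_
    rw [coeff_pathSeries_pow, if_pos (Nat.lt_succ_iff.1 (Finset.mem_range.1 hh)), smul_eq_mul]
  · intro h hh
    rw [Finset.coe_range, Set.mem_Iio]
    by_contra hk
    apply hh
    simp only [coeff_pathSeries_pow]
    rw [if_neg (by omega), smul_zero]

lemma sum_pow_betaF_eq {V : Type*} [Fintype V] {n : ℕ} (hV : Fintype.card V = n) (hn : n ≠ 0)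
    {y : ℂ} (hy : y ≠ 0) :
    ∑ F ∈ rootedOn (Finset.univ : Finset V), ∑ v₀ : V, y ^ betaF F v₀ =
      (n.factorial : ℂ) * ∑ m ∈ Finset.range (n + 1),
        (m : ℂ) ^ m / m.factorial * PowerSeries.coeff (n - m) (legSeries y ^ m) := by
  rw [sum_pow_betaF hy]
  have h1 : ∀ C : Finset V, (C.card : ℂ) * (rootedOn C).card *
        forestSum (legWeight y) pathWeight C Cᶜ = (if C.card = 0 then 0 else (C.card : ℂ) ^ C.card) *
          (((n - C.card).factorial : ℂ) *
            PowerSeries.coeff (n - C.card) (legSeries y ^ C.card)) := by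
    intro C
    rw [card_rootedOn, forestSum_leg _ disjoint_compl_right, Finset.card_compl, hV,
      coeff_legSeries_pow]
  rw [Finset.sum_congr rfl fun C _ => h1 C, ← Finset.powerset_univ,
    Finset.sum_powerset_apply_card (fun m => (if m = 0 then 0 else (m : ℂ) ^ m) *
          (((n - m).factorial : ℂ) * PowerSeries.coeff (n - m) (legSeries y ^ m))),
    Finset.card_univ, hV, Finset.mul_sum]
  refine Finset.sum_congr rfl fun m hm => ?_
  have hm' : m ≤ n := Nat.lt_succ_iff.1 (Finset.mem_range.1 hm)
  rcases Nat.eq_zero_or_pos m with rfl | hm0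
  · simp [PowerSeries.coeff_one, hn]
  · rw [if_neg hm0.ne', nsmul_eq_mul, ← Nat.choose_mul_factorial_mul_factorial hm']
    have : (m.factorial : ℂ) ≠ 0 := by exact_mod_cast m.factorial_ne_zero
    push_cast
    field_simp

lemma card_rootedOn_univ (n : ℕ) (hn : n ≠ 0) :
    (n : ℂ) * (rootedOn (Finset.univ : Finset (Fin n))).card = (n : ℂ) ^ n := by
  simpa [hn] using card_rootedOn (Finset.univ : Finset (Fin n))

end LegSeries

section TreeDistances

variable {V : Type*}

/-- The graph with an edge from each vertex to its parent. -/
def parentGraph (F : V → V) : SimpleGraph V := SimpleGraph.fromRel fun a b => F a = b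

lemma parentGraph_adj {F : V → V} {a b : V} :
    (parentGraph F).Adj a b ↔ a ≠ b ∧ (F a = b ∨ F b = a) := by simp [parentGraph]

/-- `w` is a descendant of `x`. -/
def Desc (F : V → V) (w x : V) : Prop := ∃ k, F^[k] w = x

lemma Desc.refl (F : V → V) (w : V) : Desc F w w := ⟨0, rfl⟩

lemma Desc.trans {F : V → V} {a b c : V} (h : Desc F a b) (h' : Desc F b c) : Desc F a c := by
  obtain ⟨k, rfl⟩ := h
  obtain ⟨j, rfl⟩ := h'
  exact ⟨j + k, Function.iterate_add_apply _ _ _ _⟩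

lemma Desc.total {F : V → V} {w x y : V} (hx : Desc F w x) (hy : Desc F w y) :
    Desc F x y ∨ Desc F y x := by
  obtain ⟨k, rfl⟩ := hx
  obtain ⟨j, rfl⟩ := hy
  rcases le_total k j with h | h
  · exact Or.inl ⟨j - k, by rw [← Function.iterate_add_apply, Nat.sub_add_cancel h]⟩
  · exact Or.inr ⟨k - j, by rw [← Function.iterate_add_apply, Nat.sub_add_cancel h]⟩

lemma Desc.parent {F : V → V} {w x : V} (h : Desc F w x) (hne : w ≠ x) : Desc F (F w) x := by
  obtain ⟨k, hk⟩ := h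
  cases k with
  | zero => exact absurd hk hne
  | succ k => exact ⟨k, hk⟩

lemma IsRooted.parent_ne {F : V → V} {r : V} (hF : IsRooted F r) {x : V} (hx : x ≠ r) :
    F x ≠ x := by
  intro h
  obtain ⟨k, hk⟩ := hF.2 x
  rw [Function.iterate_fixed h] at hk
  exact hx hk

lemma IsRooted.connected {F : V → V} {r : V} (hF : IsRooted F r) :
    (parentGraph F).Connected := by
  have h : ∀ (k : ℕ) (w : V), (parentGraph F).Reachable w (F^[k] w) := by
    intro k
    induction k with
    | zero => exact fun w => SimpleGraph.Reachable.refl _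
    | succ k ih =>
      intro w
      by_cases hw : w = F w
      · rw [Function.iterate_fixed hw.symm]
      · exact (SimpleGraph.Adj.reachable (parentGraph_adj.2 ⟨hw, Or.inl rfl⟩)).trans (ih (F w))
  have h' : ∀ w, (parentGraph F).Reachable w r := fun w => by
    obtain ⟨k, hk⟩ := hF.2 w
    exact hk ▸ h k w
  have : Nonempty V := ⟨r⟩
  exact ⟨fun a b => (h' a).trans (h' b).symm⟩

lemma IsRooted.le_length {F : V → V} {r : V} (hF : IsRooted F r) {x w : V} :
    ∀ {v : V} (p : (parentGraph F).Walk v w), ¬ Desc F v x → Desc F w x →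
      (parentGraph F).dist v (F x) + 1 + (parentGraph F).dist x w ≤ p.length := by
  intro v p
  induction p with
  | nil => exact fun h h' => absurd h' h
  | @cons v u w hvu p ih =>
    intro hv hw
    rw [SimpleGraph.Walk.length_cons]
    by_cases hu : Desc F u x
    · have h1 : F u = v := by
        refine (parentGraph_adj.1 hvu).2.resolve_left fun h => hv ?_
        exact Desc.trans ⟨1, h⟩ hu
      have h2 : u = x := by
        by_contra hne
        exact hv (h1 ▸ hu.parent hne)
      subst h2
      rw [h1, SimpleGraph.dist_self]
      have := SimpleGraph.dist_le p
      omega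
    · have h1 := ih hu hw
      have h2 := hF.connected.dist_triangle (u := v) (v := u) (w := F x)
      rw [SimpleGraph.dist_eq_one_iff_adj.2 hvu] at h2
      omega

lemma IsRooted.dist_eq {F : V → V} {r : V} (hF : IsRooted F r) {v w x : V} (hv : ¬ Desc F v x)
    (hw : Desc F w x) : (parentGraph F).dist v w =
      (parentGraph F).dist v (F x) + 1 + (parentGraph F).dist x w := by
  refine le_antisymm ?_ ?_
  · have hx : x ≠ r := by
      rintro rfl
      exact hv (hF.2 v)
    have h1 : (parentGraph F).dist (F x) x = 1 :=
      SimpleGraph.dist_eq_one_iff_adj.2 (parentGraph_adj.2 ⟨hF.parent_ne hx, Or.inr rfl⟩)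
    have h2 := hF.connected.dist_triangle (u := v) (v := F x) (w := w)
    have h3 := hF.connected.dist_triangle (u := F x) (v := x) (w := w)
    omega
  · obtain ⟨p, hp⟩ := hF.connected.exists_walk_length_eq_dist v w
    rw [← hp]
    exact hF.le_length p hv hw

lemma IsRooted.dist_root_add {F : V → V} {r : V} (hF : IsRooted F r) {w x : V}
    (hw : Desc F w x) : (parentGraph F).dist r w =
      (parentGraph F).dist r x + (parentGraph F).dist x w := by
  by_cases hx : x = r
  · simp [hx]
  · have hr : ¬ Desc F r x := by
      rintro ⟨k, hk⟩
      rw [Function.iterate_fixed hF.1] at hk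
      exact hx hk.symm
    have h1 := hF.dist_eq hr hw
    have h2 := hF.dist_eq hr (Desc.refl F x)
    rw [SimpleGraph.dist_self] at h2
    omega

lemma IsRooted.dist_root_parent {F : V → V} {r : V} (hF : IsRooted F r) {x : V} (hx : x ≠ r) :
    (parentGraph F).dist r x = (parentGraph F).dist r (F x) + 1 := by
  have h := hF.dist_root_add (w := x) (x := F x) ⟨1, rfl⟩
  rwa [SimpleGraph.dist_eq_one_iff_adj.2
    (parentGraph_adj.2 ⟨hF.parent_ne hx, Or.inr rfl⟩)] at h

lemma IsRooted.desc_eq {F : V → V} {r : V} (hF : IsRooted F r) {x y : V} (h : Desc F x y)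
    (hd : (parentGraph F).dist r x = (parentGraph F).dist r y) : x = y := by
  have h1 := hF.dist_root_add h
  have h2 : (parentGraph F).dist y x = 0 := by omega
  exact ((hF.connected y x).dist_eq_zero_iff.1 h2).symm

lemma IsRooted.edist_ne_iff {F : V → V} {r : V} (hF : IsRooted F r) {a b c d : V} :
    (parentGraph F).edist a b ≠ (parentGraph F).edist c d ↔
      (parentGraph F).dist a b ≠ (parentGraph F).dist c d := by
  rw [← (hF.connected a b).coe_dist_eq_edist, ← (hF.connected c d).coe_dist_eq_edist]
  norm_cast

variable [Fintype V]

lemma mem_pathKids {F : V → V} {v₀ v x : V} :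
    x ∈ pathKids F v₀ v ↔ (x ≠ v ∧ F x = v) ∧ PathSub F v₀ x := by
  rw [pathKids, Finset.mem_filter, mem_kids]

lemma IsRooted.betaF_le {F : V → V} {r : V} (hF : IsRooted F r) (v₀ : V) {R : Set V}
    (hR : Resolves (parentGraph F) R) : betaF F v₀ ≤ R.ncard := by
  set K : Finset V := Finset.univ.filter fun x =>
    x ∈ pathKids F v₀ (F x) ∧ 2 ≤ (pathKids F v₀ (F x)).card ∧ ∃ w ∈ R, Desc F w x with hK
  have h1 : betaF F v₀ ≤ K.card := by
    rw [betaF, Finset.card_eq_sum_card_fiberwise (s := K) (t := Finset.univ) (f := F)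
      (fun _ _ => Finset.mem_coe.2 (Finset.mem_univ _))]
    refine Finset.sum_le_sum fun v _ => ?_
    by_cases h2 : 2 ≤ (pathKids F v₀ v).card
    · have h3 := Finset.card_filter_add_card_filter_not (s := pathKids F v₀ v)
        (fun x => ∃ w ∈ R, Desc F w x)
      have h4 : ((pathKids F v₀ v).filter fun x => ¬ ∃ w ∈ R, Desc F w x).card ≤ 1 := by
        refine Finset.card_le_one.2 fun x hx x' hx' => ?_
        rw [Finset.mem_filter, mem_pathKids] at hx hx'
        by_contra hne
        obtain ⟨w, hw, hd⟩ := hR x x' hne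
        apply hF.edist_ne_iff.1 hd
        rw [SimpleGraph.dist_comm, SimpleGraph.dist_comm (u := x'),
          hF.dist_eq (fun h => hx.2 ⟨w, hw, h⟩) (Desc.refl F x),
          hF.dist_eq (fun h => hx'.2 ⟨w, hw, h⟩) (Desc.refl F x'), hx.1.1.2, hx'.1.1.2,
          SimpleGraph.dist_self, SimpleGraph.dist_self]
      have h5 : ((pathKids F v₀ v).filter fun x => ∃ w ∈ R, Desc F w x) ⊆
          K.filter fun x => F x = v := by
        intro x hx
        rw [Finset.mem_filter] at hx
        have e := (mem_pathKids.1 hx.1).1.2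
        rw [Finset.mem_filter, hK, Finset.mem_filter, e]
        exact ⟨⟨Finset.mem_univ _, hx.1, h2, hx.2⟩, rfl⟩
      have h6 := Finset.card_le_card h5
      omega
    · omega
  refine h1.trans ?_
  have hex : ∀ x ∈ K, ∃ w ∈ R, Desc F w x := fun x hx => (Finset.mem_filter.1 hx).2.2.2
  choose! g hgR hgD using hex
  rw [← Set.ncard_coe_finset]
  refine Set.ncard_le_ncard_of_injOn g (fun x hx => hgR x hx) ?_ (Set.toFinite R)
  have key : ∀ x ∈ K, ∀ x' ∈ K, Desc F x x' → x = x' := by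
    intro x hx x' hx' hd
    by_contra hne
    rw [hK, Finset.mem_filter] at hx hx'
    have h2 := ((mem_pathKids.1 hx'.2.1).2 (F x) (hd.parent hne)).2
    have h3 : (pathKids F v₀ (F x)).card ≤ (kids F (F x)).card :=
      Finset.card_le_card (Finset.filter_subset _ _)
    have h4 := hx.2.2.1
    omega
  intro x hx x' hx' he
  have hd' : Desc F (g x) x' := he ▸ hgD x' hx'
  rcases (hgD x hx).total hd' with h | h
  · exact key x hx x' hx' h
  · exact (key x' hx' x hx h).symm

lemma IsRooted.exists_resolves {F : V → V} {r : V} (hF : IsRooted F r) (v₀ : V) :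
    ∃ R : Set V, R.ncard ≤ betaF F v₀ + 2 ∧ Resolves (parentGraph F) R := by
  choose sel hsel hcard using fun v => Finset.exists_subset_card_eq
    (Nat.sub_le (pathKids F v₀ v).card 1)
  set R : Finset V := {r, v₀} ∪ Finset.univ.biUnion sel with hR
  have hrR : r ∈ R := by simp [hR]
  have hv₀R : v₀ ∈ R := by simp [hR]
  have hselR : ∀ v, sel v ⊆ R := fun v =>
    (Finset.subset_biUnion_of_mem sel (Finset.mem_univ v)).trans Finset.subset_union_right
  have hpath : ∀ x, (∀ w ∈ R, ¬ Desc F w x) → PathSub F v₀ x := by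
    intro x hx
    by_contra hnp
    set S : Finset V := Finset.univ.filter fun w => Desc F w x ∧ 2 ≤ (kids F w).card with hS
    have hSne : S.Nonempty := by
      by_contra hSe
      apply hnp
      intro w hw
      refine ⟨fun h => hx v₀ hv₀R (h ▸ hw), ?_⟩
      by_contra h2
      exact hSe ⟨w, Finset.mem_filter.2 ⟨Finset.mem_univ _, hw, by omega⟩⟩
    obtain ⟨w, hw, hmax⟩ := Finset.exists_max_image S (fun w => (parentGraph F).dist r w) hSne
    rw [hS, Finset.mem_filter] at hw
    obtain ⟨-, hwx, hw2⟩ := hw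
    have hpk : pathKids F v₀ w = kids F w := by
      refine Finset.filter_true_of_mem fun y hy => ?_
      rw [mem_kids] at hy
      intro z hz
      have hzx : Desc F z x := (Desc.trans hz ⟨1, hy.2⟩).trans hwx
      refine ⟨fun h => hx v₀ hv₀R (h ▸ hzx), ?_⟩
      by_contra h2
      have h3 := hmax z (Finset.mem_filter.2 ⟨Finset.mem_univ _, hzx, by omega⟩)
      have h4 := hF.dist_root_add hz
      have hyr : y ≠ r := by
        rintro rfl
        exact hy.1 (hF.1.symm.trans hy.2)
      have h5 := hF.dist_root_parent hyr
      rw [hy.2] at h5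
      omega
    have h6 : (sel w).Nonempty := Finset.card_pos.1 (by rw [hcard, hpk]; omega)
    obtain ⟨s, hs⟩ := h6
    have h7 := mem_pathKids.1 (hsel w hs)
    exact hx s (hselR w hs) (Desc.trans ⟨1, h7.1.2⟩ hwx)
  refine ⟨R, ?_, ?_⟩
  · rw [Set.ncard_coe_finset]
    calc R.card ≤ ({r, v₀} : Finset V).card + (Finset.univ.biUnion sel).card :=
          Finset.card_union_le _ _
      _ ≤ 2 + ∑ v, (sel v).card := add_le_add Finset.card_le_two Finset.card_biUnion_le
      _ = betaF F v₀ + 2 := by rw [betaF, add_comm]; simp [hcard]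
  · intro u v huv
    by_contra hcon
    have hcon' : ∀ w ∈ R, (parentGraph F).dist u w = (parentGraph F).dist v w := by
      intro w hw
      by_contra h
      exact hcon ⟨w, Finset.mem_coe.2 hw, hF.edist_ne_iff.2 h⟩
    have hdep : (parentGraph F).dist r u = (parentGraph F).dist r v := by
      rw [SimpleGraph.dist_comm, SimpleGraph.dist_comm (u := r)]
      exact hcon' r hrR
    have hroot : ∀ x, (parentGraph F).dist r x = 0 ↔ x = r := fun x => by
      rw [(hF.connected r x).dist_eq_zero_iff, eq_comm]
    have hdepk : ∀ k, (parentGraph F).dist r (F^[k] u) = (parentGraph F).dist r (F^[k] v) := by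
      intro k
      induction k with
      | zero => exact hdep
      | succ k ih =>
        rw [Function.iterate_succ_apply', Function.iterate_succ_apply']
        by_cases h : F^[k] u = r
        · have h' : F^[k] v = r := by rw [← hroot, ← ih, hroot, h]
          rw [h, h']
        · have h' : F^[k] v ≠ r := by rw [Ne, ← hroot, ← ih, hroot]; exact h
          have h1 := hF.dist_root_parent h
          have h2 := hF.dist_root_parent h'
          omega
    have hex : ∃ k, F^[k] u = F^[k] v := by
      obtain ⟨i, hi⟩ := hF.2 u
      obtain ⟨j, hj⟩ := hF.2 v
      refine ⟨i + j, ?_⟩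
      rw [Function.iterate_add_apply F i j v, hj, Function.iterate_fixed hF.1, add_comm,
        Function.iterate_add_apply, hi, Function.iterate_fixed hF.1]
    obtain ⟨k, hk⟩ : ∃ k, Nat.find hex = k + 1 := by
      refine Nat.exists_eq_succ_of_ne_zero fun h0 => ?_
      have := Nat.find_spec hex
      rw [h0] at this
      exact huv this
    have e1 : F (F^[k] u) = F (F^[k] v) := by
      rw [← Function.iterate_succ_apply' F, ← Function.iterate_succ_apply' F]
      have h := Nat.find_spec hex
      rw [hk] at h
      exact h
    have e2 : F^[k] u ≠ F^[k] v := Nat.find_min hex (by omega)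
    have free : ∀ a b : V, (parentGraph F).dist r a = (parentGraph F).dist r b →
        (parentGraph F).dist r (F^[k] a) = (parentGraph F).dist r (F^[k] b) →
        F (F^[k] a) = F (F^[k] b) → F^[k] a ≠ F^[k] b →
        (∀ w ∈ R, (parentGraph F).dist a w = (parentGraph F).dist b w) →
        (∀ w ∈ R, ¬ Desc F w (F^[k] a)) ∧ F^[k] a ≠ F (F^[k] a) := by
      intro a b hab hk' e1 e2 hcon
      have har : F^[k] a ≠ r := by
        intro h
        apply e2
        rw [h, eq_comm, ← hroot, ← hk', h, SimpleGraph.dist_self]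
      refine ⟨fun w hw hwd => ?_, (hF.parent_ne har).symm⟩
      have hb : ¬ Desc F b (F^[k] a) := by
        intro h
        rcases h.total (⟨k, rfl⟩ : Desc F b (F^[k] b)) with h | h
        · exact e2 (hF.desc_eq h hk')
        · exact e2 (hF.desc_eq h hk'.symm).symm
      have h1 := hF.dist_eq hb hwd
      have h2 := hF.connected.dist_triangle (u := a) (v := F^[k] a) (w := w)
      have h3 := hF.dist_root_add (⟨k, rfl⟩ : Desc F a (F^[k] a))
      have h4 := hF.dist_root_add (⟨k + 1, Function.iterate_succ_apply' _ _ _⟩ :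
        Desc F b (F (F^[k] b)))
      have h5 := hF.dist_root_parent har
      rw [e1] at h1 h5
      have h6 := hcon w hw
      have h7 := (parentGraph F).dist_comm (u := a) (v := F^[k] a)
      have h8 := (parentGraph F).dist_comm (u := b) (v := F (F^[k] b))
      omega
    obtain ⟨f1, g1⟩ := free u v hdep (hdepk k) e1 e2 hcon'
    obtain ⟨f2, g2⟩ := free v u hdep.symm (hdepk k).symm e1.symm e2.symm
      (fun w hw => (hcon' w hw).symm)
    have m1 : F^[k] u ∈ pathKids F v₀ (F (F^[k] u)) := mem_pathKids.2 ⟨⟨g1, rfl⟩, hpath _ f1⟩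
    have m2 : F^[k] v ∈ pathKids F v₀ (F (F^[k] u)) :=
      mem_pathKids.2 ⟨⟨e1 ▸ g2, e1.symm⟩, hpath _ f2⟩
    have n1 : F^[k] u ∉ sel (F (F^[k] u)) := fun h => f1 _ (hselR _ h) (Desc.refl _ _)
    have n2 : F^[k] v ∉ sel (F (F^[k] u)) := fun h => f2 _ (hselR _ h) (Desc.refl _ _)
    have h1 := Finset.card_sdiff_of_subset (hsel (F (F^[k] u)))
    rw [hcard] at h1
    have h2 : (pathKids F v₀ (F (F^[k] u)) \ sel (F (F^[k] u))).card ≤ 1 := by omega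
    exact e2 (Finset.card_le_one.1 h2 _ (Finset.mem_sdiff.2 ⟨m1, n1⟩) _
      (Finset.mem_sdiff.2 ⟨m2, n2⟩))

lemma IsRooted.metricDim_bounds {F : V → V} {r : V} (hF : IsRooted F r) (v₀ : V)
    (hV : Nat.card V ≠ 1) : betaF F v₀ ≤ metricDim (parentGraph F) ∧
      metricDim (parentGraph F) ≤ betaF F v₀ + 2 := by
  obtain ⟨R, hR, hres⟩ := hF.exists_resolves v₀
  rw [metricDim, if_neg hV]
  constructor
  · have hne : {m : ℕ | ∃ R : Set V, R.ncard = m ∧ Resolves (parentGraph F) R}.Nonempty :=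
      ⟨R.ncard, R, rfl, hres⟩
    obtain ⟨R', hR', hres'⟩ := Nat.sInf_mem hne
    rw [← hR']
    exact hF.betaF_le v₀ hres'
  · refine le_trans (Nat.sInf_le ?_) hR
    exact ⟨R, rfl, hres⟩

end TreeDistances

section Bijection

variable {V : Type*}

lemma IsRooted.ext {F F' : V → V} {r : V} (hF : IsRooted F r) (hF' : IsRooted F' r)
    (h : parentGraph F = parentGraph F') : F = F' := by
  funext a
  by_cases ha : a = r
  · rw [ha, hF.1, hF'.1]
  have h1 : (parentGraph F').Adj a (F a) :=
    h ▸ parentGraph_adj.2 ⟨(hF.parent_ne ha).symm, Or.inl rfl⟩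
  rcases (parentGraph_adj.1 h1).2 with h2 | h2
  · exact h2.symm
  · exfalso
    have h3 : F a ≠ r := by
      intro e
      rw [e, hF'.1] at h2
      exact ha h2.symm
    have h4 := hF.dist_root_parent ha
    have h5 := hF'.dist_root_parent h3
    rw [h2, ← h] at h5
    omega

lemma exists_parent_of_isTree {T : SimpleGraph V} (hT : T.IsTree) (r : V) :
    ∃ F : V → V, IsRooted F r ∧ parentGraph F = T := by
  have h1 : ∀ a, ∃ b, (a = r → b = r) ∧ (a ≠ r → T.Adj a b ∧ T.dist b r < T.dist a r) := by
    intro a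
    by_cases ha : a = r
    · exact ⟨r, fun _ => rfl, fun h => absurd ha h⟩
    · obtain ⟨p, hp⟩ := hT.1.exists_walk_length_eq_dist a r
      cases p with
      | nil => exact absurd rfl ha
      | @cons _ b _ hab p =>
        refine ⟨b, fun h => absurd h ha, fun _ => ⟨hab, ?_⟩⟩
        rw [← hp, SimpleGraph.Walk.length_cons]
        exact Nat.lt_succ_of_le (SimpleGraph.dist_le p)
  choose F hF1 hF2 using h1
  have hroot : IsRooted F r := by
    refine ⟨hF1 r rfl, ?_⟩
    suffices h : ∀ (n : ℕ) (w : V), T.dist w r ≤ n → ∃ k, F^[k] w = r from fun w => h _ w le_rfl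
    intro n
    induction n with
    | zero =>
      intro w hw
      exact ⟨0, (hT.1 w r).dist_eq_zero_iff.1 (Nat.le_zero.1 hw)⟩
    | succ n ih =>
      intro w hw
      by_cases hwr : w = r
      · exact ⟨0, hwr⟩
      · obtain ⟨k, hk⟩ := ih (F w) (by have := (hF2 w hwr).2; omega)
        exact ⟨k + 1, hk⟩
  refine ⟨F, hroot, ?_⟩
  have hle : parentGraph F ≤ T := by
    have key : ∀ a b, a ≠ b → F a = b → T.Adj a b := by
      intro a b hab h
      have ha : a ≠ r := by
        rintro rfl
        exact hab ((hF1 a rfl).symm.trans h)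
      exact h ▸ (hF2 a ha).1
    intro a b hab
    obtain ⟨hne, h | h⟩ := parentGraph_adj.1 hab
    · exact key a b hne h
    · exact (key b a hne.symm h).symm
  exact le_antisymm hle ((SimpleGraph.isTree_iff_minimal_connected.1 hT).2 hroot.connected hle)

lemma IsRooted.isTree [Finite V] {F : V → V} {r : V} (hF : IsRooted F r) :
    (parentGraph F).IsTree := by
  rw [SimpleGraph.isTree_iff_connected_and_card]
  refine ⟨hF.connected, le_antisymm ?_ hF.connected.card_vert_le_card_edgeSet_add_one⟩
  have h1 : (parentGraph F).edgeSet ⊆ Set.image (fun a => s(a, F a)) {r}ᶜ := by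
    intro e
    induction e using Sym2.ind with
    | _ a b =>
      intro he
      rw [SimpleGraph.mem_edgeSet, parentGraph_adj] at he
      have key : ∀ a b, a ≠ b → F a = b → a ∈ ({r}ᶜ : Set V) := by
        rintro a b hab h rfl
        exact hab (hF.1.symm.trans h)
      obtain ⟨hne, h | h⟩ := he
      · exact ⟨a, key a b hne h, by simp only [h]⟩
      · exact ⟨b, key b a hne.symm h, by simp only [h, Sym2.eq_swap]⟩
  have h2 := (Set.ncard_le_ncard h1 (Set.toFinite _)).trans (Set.ncard_image_le (Set.toFinite _))
  rw [Set.ncard_compl, Set.ncard_singleton] at h2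
  have h3 : 0 < Nat.card V := Nat.card_pos_iff.2 ⟨⟨r⟩, inferInstance⟩
  have h4 : (parentGraph F).edgeSet.ncard = Nat.card (parentGraph F).edgeSet := rfl
  omega

variable [Fintype V]

lemma sum_rootedOn_parentGraph {M : Type*} [AddCommMonoid M] (f : SimpleGraph V → M) :
    ∑ F ∈ rootedOn (Finset.univ : Finset V), f (parentGraph F) =
      Fintype.card V • ∑ T ∈ Finset.univ.filter (fun T : SimpleGraph V => T.IsTree), f T := by
  have h1 : rootedOn (Finset.univ : Finset V) =
      Finset.univ.biUnion fun r => Finset.univ.filter fun F : V → V => IsRooted F r := by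
    ext F
    simp [mem_rootedOn_univ]
  rw [h1, Finset.sum_biUnion]
  · rw [← Finset.card_univ, ← Finset.sum_const]
    refine Finset.sum_congr rfl fun r _ => ?_
    refine Finset.sum_bij (fun F _ => parentGraph F) ?_ ?_ ?_ ?_
    · intro F hF
      rw [Finset.mem_filter] at hF ⊢
      exact ⟨Finset.mem_univ _, hF.2.isTree⟩
    · intro F hF F' hF' h
      rw [Finset.mem_filter] at hF hF'
      exact hF.2.ext hF'.2 h
    · intro T hT
      rw [Finset.mem_filter] at hT
      obtain ⟨F, hF, h⟩ := exists_parent_of_isTree hT.2 r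
      exact ⟨F, Finset.mem_filter.2 ⟨Finset.mem_univ _, hF⟩, h⟩
    · intro _ _
      rfl
  · intro r _ s _ hrs
    rw [Function.onFun, Finset.disjoint_left]
    intro F hF hF'
    rw [Finset.mem_filter] at hF hF'
    obtain ⟨k, hk⟩ := hF'.2.2 r
    rw [Function.iterate_fixed hF.2.1] at hk
    exact hrs hk

end Bijection

section LegCoefficients

/-- The coefficients of the power series `exp (c * X / (1 - X))`. -/
def expPathCoeff (c : ℂ) (k : ℕ) : ℂ :=
  ∑ h ∈ Finset.range (k + 1), c ^ h / h.factorial * ((k - 1).choose (k - h) : ℂ)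

lemma hasSum_pathSeries_pow {z : ℂ} (hz : ‖z‖ < 1) (h : ℕ) :
    HasSum (fun k => (if h ≤ k then ((k - 1).choose (k - h) : ℂ) else 0) * z ^ k)
      ((z / (1 - z)) ^ h) := by
  rcases h with _ | h
  · rw [pow_zero]
    convert hasSum_ite_eq 0 (1 : ℂ) using 2 with k
    rcases k with _ | k <;> simp
  · have h1 := (hasSum_choose_mul_geometric_of_norm_lt_one h hz).mul_right (z ^ (h + 1))
    rw [div_pow, div_eq_mul_one_div, mul_comm (z ^ (h + 1))]
    refine (hasSum_iff_hasSum_of_ne_zero_bij (fun i => (i : ℕ) + (h + 1)) ?_ ?_ ?_).2 h1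
    · intro i j hij
      exact Subtype.ext (Nat.add_right_cancel hij)
    · intro k hk
      have hk' : h + 1 ≤ k := by
        by_contra hlt
        rw [Function.mem_support, if_neg hlt, zero_mul] at hk
        exact hk rfl
      refine ⟨⟨k - (h + 1), ?_⟩, Nat.sub_add_cancel hk'⟩
      rw [Function.mem_support] at hk ⊢
      rw [if_pos hk'] at hk
      have e : k - (h + 1) + h = k - 1 := by omega
      rw [e, ← Nat.choose_symm (by omega), show k - 1 - h = k - (h + 1) by omega, mul_assoc,
        ← pow_add, Nat.sub_add_cancel hk']
      exact hk
    · rintro ⟨i, hi⟩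
      dsimp only
      rw [if_pos (by omega), show i + (h + 1) - 1 = i + h by omega, Nat.add_sub_cancel,
        Nat.choose_symm_add, pow_add]
      ring

/-- The double array of terms of `exp (c * z / (1 - z))`. -/
def expPathTerm (c z : ℂ) (p : ℕ × ℕ) : ℂ := c ^ p.1 / p.1.factorial *
    ((if p.1 ≤ p.2 then ((p.2 - 1).choose (p.2 - p.1) : ℂ) else 0) * z ^ p.2)

lemma hasSum_expPathTerm_row (c : ℂ) {z : ℂ} (hz : ‖z‖ < 1) (h : ℕ) :
    HasSum (fun k => expPathTerm c z (h, k)) (c ^ h / h.factorial * (z / (1 - z)) ^ h) := by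
  simp only [expPathTerm]
  exact (hasSum_pathSeries_pow hz h).mul_left _

lemma norm_expPathTerm (c z : ℂ) (p : ℕ × ℕ) :
    ((‖expPathTerm c z p‖ : ℝ) : ℂ) = expPathTerm (‖c‖ : ℝ) (‖z‖ : ℝ) p := by
  rw [expPathTerm, expPathTerm, norm_mul, norm_div, norm_mul, norm_pow, norm_pow,
    Complex.norm_natCast]
  split_ifs <;> simp

lemma hasSum_norm_expPathTerm_row (c : ℂ) {z : ℂ} (hz : ‖z‖ < 1) (h : ℕ) :
    HasSum (fun k => ‖expPathTerm c z (h, k)‖)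
      ((‖c‖ * (‖z‖ / (1 - ‖z‖))) ^ h / h.factorial) := by
  have hz' : ‖((‖z‖ : ℝ) : ℂ)‖ < 1 := by simpa using hz
  have h1 := hasSum_expPathTerm_row ((‖c‖ : ℝ) : ℂ) hz' h
  rw [← Complex.hasSum_ofReal]
  have e : (((‖c‖ * (‖z‖ / (1 - ‖z‖))) ^ h / h.factorial : ℝ) : ℂ) =
      ((‖c‖ : ℝ) : ℂ) ^ h / h.factorial * (((‖z‖ : ℝ) : ℂ) / (1 - ((‖z‖ : ℝ) : ℂ))) ^ h := by
    push_cast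
    rw [mul_pow]
    ring
  rw [e]
  refine h1.congr_fun fun k => ?_
  exact norm_expPathTerm c z (h, k)

lemma summable_expPathTerm (c : ℂ) {z : ℂ} (hz : ‖z‖ < 1) : Summable (expPathTerm c z) := by
  refine Summable.of_norm ?_
  rw [summable_prod_of_nonneg (fun _ => norm_nonneg _)]
  refine ⟨fun h => (hasSum_norm_expPathTerm_row c hz h).summable, ?_⟩
  simp only [(hasSum_norm_expPathTerm_row c hz _).tsum_eq]
  exact Real.summable_pow_div_factorial _

lemma hasSum_expPathTerm (c : ℂ) {z : ℂ} (hz : ‖z‖ < 1) :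
    HasSum (expPathTerm c z) (Complex.exp (c * (z / (1 - z)))) := by
  have h1 := (summable_expPathTerm c hz).hasSum.prod_fiberwise (hasSum_expPathTerm_row c hz)
  have h2 : HasSum (fun h => c ^ h / h.factorial * (z / (1 - z)) ^ h)
      (Complex.exp (c * (z / (1 - z)))) := by
    rw [Complex.exp_eq_exp_ℂ]
    refine (NormedSpace.expSeries_div_hasSum_exp (c * (z / (1 - z)))).congr_fun fun h => ?_
    rw [mul_pow]
    ring
  rw [← h1.unique h2]
  exact (summable_expPathTerm c hz).hasSum

lemma hasSum_expPathTerm_col (c z : ℂ) (k : ℕ) :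
    HasSum (fun h => expPathTerm c z (h, k)) (expPathCoeff c k * z ^ k) := by
  have e : expPathCoeff c k * z ^ k = ∑ h ∈ Finset.range (k + 1), expPathTerm c z (h, k) := by
    rw [expPathCoeff, Finset.sum_mul]
    refine Finset.sum_congr rfl fun h hh => ?_
    rw [expPathTerm, if_pos (Nat.lt_succ_iff.1 (Finset.mem_range.1 hh)), mul_assoc]
  rw [e]
  refine hasSum_sum_of_ne_finset_zero fun h hh => ?_
  rw [expPathTerm, if_neg (by simpa using hh), zero_mul, mul_zero]

lemma hasSum_expPathCoeff (c : ℂ) {z : ℂ} (hz : ‖z‖ < 1) :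
    HasSum (fun k => expPathCoeff c k * z ^ k) (Complex.exp (c * (z / (1 - z)))) := by
  have h1 : HasSum (fun p : ℕ × ℕ => expPathTerm c z p.swap) (Complex.exp (c * (z / (1 - z)))) :=
    ((Equiv.prodComm ℕ ℕ).hasSum_iff).2 (hasSum_expPathTerm c hz)
  exact h1.prod_fiberwise fun k => hasSum_expPathTerm_col c z k

/-- The coefficients of `legSeries`. -/
def legCoeff (y : ℂ) (k : ℕ) : ℂ := PowerSeries.coeff k (legSeries y)

lemma legCoeff_eq_sum (y : ℂ) (k : ℕ) : legCoeff y k = ∑ h ∈ Finset.range (k + 1),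
    legWeight y h / h.factorial * ((k - 1).choose (k - h) : ℂ) := by
  rw [legCoeff, ← pow_one (legSeries y), coeff_legSeries_pow, pow_one]
  simp [egf]

lemma legCoeff_zero (y : ℂ) : legCoeff y 0 = 1 := by
  simp [legCoeff_eq_sum, legWeight_zero]

/-- The analytic function with Taylor coefficients `legCoeff y`. -/
def legFun (y z : ℂ) : ℂ :=
  (1 - 1 / y) * Complex.exp (-1 * (z / (1 - z))) + Complex.exp ((y - 1) * (z / (1 - z))) / y

lemma hasSum_legCoeff (y : ℂ) {z : ℂ} (hz : ‖z‖ < 1) :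
    HasSum (fun k => legCoeff y k * z ^ k) (legFun y z) := by
  have h1 := (hasSum_expPathCoeff (-1) hz).mul_left (1 - 1 / y)
  have h2 := (hasSum_expPathCoeff (y - 1) hz).div_const y
  refine (h1.add h2).congr_fun fun k => ?_
  rw [legCoeff_eq_sum, expPathCoeff, expPathCoeff, Finset.sum_mul, Finset.sum_mul,
    Finset.sum_mul, Finset.mul_sum, Finset.sum_div, ← Finset.sum_add_distrib]
  refine Finset.sum_congr rfl fun h _ => ?_
  rw [legWeight]
  ring

lemma norm_legWeight_le {y : ℂ} (hy : ‖y - 1‖ ≤ 1 / 2) {i : ℕ} (hi : 1 ≤ i) :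
    ‖legWeight y i‖ ≤ 3 * ‖y - 1‖ := by
  have h0 : 1 / 2 ≤ ‖y‖ := by
    have := norm_sub_norm_le (1 : ℂ) (1 - y)
    rw [norm_one, sub_sub_cancel, norm_sub_rev] at this
    linarith
  have hy0 : y ≠ 0 := by
    rintro rfl
    norm_num at h0
  rcases hi.lt_or_eq with hi | rfl
  · have e : legWeight y i = ((y - 1) * (-1) ^ i + (y - 1) ^ i) / y := by
      rw [legWeight]; field_simp
    rw [e, norm_div, div_le_iff₀ (by linarith)]
    have h1 : ‖(y - 1) ^ i‖ ≤ ‖y - 1‖ * (1 / 2) := by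
      rw [norm_pow]
      calc ‖y - 1‖ ^ i ≤ ‖y - 1‖ ^ 2 :=
            pow_le_pow_of_le_one (norm_nonneg _) (by linarith) hi
        _ ≤ ‖y - 1‖ * (1 / 2) := by
          rw [sq]; exact mul_le_mul_of_nonneg_left hy (norm_nonneg _)
    have h2 := norm_add_le ((y - 1) * (-1) ^ i) ((y - 1) ^ i)
    have h3 : ‖(y - 1) * (-1) ^ i‖ = ‖y - 1‖ := by simp
    nlinarith [norm_nonneg (y - 1)]
  · rw [legWeight_one hy0, norm_zero]
    positivity

lemma inv_factorial_le (h : ℕ) : (1 : ℝ) / (h + 1).factorial ≤ (1 / 2) ^ h := by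
  induction h with
  | zero => simp
  | succ h ih =>
    rw [Nat.factorial_succ, pow_succ]
    push_cast at *
    have h1 : (0 : ℝ) < (h + 1).factorial := by positivity
    have h2 : (1 : ℝ) / ((h : ℝ) + 1 + 1) ≤ 1 / 2 := by
      apply one_div_le_one_div_of_le <;> linarith [(Nat.cast_nonneg h : (0 : ℝ) ≤ h)]
    calc (1 : ℝ) / (((h : ℝ) + 1 + 1) * (h + 1).factorial)
        = 1 / (h + 1).factorial * (1 / ((h : ℝ) + 1 + 1)) := by field_simp
      _ ≤ (1 / 2) ^ h * (1 / 2) := by gcongr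

lemma norm_legCoeff_le {y : ℂ} (hy : ‖y - 1‖ ≤ 1 / 2) (k : ℕ) :
    ‖legCoeff y (k + 1)‖ ≤ 3 * ‖y - 1‖ * (3 / 2) ^ (k + 1) := by
  rw [legCoeff_eq_sum, Finset.sum_range_succ']
  have h0 : ((k + 1 - 1).choose (k + 1 - 0) : ℂ) = 0 := by simp
  rw [h0, mul_zero, add_zero]
  refine (norm_sum_le _ _).trans ?_
  have h1 : ∀ h ∈ Finset.range (k + 1), ‖legWeight y (h + 1) / ((h + 1).factorial : ℂ) *
      ((k + 1 - 1).choose (k + 1 - (h + 1)) : ℂ)‖ ≤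
      3 * ‖y - 1‖ * ((1 / 2) ^ h * 1 ^ (k - h) * (k.choose h : ℝ)) := by
    intro h hh
    have hh' : h ≤ k := Nat.lt_succ_iff.1 (Finset.mem_range.1 hh)
    rw [norm_mul, norm_div, Complex.norm_natCast, Complex.norm_natCast, Nat.add_sub_cancel,
      Nat.add_sub_add_right, Nat.choose_symm hh', div_eq_mul_one_div, one_pow, mul_one, mul_assoc]
    exact mul_le_mul (norm_legWeight_le hy (by omega))
      (mul_le_mul_of_nonneg_right (inv_factorial_le h) (Nat.cast_nonneg _)) (by positivity)
      (by positivity)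
  refine (Finset.sum_le_sum h1).trans ?_
  rw [← Finset.mul_sum, ← add_pow, pow_succ]
  norm_num
  gcongr
  nlinarith [show (0 : ℝ) < (3 / 2) ^ k by positivity]

end LegCoefficients

section Renewal

/-- The convolution sequence `∑ m, X ^ m [z ^ (n - m)] A ^ m`, where `A = legSeries y`. -/
def renewal (y X : ℂ) (n : ℕ) : ℂ :=
  ∑ m ∈ Finset.range (n + 1), X ^ m * PowerSeries.coeff (n - m) (legSeries y ^ m)

lemma renewal_zero (y X : ℂ) : renewal y X 0 = 1 := by simp [renewal]

lemma renewal_eq_coeff (y X : ℂ) {n N : ℕ} (hN : n < N) : renewal y X n =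
    PowerSeries.coeff n (∑ m ∈ Finset.range N,
      (PowerSeries.C X * (PowerSeries.X * legSeries y)) ^ m) := by
  have hc : ∀ m, PowerSeries.coeff n ((PowerSeries.C X * (PowerSeries.X * legSeries y)) ^ m) =
      if m ≤ n then X ^ m * PowerSeries.coeff (n - m) (legSeries y ^ m) else 0 := by
    intro m
    rw [mul_pow, mul_pow, ← map_pow, PowerSeries.coeff_C_mul, PowerSeries.coeff_X_pow_mul']
    split_ifs <;> simp
  rw [map_sum, renewal, Finset.sum_congr rfl fun m _ => hc m]
  rw [← Finset.sum_subset (Finset.range_subset_range.2 (Nat.succ_le_of_lt hN))]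
  · refine Finset.sum_congr rfl fun m hm => ?_
    rw [if_pos (Nat.lt_succ_iff.1 (Finset.mem_range.1 hm))]
  · intro m _ hm
    rw [if_neg (by simpa using hm)]

lemma renewal_succ (y X : ℂ) (n : ℕ) : renewal y X (n + 1) =
    X * ∑ k ∈ Finset.range (n + 1), legCoeff y k * renewal y X (n - k) := by
  rw [renewal_eq_coeff y X (Nat.lt_succ_self (n + 1)), Finset.sum_range_succ']
  simp only [pow_succ']
  rw [← Finset.mul_sum, map_add, mul_assoc, PowerSeries.coeff_C_mul, mul_assoc,
    PowerSeries.coeff_succ_X_mul, PowerSeries.coeff_mul,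
    Finset.Nat.sum_antidiagonal_eq_sum_range_succ_mk, pow_zero, PowerSeries.coeff_one,
    if_neg (Nat.succ_ne_zero n), add_zero]
  congr 1
  refine Finset.sum_congr rfl fun k hk => ?_
  rw [legCoeff, renewal_eq_coeff y X (show n - k < n + 1 by omega)]

lemma sum_geometric_le {x : ℝ} (h0 : 0 ≤ x) (h1 : x < 1) (n : ℕ) :
    ∑ k ∈ Finset.range n, x ^ k ≤ (1 - x)⁻¹ :=
  sum_le_hasSum _ (fun _ _ => pow_nonneg h0 _) (hasSum_geometric_of_lt_one h0 h1)

lemma norm_renewal_le {y X : ℂ} (hy : ‖y - 1‖ ≤ 1 / 300) (hX : ‖X‖ ≤ 11 / 5) (n : ℕ) :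
    ‖renewal y X n‖ ≤ (5 / 2) ^ n := by
  induction n using Nat.strong_induction_on with
  | _ n ih =>
  rcases n with _ | n
  · simp [renewal_zero]
  rw [renewal_succ, norm_mul, Finset.sum_range_succ', legCoeff_zero, one_mul, Nat.sub_zero]
  have h1 : ‖∑ k ∈ Finset.range n, legCoeff y (k + 1) * renewal y X (n - (k + 1))‖ ≤
      ∑ k ∈ Finset.range n, (1 / 100) * (5 / 2 : ℝ) ^ n * (3 / 5) ^ (k + 1) := by
    refine norm_sum_le_of_le _ fun k hk => ?_
    have hk' : k + 1 ≤ n := Finset.mem_range.1 hk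
    have e : (1 / 100) * (5 / 2 : ℝ) ^ n * (3 / 5) ^ (k + 1) =
        (1 / 100 * (3 / 2) ^ (k + 1)) * (5 / 2) ^ (n - (k + 1)) := by
      conv_lhs => rw [← Nat.sub_add_cancel hk', pow_add]
      rw [mul_assoc, mul_assoc, ← mul_pow]
      norm_num
      ring
    rw [norm_mul, e]
    refine mul_le_mul ((norm_legCoeff_le (by linarith) k).trans ?_) (ih _ (by omega))
      (norm_nonneg _) (by positivity)
    gcongr
    linarith
  have h2 : ∑ k ∈ Finset.range n, (1 / 100) * (5 / 2 : ℝ) ^ n * (3 / 5) ^ (k + 1) ≤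
      (1 / 50) * (5 / 2) ^ n := by
    rw [← Finset.mul_sum]
    simp only [pow_succ]
    rw [← Finset.sum_mul]
    have : ∑ k ∈ Finset.range n, (3 / 5 : ℝ) ^ k ≤ 5 / 2 := by
      have h := sum_geometric_le (x := (3 / 5 : ℝ)) (by norm_num) (by norm_num) n
      norm_num at h
      exact h
    nlinarith [show (0 : ℝ) < (5 / 2) ^ n by positivity]
  have h3 := norm_add_le (∑ k ∈ Finset.range n, legCoeff y (k + 1) * renewal y X (n - (k + 1)))
    (renewal y X n)
  have h4 := ih n (Nat.lt_succ_self n)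
  have h5 : (0 : ℝ) < (5 / 2) ^ n := by positivity
  rw [pow_succ]
  generalize (5 / 2 : ℝ) ^ n = t at *
  refine (mul_le_mul hX (h3.trans (add_le_add (h1.trans h2) h4)) (norm_nonneg _)
    (by norm_num)).trans ?_
  linarith

lemma norm_legCoeff_mul_le {y z : ℂ} (hy : ‖y - 1‖ ≤ 1 / 2) (hz : ‖z‖ ≤ 1 / 2) (k : ℕ) :
    ‖legCoeff y (k + 1) * z ^ (k + 1)‖ ≤ 3 * ‖y - 1‖ * (3 / 4) ^ (k + 1) := by
  rw [norm_mul, norm_pow]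
  calc _ ≤ 3 * ‖y - 1‖ * (3 / 2) ^ (k + 1) * (1 / 2) ^ (k + 1) := by
        gcongr; exact norm_legCoeff_le hy k
    _ = _ := by rw [mul_assoc, ← mul_pow]; norm_num

lemma norm_legFun_tail_le {y z : ℂ} (hy : ‖y - 1‖ ≤ 1 / 2) (hz : ‖z‖ ≤ 1 / 2) (i : ℕ) :
    ‖legFun y z - ∑ k ∈ Finset.range (i + 1), legCoeff y k * z ^ k‖ ≤
      9 * ‖y - 1‖ * (3 / 4) ^ i := by
  have h1 := (hasSum_nat_add_iff' (i + 1)).2 (hasSum_legCoeff y (hz.trans_lt (by norm_num)))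
  have h2 : HasSum (fun k => 3 * ‖y - 1‖ * (3 / 4 : ℝ) ^ (i + 1) * (3 / 4) ^ k)
      (3 * ‖y - 1‖ * (3 / 4 : ℝ) ^ (i + 1) * (1 - 3 / 4)⁻¹) :=
    (hasSum_geometric_of_lt_one (by norm_num) (by norm_num)).mul_left _
  rw [← h1.tsum_eq]
  have h3 := tsum_of_norm_bounded h2 (f := fun k => legCoeff y (k + (i + 1)) * z ^ (k + (i + 1)))
    fun k => by
      rw [← add_assoc]
      refine (norm_legCoeff_mul_le hy hz (k + i)).trans (le_of_eq ?_)
      ring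
  refine h3.trans (le_of_eq ?_)
  ring

lemma norm_legFun_sub_one_le {y z : ℂ} (hy : ‖y - 1‖ ≤ 1 / 2) (hz : ‖z‖ ≤ 1 / 2) :
    ‖legFun y z - 1‖ ≤ 9 * ‖y - 1‖ := by
  simpa [legCoeff_zero] using norm_legFun_tail_le hy hz 0

lemma norm_pow_sub_pow_le {z w : ℂ} (hz : ‖z‖ ≤ 1 / 2) (hw : ‖w‖ ≤ 1 / 2) (k : ℕ) :
    ‖z ^ k - w ^ k‖ ≤ k * (1 / 2) ^ (k - 1) * ‖z - w‖ := by
  rw [← (Commute.all z w).geom_sum₂_mul, norm_mul]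
  gcongr
  refine (norm_sum_le_of_le (f := fun i => z ^ i * w ^ (k - 1 - i)) (Finset.range k)
    (n := fun _ => (1 / 2) ^ (k - 1)) fun i hi => ?_).trans ?_
  · have : i + (k - 1 - i) = k - 1 := by have := Finset.mem_range.1 hi; omega
    rw [norm_mul, norm_pow, norm_pow, ← this, pow_add, this]
    gcongr
  · simp

lemma norm_legFun_sub_le {y z w : ℂ} (hy : ‖y - 1‖ ≤ 1 / 2) (hz : ‖z‖ ≤ 1 / 2)
    (hw : ‖w‖ ≤ 1 / 2) : ‖legFun y z - legFun y w‖ ≤ 72 * ‖y - 1‖ * ‖z - w‖ := by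
  have h1 : HasSum (fun k => legCoeff y k * z ^ k - legCoeff y k * w ^ k)
      (legFun y z - legFun y w) :=
    (hasSum_legCoeff y (hz.trans_lt (by norm_num))).sub
      (hasSum_legCoeff y (hw.trans_lt (by norm_num)))
  have h0 : HasSum (fun k : ℕ => (k : ℝ) * (3 / 4 : ℝ) ^ k) (3 / 4 / (1 - 3 / 4) ^ 2) :=
    hasSum_coe_mul_geometric_of_norm_lt_one (by norm_num)
  have h2 := h0.mul_left (6 * ‖y - 1‖ * ‖z - w‖)
  rw [← h1.tsum_eq]
  refine (tsum_of_norm_bounded h2 fun k => ?_).trans (le_of_eq (by ring))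
  rw [← mul_sub, norm_mul]
  rcases k with _ | k
  · simp
  calc _ ≤ 3 * ‖y - 1‖ * (3 / 2) ^ (k + 1) *
        (((k + 1 : ℕ) : ℝ) * (1 / 2) ^ (k + 1 - 1) * ‖z - w‖) := by
        gcongr
        · exact norm_legCoeff_le hy k
        · exact norm_pow_sub_pow_le hz hw _
    _ = _ := by
      have : (3 / 4 : ℝ) ^ (k + 1) = (3 / 2) ^ (k + 1) * ((1 / 2) ^ k * (1 / 2)) := by
        rw [← pow_succ, ← mul_pow]; norm_num
      rw [this, Nat.add_sub_cancel]
      ring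

lemma exists_root {y η : ℂ} (hy : ‖y - 1‖ ≤ 1 / 300) (hη : ‖η‖ ≤ 5 / 11) :
    ∃ z : ℂ, ‖z‖ ≤ 1 / 2 ∧ z * legFun y z = η := by
  have hy' : ‖y - 1‖ ≤ 1 / 2 := by linarith
  have hlow : ∀ z : ℂ, ‖z‖ ≤ 1 / 2 → 97 / 100 ≤ ‖legFun y z‖ := by
    intro z hz
    have h1 := norm_legFun_sub_one_le hy' hz
    have h2 := norm_sub_norm_le (1 : ℂ) (1 - legFun y z)
    rw [norm_one, sub_sub_cancel, norm_sub_rev] at h2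
    linarith
  have hmaps : Set.MapsTo (fun z => η / legFun y z) (Metric.closedBall 0 (1 / 2))
      (Metric.closedBall 0 (1 / 2)) := by
    intro z hz
    rw [mem_closedBall_zero_iff] at hz ⊢
    have := hlow z hz
    rw [norm_div, div_le_iff₀ (by linarith)]
    linarith
  have hcontr : ContractingWith (1 / 2) (hmaps.restrict _ _ _) := by
    refine ⟨by rw [← NNReal.coe_lt_coe]; norm_num, LipschitzWith.of_dist_le_mul ?_⟩
    rintro ⟨z, hz⟩ ⟨w, hw⟩
    rw [Subtype.dist_eq, Subtype.dist_eq]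
    simp only [Set.MapsTo.val_restrict_apply, dist_eq_norm]
    rw [mem_closedBall_zero_iff] at hz hw
    have h1 := hlow z hz
    have h2 := hlow w hw
    have hz0 : legFun y z ≠ 0 := norm_pos_iff.1 (by linarith)
    have hw0 : legFun y w ≠ 0 := norm_pos_iff.1 (by linarith)
    have e : η / legFun y z - η / legFun y w =
        η * (legFun y w - legFun y z) / (legFun y z * legFun y w) := by
      field_simp
    rw [e, norm_div, norm_mul, norm_mul, norm_sub_rev]
    have h3 := norm_legFun_sub_le hy' hz hw
    have h4 : ‖legFun y z - legFun y w‖ ≤ 6 / 25 * ‖z - w‖ := by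
      refine h3.trans ?_
      gcongr
      linarith
    rw [div_le_iff₀ (by nlinarith)]
    calc _ ≤ 5 / 11 * (6 / 25 * ‖z - w‖) := by gcongr
      _ ≤ (1 / 2 * ‖z - w‖) * (97 / 100 * (97 / 100)) := by nlinarith [norm_nonneg (z - w)]
      _ ≤ _ := by
        push_cast
        gcongr
  obtain ⟨z, hz, hfix, -⟩ := hcontr.exists_fixedPoint' Metric.isClosed_closedBall.isComplete
    hmaps (x := 0) (by simp) (edist_ne_top _ _)
  rw [mem_closedBall_zero_iff] at hz
  refine ⟨z, hz, ?_⟩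
  have h0 : legFun y z ≠ 0 := norm_pos_iff.1 (by linarith [hlow z hz])
  have h1 : η / legFun y z = z := hfix
  rw [div_eq_iff h0] at h1
  exact h1.symm

lemma sum_tail_mul_renewal {y X z : ℂ} (hz : X * z * legFun y z = 1) (n : ℕ) :
    ∑ i ∈ Finset.range (n + 1), (legFun y z - ∑ k ∈ Finset.range i, legCoeff y k * z ^ k) *
      (renewal y X (n - i) * z ^ (n - i)) = legFun y z := by
  induction n with
  | zero => simp [renewal_zero]
  | succ n ih =>
    rw [Finset.sum_range_succ']
    simp only [Nat.add_sub_add_right, Nat.sub_zero, Finset.range_zero, Finset.sum_empty, sub_zero]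
    have h1 : legFun y z * (renewal y X (n + 1) * z ^ (n + 1)) =
        ∑ i ∈ Finset.range (n + 1), legCoeff y i * z ^ i *
          (renewal y X (n - i) * z ^ (n - i)) := by
      have : legFun y z * (renewal y X (n + 1) * z ^ (n + 1)) =
          ∑ k ∈ Finset.range (n + 1), legCoeff y k * renewal y X (n - k) * z ^ n := by
        rw [renewal_succ, ← Finset.sum_mul, pow_succ]
        linear_combination (∑ k ∈ Finset.range (n + 1), legCoeff y k * renewal y X (n - k)) *
          z ^ n * hz
      rw [this]
      refine Finset.sum_congr rfl fun i hi => ?_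
      have hi' : i + (n - i) = n := by have := Finset.mem_range.1 hi; omega
      rw [← hi', pow_add, hi']
      ring
    rw [h1, ← Finset.sum_add_distrib]
    refine Eq.trans (Finset.sum_congr rfl fun i _ => ?_) ih
    rw [Finset.sum_range_succ]
    ring

lemma norm_renewal_mul_pow_sub_one_le {y X z : ℂ} (hy : ‖y - 1‖ ≤ 1 / 300) (hz' : ‖z‖ ≤ 1 / 2)
    (hz : X * z * legFun y z = 1) (n : ℕ) :
    ‖renewal y X n * z ^ n - 1‖ ≤ 100 * ‖y - 1‖ := by
  have hy' : ‖y - 1‖ ≤ 1 / 2 := by linarith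
  induction n using Nat.strong_induction_on with
  | _ n ih =>
  have h0 := norm_legFun_sub_one_le hy' hz'
  have hlow := norm_sub_norm_le (1 : ℂ) (1 - legFun y z)
  rw [norm_one, sub_sub_cancel, norm_sub_rev] at hlow
  have h1 := sum_tail_mul_renewal hz n
  rw [Finset.sum_range_succ'] at h1
  simp only [Finset.range_zero, Finset.sum_empty, sub_zero] at h1
  have h2 : ‖∑ i ∈ Finset.range n,
      (legFun y z - ∑ k ∈ Finset.range (i + 1), legCoeff y k * z ^ k) *
        (renewal y X (n - (i + 1)) * z ^ (n - (i + 1)))‖ ≤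
      ∑ i ∈ Finset.range n, 9 * ‖y - 1‖ * (3 / 4) ^ i * 2 := by
    refine norm_sum_le_of_le _ fun i hi => ?_
    have hi' := Finset.mem_range.1 hi
    rw [norm_mul]
    gcongr
    · exact norm_legFun_tail_le hy' hz' i
    · have := ih (n - (i + 1)) (by omega)
      have h3 := norm_sub_norm_le (renewal y X (n - (i + 1)) * z ^ (n - (i + 1))) 1
      rw [norm_one] at h3
      linarith
  have h3 : ∑ i ∈ Finset.range n, 9 * ‖y - 1‖ * (3 / 4 : ℝ) ^ i * 2 ≤ 72 * ‖y - 1‖ := by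
    have h := sum_geometric_le (x := (3 / 4 : ℝ)) (by norm_num) (by norm_num) n
    norm_num at h
    rw [← Finset.sum_mul, ← Finset.mul_sum]
    nlinarith [norm_nonneg (y - 1)]
  have h4 : legFun y z * (renewal y X n * z ^ n - 1) = -∑ i ∈ Finset.range n,
      (legFun y z - ∑ k ∈ Finset.range (i + 1), legCoeff y k * z ^ k) *
        (renewal y X (n - (i + 1)) * z ^ (n - (i + 1))) := by
    linear_combination h1
  have h5 := congrArg norm h4
  rw [norm_neg, norm_mul] at h5
  nlinarith [norm_nonneg (renewal y X n * z ^ n - 1)]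

end Renewal

section ScaledLimits

/-- The square root of `n`, as a complex number. -/
def sqrtC (n : ℕ) : ℂ := ((Real.sqrt n : ℝ) : ℂ)

lemma sqrtC_sq (n : ℕ) : sqrtC n * sqrtC n = n := by
  rw [sqrtC, ← Complex.ofReal_mul, Real.mul_self_sqrt (Nat.cast_nonneg n), Complex.ofReal_natCast]

lemma norm_sqrtC (n : ℕ) : ‖sqrtC n‖ = Real.sqrt n := by
  rw [sqrtC, Complex.norm_real, Real.norm_of_nonneg (Real.sqrt_nonneg _)]

lemma sqrtC_ne_zero {n : ℕ} (hn : n ≠ 0) : sqrtC n ≠ 0 := by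
  rw [← norm_pos_iff, norm_sqrtC]
  exact Real.sqrt_pos.2 (by positivity)

lemma tendsto_norm_sqrtC : Tendsto (fun n => ‖sqrtC n‖) atTop atTop := by
  simp only [norm_sqrtC]
  exact Real.tendsto_sqrt_atTop.comp tendsto_natCast_atTop_atTop

lemma tendsto_inv_sqrtC : Tendsto (fun n => (sqrtC n)⁻¹) atTop (𝓝 0) := by
  rw [tendsto_zero_iff_norm_tendsto_zero]
  simp only [norm_inv]
  exact tendsto_inv_atTop_zero.comp tendsto_norm_sqrtC

lemma tendsto_zero_of_sqrtC_mul {w : ℕ → ℂ} {l : ℂ}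
    (h : Tendsto (fun n => sqrtC n * w n) atTop (𝓝 l)) : Tendsto w atTop (𝓝 0) := by
  have h1 := tendsto_inv_sqrtC.mul h
  rw [zero_mul] at h1
  refine h1.congr' ?_
  filter_upwards [eventually_ne_atTop 0] with n hn
  rw [inv_mul_cancel_left₀ (sqrtC_ne_zero hn)]

lemma tendsto_sqrtC_mul_div (s : ℂ) : Tendsto (fun n => sqrtC n * (s / sqrtC n)) atTop (𝓝 s) := by
  refine tendsto_const_nhds.congr' ?_
  filter_upwards [eventually_ne_atTop 0] with n hn
  rw [mul_div_cancel₀ _ (sqrtC_ne_zero hn)]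

lemma tendsto_sqrtC_mul_comp {f : ℂ → ℂ} {f' x l : ℂ} (hf : HasDerivAt f f' x) {w : ℕ → ℂ}
    (h : Tendsto (fun n => sqrtC n * (w n - x)) atTop (𝓝 l)) :
    Tendsto (fun n => sqrtC n * (f (w n) - f x)) atTop (𝓝 (f' * l)) := by
  have := hf.hasFDerivAt.hasFDerivWithinAt (s := Set.univ) |>.lim
    (l := atTop) (c := sqrtC) (d := fun n => w n - x) (v := l) (tendsto_zero_of_sqrtC_mul h)
    (by simp) h
  simpa [mul_comm] using this

lemma norm_exp_sub_quadratic_le {w : ℂ} (hw : ‖w‖ ≤ 1) :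
    ‖Complex.exp w - 1 - w - w ^ 2 / 2‖ ≤ ‖w‖ ^ 3 := by
  have h := Complex.exp_bound hw (n := 3) (by norm_num)
  simp only [Finset.sum_range_succ, Finset.sum_range_zero, Nat.factorial] at h
  have e : Complex.exp w - 1 - w - w ^ 2 / 2 = Complex.exp w -
      (0 + w ^ 0 / ((1 : ℕ) : ℂ) + w ^ 1 / ((Nat.succ 0 * 1 : ℕ) : ℂ) +
        w ^ 2 / ((Nat.succ 1 * (Nat.succ 0 * 1) : ℕ) : ℂ)) := by
    push_cast; ring
  rw [e]
  refine h.trans ?_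
  norm_num
  nlinarith [pow_nonneg (norm_nonneg w) 3]

lemma tendsto_mul_exp_sub_one_sub {w : ℕ → ℂ} {l : ℂ}
    (h : Tendsto (fun n => sqrtC n * w n) atTop (𝓝 l)) :
    Tendsto (fun n : ℕ => (n : ℂ) * (Complex.exp (w n) - 1 - w n)) atTop (𝓝 (l ^ 2 / 2)) := by
  have h0 := tendsto_zero_of_sqrtC_mul h
  have h1 : Tendsto (fun n : ℕ => (n : ℂ) * (Complex.exp (w n) - 1 - w n - w n ^ 2 / 2))
      atTop (𝓝 0) := by
    have h2 : Tendsto (fun n => ‖sqrtC n * w n‖ ^ 2 * ‖w n‖) atTop (𝓝 0) := by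
      simpa using (h.norm.pow 2).mul h0.norm
    refine squeeze_zero_norm' ?_ h2
    filter_upwards [h0.norm.eventually_le_const (u := 1) (by simp)] with n hn
    rw [norm_mul, norm_mul, norm_sqrtC, mul_pow, Real.sq_sqrt (Nat.cast_nonneg n),
      Complex.norm_natCast, mul_assoc, ← pow_succ]
    gcongr
    exact norm_exp_sub_quadratic_le hn
  have h3 := h1.add ((h.pow 2).div_const 2)
  rw [zero_add] at h3
  refine h3.congr fun n => ?_
  rw [mul_pow, sq (sqrtC n), sqrtC_sq]
  ring

lemma tendsto_sqrtC_mul_exp_sub_one (s : ℂ) :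
    Tendsto (fun n => sqrtC n * (Complex.exp (s / sqrtC n) - 1)) atTop (𝓝 s) := by
  have h := tendsto_sqrtC_mul_comp (f := Complex.exp) (f' := 1) (x := 0) (l := s)
    (by simpa using Complex.hasDerivAt_exp 0) (w := fun n => s / sqrtC n)
    (by simpa using tendsto_sqrtC_mul_div s)
  simpa using h

lemma tendsto_mul_tilt {p l : ℂ} (s : ℂ) {P : ℕ → ℂ}
    (hP : Tendsto (fun n => sqrtC n * (P n - p)) atTop (𝓝 l)) :
    Tendsto (fun n : ℕ => (n : ℂ) * (((Complex.exp (s / sqrtC n) - 1) * Complex.exp (-P n) +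
        Complex.exp ((Complex.exp (s / sqrtC n) - 1) * P n)) *
        Complex.exp (-(s / sqrtC n * (p + Complex.exp (-p)))) - 1)) atTop
      (𝓝 (s * l * (1 - Complex.exp (-p)) + s ^ 2 / 2 * (p + Complex.exp (-p)) + (s * p) ^ 2 / 2 -
        (s * (p + Complex.exp (-p))) ^ 2 / 2)) := by
  set c := p + Complex.exp (-p) with hc
  have hP0 : Tendsto P atTop (𝓝 p) := by
    simpa using (tendsto_zero_of_sqrtC_mul hP).add_const p
  have hg : HasDerivAt (fun x : ℂ => x + Complex.exp (-x)) (1 - Complex.exp (-p)) p := by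
    have := (hasDerivAt_id p).add ((hasDerivAt_neg p).cexp)
    exact this.congr_deriv (by ring)
  have hgP : Tendsto (fun n => P n + Complex.exp (-P n)) atTop (𝓝 c) :=
    (hg.continuousAt.tendsto.comp hP0)
  have h1 := (tendsto_sqrtC_mul_comp hg hP).const_mul s
  have h2 := (tendsto_mul_exp_sub_one_sub (tendsto_sqrtC_mul_div s)).mul hgP
  have h3 : Tendsto (fun n => sqrtC n * ((Complex.exp (s / sqrtC n) - 1) * P n)) atTop
      (𝓝 (s * p)) := by
    simpa [mul_assoc] using (tendsto_sqrtC_mul_exp_sub_one s).mul hP0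
  have h4 := tendsto_mul_exp_sub_one_sub h3
  have h5 : Tendsto (fun n => sqrtC n * (s / sqrtC n * c)) atTop (𝓝 (s * c)) := by
    simpa [mul_assoc] using (tendsto_sqrtC_mul_div s).mul_const c
  have h6 := tendsto_mul_exp_sub_one_sub h5
  have h7 : Tendsto (fun n => Complex.exp (-(s / sqrtC n * c))) atTop (𝓝 1) := by
    have := ((tendsto_zero_of_sqrtC_mul h5).neg).cexp
    simpa using this
  have h8 := (((h1.add h2).add h4).sub h6).mul h7
  rw [mul_one] at h8
  have e : s * ((1 - Complex.exp (-p)) * l) = s * l * (1 - Complex.exp (-p)) := by ring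
  rw [e] at h8
  refine h8.congr' ?_
  filter_upwards [eventually_ne_atTop 0] with n hn
  have hs : s * sqrtC n = n * (s / sqrtC n) := by
    rw [← sqrtC_sq, mul_assoc, mul_div_cancel₀ _ (sqrtC_ne_zero hn), mul_comm]
  have he : Complex.exp (s / sqrtC n * c) * Complex.exp (-(s / sqrtC n * c)) = 1 := by
    rw [← Complex.exp_add, add_neg_cancel, Complex.exp_zero]
  rw [← mul_assoc s, hs]
  linear_combination (-(n : ℂ)) * he

lemma legFun_exp_mul (σ z b : ℂ) : legFun (Complex.exp σ) z * Complex.exp (-(σ * b)) =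
    ((Complex.exp σ - 1) * Complex.exp (-(z / (1 - z))) +
      Complex.exp ((Complex.exp σ - 1) * (z / (1 - z)))) * Complex.exp (-(σ * (1 + b))) := by
  have h0 := Complex.exp_ne_zero σ
  rw [legFun, mul_add σ, mul_one, neg_add, Complex.exp_add, Complex.exp_neg σ, neg_one_mul]
  field_simp

lemma tendsto_sqrtC_mul_legFun_sub_one {z : ℂ} (hz : z ≠ 1) (s : ℂ) {w : ℕ → ℂ}
    (hw : Tendsto w atTop (𝓝 z)) :
    Tendsto (fun n => sqrtC n * (legFun (Complex.exp (s / sqrtC n)) (w n) - 1)) atTop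
      (𝓝 (s * (z / (1 - z) + Complex.exp (-(z / (1 - z))) - 1))) := by
  have hP : Tendsto (fun n => w n / (1 - w n)) atTop (𝓝 (z / (1 - z))) :=
    hw.div (hw.const_sub 1) (sub_ne_zero.2 hz.symm)
  have h1 := tendsto_sqrtC_mul_exp_sub_one s
  have h3 : Tendsto (fun n => sqrtC n * ((Complex.exp (s / sqrtC n) - 1) * (w n / (1 - w n))))
      atTop (𝓝 (s * (z / (1 - z)))) := by
    simpa [mul_assoc] using h1.mul hP
  have h4 : Tendsto (fun n => sqrtC n *
      (Complex.exp ((Complex.exp (s / sqrtC n) - 1) * (w n / (1 - w n))) - 1))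
      atTop (𝓝 (s * (z / (1 - z)))) := by
    have := tendsto_sqrtC_mul_comp (f := Complex.exp) (f' := 1) (x := 0)
      (by simpa using Complex.hasDerivAt_exp 0) (l := s * (z / (1 - z)))
      (w := fun n => (Complex.exp (s / sqrtC n) - 1) * (w n / (1 - w n))) (by simpa using h3)
    simpa using this
  have h5 : Tendsto (fun n => (Complex.exp (s / sqrtC n))⁻¹) atTop (𝓝 1) := by
    have := ((tendsto_zero_of_sqrtC_mul (tendsto_sqrtC_mul_div s)).cexp).inv₀ (by simp)
    simpa using this
  have h6 := (((h1.mul (hP.neg.cexp)).add h4).sub h1).mul h5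
  have e : (s * Complex.exp (-(z / (1 - z))) + s * (z / (1 - z)) - s) * 1 =
      s * (z / (1 - z) + Complex.exp (-(z / (1 - z))) - 1) := by ring
  rw [e] at h6
  refine h6.congr fun n => ?_
  have h0 := Complex.exp_ne_zero (s / sqrtC n)
  rw [legFun, neg_one_mul]
  field_simp
  ring

end ScaledLimits

section Constants

/-- The value at `1 / e` of the generating function `z / (1 - z)` of paths. -/
def pathMean : ℝ := 1 / (Real.exp 1 - 1)

/-- The asymptotic mean of the metric dimension of a random tree, per vertex. -/
def dimMean : ℝ := pathMean + Real.exp (-pathMean) - 1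

/-- The asymptotic variance of the metric dimension of a random tree, per vertex. -/
def dimVar : ℝ := (1 + dimMean) + pathMean ^ 2 - (1 + dimMean) ^ 2 -
  2 * dimMean * (pathMean * (1 + pathMean)) * (1 - Real.exp (-pathMean))

lemma pathMean_bounds : 0.5819 < pathMean ∧ pathMean < 0.582 := by
  have h1 := Real.exp_one_gt_d9
  have h2 := Real.exp_one_lt_d9
  rw [pathMean, lt_div_iff₀ (by linarith), div_lt_iff₀ (by linarith)]
  constructor <;> linarith

lemma exp_neg_pathMean_bounds : 0.557 < Real.exp (-pathMean) ∧ Real.exp (-pathMean) < 0.561 := by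
  obtain ⟨h1, h2⟩ := pathMean_bounds
  have h := Real.exp_bound (x := -pathMean) (by rw [abs_neg, abs_of_pos] <;> linarith) (n := 5)
    (by norm_num)
  simp only [Finset.sum_range_succ, Finset.sum_range_zero, Nat.factorial] at h
  rw [abs_neg, abs_of_pos (by linarith : 0 < pathMean), abs_le] at h
  norm_num at h
  have p2 : pathMean ^ 2 < 0.582 ^ 2 := by gcongr
  have p2' : 0.5819 ^ 2 < pathMean ^ 2 := by gcongr
  have p3 : pathMean ^ 3 < 0.582 ^ 3 := by gcongr
  have p3' : 0.5819 ^ 3 < pathMean ^ 3 := by gcongr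
  have p4 : pathMean ^ 4 < 0.582 ^ 4 := by gcongr
  have p4' : 0.5819 ^ 4 < pathMean ^ 4 := by gcongr
  have p5 : pathMean ^ 5 < 0.582 ^ 5 := by gcongr
  norm_num [Odd.neg_pow (by decide : Odd 3)] at *
  constructor <;> nlinarith

lemma dimVar_pos : 0 < dimVar := by
  obtain ⟨h1, h2⟩ := pathMean_bounds
  obtain ⟨h3, h4⟩ := exp_neg_pathMean_bounds
  rw [dimVar, dimMean]
  generalize pathMean = p at *
  generalize Real.exp (-p) = q at *
  have a1 : p * (1 + p) ≤ 0.582 * (1 + 0.582) := by gcongr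
  have a2 : (p + q - 1) * (p * (1 + p)) ≤ 0.143 * (0.582 * (1 + 0.582)) := by
    gcongr
    nlinarith
  have a3 : (p + q - 1) * (p * (1 + p)) * (1 - q) ≤ 0.143 * (0.582 * (1 + 0.582)) * 0.443 := by
    gcongr <;> linarith
  have a4 : 0.5819 ^ 2 ≤ p ^ 2 := by gcongr
  have a5 : (1 + (p + q - 1)) * ((p + q - 1)) ≤ 1.143 * 0.143 := by
    gcongr <;> linarith
  norm_num at *
  nlinarith

end Constants

section Kernel

/-- The kernel whose `m`-th power integrates to `2 * π * m ^ m / m !` over a period. -/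
def kern (θ : ℂ) : ℂ := Complex.exp (Complex.exp (θ * Complex.I) - θ * Complex.I)

lemma continuous_kern : Continuous kern := by
  unfold kern
  fun_prop

lemma kern_add_two_pi (θ : ℝ) : kern ((θ + 2 * Real.pi : ℝ) : ℂ) = kern θ := by
  rw [kern, kern]
  push_cast
  rw [add_mul, Complex.exp_add, Complex.exp_two_pi_mul_I, mul_one, ← sub_sub, Complex.exp_sub _
    (2 * (Real.pi : ℂ) * Complex.I), Complex.exp_two_pi_mul_I, div_one]

lemma intervalIntegral_kern_pow (m : ℕ) : ∫ θ in (-Real.pi)..Real.pi, kern θ ^ m =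
    2 * Real.pi * ((m : ℂ) ^ m / m.factorial) := by
  have h1 : Function.Periodic (fun θ : ℝ => kern θ ^ m) (2 * Real.pi) := fun θ => by
    simp only [kern_add_two_pi]
  have h2 := h1.intervalIntegral_add_eq (-Real.pi) 0
  rw [show -Real.pi + 2 * Real.pi = Real.pi by ring, zero_add] at h2
  rw [h2]
  have hd : Differentiable ℂ fun z : ℂ => Complex.exp ((m : ℂ) * z) := by fun_prop
  have h3 := (hd.diffContOnCl (s := Metric.ball 0 1)).circleIntegral_one_div_sub_center_pow_smul
    one_pos m
  have h4 : iteratedDeriv m (fun z : ℂ => Complex.exp ((m : ℂ) * z)) 0 = (m : ℂ) ^ m := by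
    rw [iteratedDeriv_cexp_const_mul]
    simp
  rw [h4, circleIntegral] at h3
  have h5 : ∀ θ : ℝ, deriv (circleMap 0 1) θ • ((1 / (circleMap 0 1 θ - 0) ^ (m + 1)) •
      Complex.exp ((m : ℂ) * circleMap 0 1 θ)) = Complex.I * kern θ ^ m := by
    intro θ
    have h6 : circleMap 0 1 θ = Complex.exp (θ * Complex.I) := by simp [circleMap]
    have h0 := Complex.exp_ne_zero (θ * Complex.I)
    rw [deriv_circleMap, h6, sub_zero, smul_eq_mul, smul_eq_mul, kern, Complex.exp_sub,
      div_pow, Complex.exp_nat_mul, pow_succ]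
    field_simp
  simp only [h5] at h3
  rw [intervalIntegral.integral_const_mul, smul_eq_mul] at h3
  have := Complex.I_ne_zero
  apply mul_left_cancel₀ this
  rw [h3]
  ring

lemma sum_coeff_eq_integral (y : ℂ) (n : ℕ) :
    2 * Real.pi * ∑ m ∈ Finset.range (n + 1), (m : ℂ) ^ m / m.factorial *
      PowerSeries.coeff (n - m) (legSeries y ^ m) =
    ∫ θ in (-Real.pi)..Real.pi, renewal y (kern θ) n := by
  unfold renewal
  have hc : ∀ m : ℕ, Continuous fun θ : ℝ => kern θ ^ m := fun m =>
    (continuous_kern.comp Complex.continuous_ofReal).pow m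
  rw [intervalIntegral.integral_finsetSum]
  · rw [Finset.mul_sum]
    refine Finset.sum_congr rfl fun m _ => ?_
    rw [intervalIntegral.integral_mul_const, intervalIntegral_kern_pow]
    ring
  · intro m _
    exact ((hc m).mul continuous_const).intervalIntegrable _ _

lemma norm_kern (θ : ℝ) : ‖kern θ‖ = Real.exp (Real.cos θ) := by
  rw [kern, Complex.norm_exp]
  congr 1
  rw [Complex.sub_re, Complex.exp_ofReal_mul_I_re]
  simp

lemma kern_ne_zero (θ : ℂ) : kern θ ≠ 0 := Complex.exp_ne_zero _

lemma inv_kern (θ : ℂ) : (kern θ)⁻¹ =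
    Complex.exp (-1) * Complex.exp (-(Complex.exp (θ * Complex.I) - 1 - θ * Complex.I)) := by
  rw [kern, ← Complex.exp_neg, ← Complex.exp_add]
  ring_nf

lemma norm_inv_kern_sub_le {θ : ℝ} (h : ‖(kern θ)⁻¹‖ ≤ 5 / 11) :
    ‖(kern θ)⁻¹ - Complex.exp (-1)‖ ≤ 2 * θ ^ 2 := by
  have he : ‖Complex.exp (-1)‖ ≤ 1 := by
    rw [Complex.norm_exp]
    simp
  rcases le_or_gt |θ| 1 with hθ | hθ
  · have h1 : ‖(θ : ℂ) * Complex.I‖ = |θ| := by simp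
    have h2 := Complex.norm_exp_sub_one_sub_id_le (x := (θ : ℂ) * Complex.I) (by rwa [h1])
    rw [h1, sq_abs] at h2
    have h3 : ‖-(Complex.exp ((θ : ℂ) * Complex.I) - 1 - (θ : ℂ) * Complex.I)‖ ≤ 1 := by
      rw [norm_neg]
      refine h2.trans ?_
      rw [← sq_abs]
      exact pow_le_one₀ (abs_nonneg _) hθ
    have h4 := Complex.norm_exp_sub_one_le h3
    rw [norm_neg] at h4
    have e : (kern θ)⁻¹ - Complex.exp (-1) = Complex.exp (-1) *
        (Complex.exp (-(Complex.exp ((θ : ℂ) * Complex.I) - 1 - (θ : ℂ) * Complex.I)) - 1) := by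
      rw [inv_kern]; ring
    rw [e, norm_mul]
    nlinarith [norm_nonneg (Complex.exp (-(Complex.exp ((θ : ℂ) * Complex.I) - 1 -
      (θ : ℂ) * Complex.I)) - 1)]
  · have h1 := norm_sub_le (kern θ)⁻¹ (Complex.exp (-1))
    have h2 : 1 < θ ^ 2 := by
      rw [← sq_abs]
      exact one_lt_pow₀ hθ (by norm_num)
    linarith

lemma hasDerivAt_inv_kern : HasDerivAt (fun θ => (kern θ)⁻¹) 0 0 := by
  have h1 : HasDerivAt (fun θ : ℂ => θ * Complex.I) Complex.I 0 := by
    simpa using (hasDerivAt_id (0 : ℂ)).mul_const Complex.I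
  have h2 := ((h1.cexp.sub_const 1).sub h1).neg.cexp.const_mul (Complex.exp (-1))
  simp only [inv_kern]
  refine h2.congr_deriv ?_
  simp

lemma inv_kern_zero : (kern 0)⁻¹ = Complex.exp (-1) := by
  rw [inv_kern]; simp

lemma tendsto_kern_pow (t : ℂ) :
    Tendsto (fun n : ℕ => (kern (t / sqrtC n) * Complex.exp (-1)) ^ n) atTop
      (𝓝 (Complex.exp (-t ^ 2 / 2))) := by
  have h1 : Tendsto (fun n => sqrtC n * (t / sqrtC n * Complex.I)) atTop
      (𝓝 (t * Complex.I)) := by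
    simpa [mul_assoc] using (tendsto_sqrtC_mul_div t).mul_const Complex.I
  have h2 := (tendsto_mul_exp_sub_one_sub h1).cexp
  rw [mul_pow, Complex.I_sq, mul_neg_one] at h2
  refine h2.congr fun n => ?_
  rw [kern, ← Complex.exp_add, ← Complex.exp_nat_mul]
  ring_nf

end Kernel

section Pointwise

lemma exp_neg_one_div : Complex.exp (-1) / (1 - Complex.exp (-1)) = pathMean := by
  have h : (Real.exp 1 : ℂ) - 1 ≠ 0 := by
    rw [← Complex.ofReal_one, ← Complex.ofReal_sub, Complex.ofReal_ne_zero]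
    linarith [Real.exp_one_gt_d9]
  rw [pathMean, Complex.exp_neg]
  push_cast at *
  have := Complex.exp_ne_zero 1
  field_simp

lemma exp_neg_one_ne_one : Complex.exp (-1) ≠ 1 := by
  intro h
  have := congrArg norm h
  rw [Complex.norm_exp, norm_one, Complex.neg_re, Complex.one_re, Real.exp_eq_one_iff] at this
  norm_num at this

lemma norm_root_sub_le {y z η : ℂ} (hy : ‖y - 1‖ ≤ 1 / 300) (hz : ‖z‖ ≤ 1 / 2)
    (h : z * legFun y z = η) : ‖z - η‖ ≤ 9 / 2 * ‖y - 1‖ := by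
  have e : z - η = -(z * (legFun y z - 1)) := by rw [← h]; ring
  rw [e, norm_neg, norm_mul]
  have h1 := norm_legFun_sub_one_le (by linarith : ‖y - 1‖ ≤ 1 / 2) hz
  calc _ ≤ 1 / 2 * (9 * ‖y - 1‖) := by gcongr
    _ = _ := by ring

lemma tendsto_exp_div_sqrtC (s : ℂ) :
    Tendsto (fun n => Complex.exp (s / sqrtC n)) atTop (𝓝 1) := by
  simpa using (tendsto_zero_of_sqrtC_mul (tendsto_sqrtC_mul_div s)).cexp

lemma tendsto_legFun_root_pow {s : ℂ} {η z : ℕ → ℂ}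
    (hη : Tendsto (fun n => sqrtC n * (η n - Complex.exp (-1))) atTop (𝓝 0))
    (hz : ∀ᶠ n in atTop, ‖z n‖ ≤ 1 / 2)
    (hroot : ∀ᶠ n in atTop, z n * legFun (Complex.exp (s / sqrtC n)) (z n) = η n) :
    Tendsto (fun n : ℕ => (legFun (Complex.exp (s / sqrtC n)) (z n) *
      Complex.exp (-(s / sqrtC n * dimMean))) ^ n) atTop (𝓝 (Complex.exp (s ^ 2 * dimVar / 2))) := by
  have hy := tendsto_exp_div_sqrtC s
  have hy' : Tendsto (fun n => ‖Complex.exp (s / sqrtC n) - 1‖) atTop (𝓝 0) := by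
    simpa using (hy.sub_const 1).norm
  have hη0 : Tendsto η atTop (𝓝 (Complex.exp (-1))) := by
    simpa using (tendsto_zero_of_sqrtC_mul hη).add_const (Complex.exp (-1))
  have hz0 : Tendsto z atTop (𝓝 (Complex.exp (-1))) := by
    have h1 : Tendsto (fun n => z n - η n) atTop (𝓝 0) := by
      refine squeeze_zero_norm' ?_ (by simpa using hy'.const_mul (9 / 2))
      filter_upwards [hz, hroot, hy'.eventually_le_const (u := 1 / 300) (by norm_num)]
        with n h1 h2 h3
      exact norm_root_sub_le h3 h1 h2
    simpa using h1.add hη0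
  have ha := tendsto_sqrtC_mul_legFun_sub_one exp_neg_one_ne_one s hz0
  have ha1 : Tendsto (fun n => legFun (Complex.exp (s / sqrtC n)) (z n)) atTop (𝓝 1) := by
    simpa using (tendsto_zero_of_sqrtC_mul ha).add_const 1
  rw [exp_neg_one_div] at ha
  have hμ : (pathMean : ℂ) + Complex.exp (-pathMean) - 1 = dimMean := by
    rw [dimMean]; push_cast; rfl
  have hμ' : (pathMean : ℂ) + Complex.exp (-pathMean) = 1 + dimMean := by rw [← hμ]; ring
  rw [hμ] at ha
  have hzz : Tendsto (fun n => sqrtC n * (z n - Complex.exp (-1))) atTop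
      (𝓝 (-(Complex.exp (-1) * (s * dimMean)))) := by
    have h1 := (hη.sub (ha.const_mul (Complex.exp (-1)))).div ha1 one_ne_zero
    rw [zero_sub, div_one] at h1
    refine h1.congr' ?_
    filter_upwards [hroot, ha1.eventually_ne one_ne_zero] with n h2 h3
    rw [Pi.div_apply, div_eq_iff h3, ← h2]
    ring
  have hd : HasDerivAt (fun z : ℂ => z / (1 - z)) (1 / (1 - Complex.exp (-1)) ^ 2)
      (Complex.exp (-1)) := by
    have h1 := (hasDerivAt_id (Complex.exp (-1))).div
      ((hasDerivAt_id (Complex.exp (-1))).const_sub 1) (sub_ne_zero.2 exp_neg_one_ne_one.symm)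
    refine h1.congr_deriv ?_
    simp
  have hP := tendsto_sqrtC_mul_comp hd hzz
  rw [exp_neg_one_div] at hP
  have h1 := tendsto_mul_tilt s hP
  have h2 := Complex.tendsto_one_add_pow_exp_of_tendsto h1
  refine Tendsto.congr (fun n => ?_) (h2.trans (le_of_eq ?_))
  · rw [legFun_exp_mul, hμ']
    ring
  · congr 2
    have e : Complex.exp (-1) / (1 - Complex.exp (-1)) ^ 2 = pathMean * (1 + pathMean) := by
      rw [← exp_neg_one_div]
      have := sub_ne_zero.2 exp_neg_one_ne_one.symm
      field_simp
      ring
    have e' : 1 / (1 - Complex.exp (-1)) ^ 2 * -(Complex.exp (-1) * (s * dimMean)) =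
        -(s * dimMean * (pathMean * (1 + pathMean))) := by
      rw [← e]; ring
    rw [e', hμ', dimVar]
    push_cast
    ring

/-- The normalised integrand representing the moment generating function. -/
def integrand (s : ℂ) (n : ℕ) (t : ℝ) : ℂ :=
  Complex.exp (-1) ^ n * Complex.exp (-(s / sqrtC n * dimMean)) ^ n *
    renewal (Complex.exp (s / sqrtC n)) (kern (t / sqrtC n)) n

lemma integrand_eq {s z : ℂ} {n : ℕ} {t : ℝ}
    (h : kern (t / sqrtC n) * z * legFun (Complex.exp (s / sqrtC n)) z = 1) :
    integrand s n t = renewal (Complex.exp (s / sqrtC n)) (kern (t / sqrtC n)) n * z ^ n *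
      (kern (t / sqrtC n) * Complex.exp (-1)) ^ n *
      (legFun (Complex.exp (s / sqrtC n)) z * Complex.exp (-(s / sqrtC n * dimMean))) ^ n := by
  have h' : kern (t / sqrtC n) ^ n * z ^ n * legFun (Complex.exp (s / sqrtC n)) z ^ n = 1 := by
    rw [← mul_pow, ← mul_pow, h, one_pow]
  rw [integrand, mul_pow, mul_pow]
  linear_combination -(renewal (Complex.exp (s / sqrtC n)) (kern (t / sqrtC n)) n *
    Complex.exp (-1) ^ n * Complex.exp (-(s / sqrtC n * dimMean)) ^ n) * h'

lemma tendsto_integrand (s : ℂ) (t : ℝ) : Tendsto (fun n => integrand s n t) atTop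
    (𝓝 (Complex.exp (-(t : ℂ) ^ 2 / 2) * Complex.exp (s ^ 2 * dimVar / 2))) := by
  set η : ℕ → ℂ := fun n => (kern (t / sqrtC n))⁻¹ with hη_def
  have hη : Tendsto (fun n => sqrtC n * (η n - Complex.exp (-1))) atTop (𝓝 0) := by
    have := tendsto_sqrtC_mul_comp hasDerivAt_inv_kern (w := fun n => (t : ℂ) / sqrtC n) (l := t)
      (by simpa using tendsto_sqrtC_mul_div t)
    rw [inv_kern_zero, zero_mul] at this
    exact this
  have hη0 : Tendsto η atTop (𝓝 (Complex.exp (-1))) := by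
    simpa using (tendsto_zero_of_sqrtC_mul hη).add_const (Complex.exp (-1))
  have he : ‖Complex.exp (-1)‖ < 5 / 11 := by
    rw [Complex.norm_exp, Complex.neg_re, Complex.one_re, Real.exp_neg]
    have := Real.exp_one_gt_d9
    rw [inv_lt_comm₀ (by positivity) (by norm_num)]
    linarith
  have hy' : Tendsto (fun n => ‖Complex.exp (s / sqrtC n) - 1‖) atTop (𝓝 0) := by
    simpa using ((tendsto_exp_div_sqrtC s).sub_const 1).norm
  have hex : ∀ n, ∃ z : ℂ, ‖Complex.exp (s / sqrtC n) - 1‖ ≤ 1 / 300 → ‖η n‖ ≤ 5 / 11 →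
      ‖z‖ ≤ 1 / 2 ∧ z * legFun (Complex.exp (s / sqrtC n)) z = η n := by
    intro n
    by_cases h : ‖Complex.exp (s / sqrtC n) - 1‖ ≤ 1 / 300 ∧ ‖η n‖ ≤ 5 / 11
    · obtain ⟨z, hz⟩ := exists_root h.1 h.2
      exact ⟨z, fun _ _ => hz⟩
    · exact ⟨0, fun h1 h2 => (h ⟨h1, h2⟩).elim⟩
  choose z hz using hex
  have hy300 := hy'.eventually_le_const (u := 1 / 300) (by norm_num)
  have hev : ∀ᶠ n in atTop, ‖z n‖ ≤ 1 / 2 ∧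
      z n * legFun (Complex.exp (s / sqrtC n)) (z n) = η n := by
    filter_upwards [hy300, hη0.norm.eventually_le_const he] with n h1 h2
    exact hz n h1 h2
  have h1 := tendsto_legFun_root_pow hη (hev.mono fun _ h => h.1) (hev.mono fun _ h => h.2)
  have h2 := tendsto_kern_pow t
  have h3 : Tendsto (fun n => renewal (Complex.exp (s / sqrtC n)) (kern (t / sqrtC n)) n *
      z n ^ n) atTop (𝓝 1) := by
    rw [tendsto_iff_norm_sub_tendsto_zero]
    refine squeeze_zero' (Eventually.of_forall fun _ => norm_nonneg _) ?_
      (by simpa using hy'.const_mul 100)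
    filter_upwards [hy300, hev] with n hn1 hn2
    refine norm_renewal_mul_pow_sub_one_le hn1 hn2.1 ?_ n
    rw [mul_assoc, hn2.2, hη_def, mul_inv_cancel₀ (kern_ne_zero _)]
  have h4 := (h3.mul h2).mul h1
  rw [one_mul] at h4
  refine h4.congr' ?_
  filter_upwards [hev] with n hn
  refine (integrand_eq ?_).symm
  rw [mul_assoc, hn.2, hη_def, mul_inv_cancel₀ (kern_ne_zero _)]

end Pointwise

section Domination

lemma ofReal_div_sqrtC (t : ℝ) (n : ℕ) : (t : ℂ) / sqrtC n = ((t / Real.sqrt n : ℝ) : ℂ) := by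
  rw [sqrtC, Complex.ofReal_div]

lemma norm_kern_mul_pow_le {n : ℕ} (hn : n ≠ 0) {t : ℝ} (ht : |t| ≤ Real.pi * Real.sqrt n) :
    ‖(kern (t / sqrtC n) * Complex.exp (-1)) ^ n‖ ≤ Real.exp (-(2 / Real.pi ^ 2 * t ^ 2)) := by
  have hs : 0 < Real.sqrt n := Real.sqrt_pos.2 (by positivity)
  have hn' : (0 : ℝ) < n := by positivity
  rw [ofReal_div_sqrtC, norm_pow, norm_mul, norm_kern, Complex.norm_exp, ← Real.exp_add,
    ← Real.exp_nat_mul, Real.exp_le_exp]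
  have h := Real.cos_le_one_sub_mul_cos_sq (x := t / Real.sqrt n) (by
    rw [abs_div, abs_of_pos hs, div_le_iff₀ hs]; exact ht)
  rw [div_pow, Real.sq_sqrt hn'.le] at h
  calc _ ≤ (n : ℝ) * (-(2 / Real.pi ^ 2 * (t ^ 2 / n))) := by
        refine mul_le_mul_of_nonneg_left ?_ hn'.le
        simp only [Complex.neg_re, Complex.one_re]
        linarith
    _ = _ := by field_simp

lemma one_add_div_pow_le_exp {n : ℕ} {x : ℝ} (hx : 0 ≤ x) : (1 + x / n) ^ n ≤ Real.exp x := by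
  rcases eq_or_ne n 0 with rfl | hn
  · simpa using hx
  calc (1 + x / n) ^ n ≤ Real.exp (x / n) ^ n := by
        gcongr
        rw [add_comm]
        exact Real.add_one_le_exp _
    _ = Real.exp x := by
        rw [← Real.exp_nat_mul, mul_div_cancel₀ _ (by positivity)]

lemma exists_norm_legFun_mul_exp_le (s : ℂ) : ∃ E : ℝ, 0 ≤ E ∧ ∀ᶠ n : ℕ in atTop,
    n * ‖legFun (Complex.exp (s / sqrtC n)) (Complex.exp (-1)) *
      Complex.exp (-(s / sqrtC n * dimMean)) - 1‖ ≤ E := by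
  have h := (tendsto_mul_tilt (p := pathMean) (l := 0) s (P := fun _ => (pathMean : ℂ))
    (by simp)).norm
  set l := ‖s * 0 * (1 - Complex.exp (-pathMean)) +
    s ^ 2 / 2 * (pathMean + Complex.exp (-pathMean)) + (s * pathMean) ^ 2 / 2 -
      (s * (pathMean + Complex.exp (-pathMean))) ^ 2 / 2‖ with hl
  refine ⟨l + 1, by positivity, ?_⟩
  filter_upwards [h.eventually_le_const (lt_add_one l)] with n hn
  rw [legFun_exp_mul, exp_neg_one_div]
  rw [norm_mul, Complex.norm_natCast] at hn
  have hμ : (pathMean : ℂ) + Complex.exp (-pathMean) = 1 + dimMean := by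
    rw [dimMean]; push_cast; ring
  rwa [hμ] at hn

lemma norm_legFun_mul_exp_le {y z e : ℂ} {n : ℕ} (hn : n ≠ 0) {t D E : ℝ}
    (hD : 0 ≤ D) (hy : ‖y - 1‖ ≤ 1 / 300) (hyD : Real.sqrt n * ‖y - 1‖ ≤ D)
    (he : ‖e‖ ≤ 51 / 50) (hE : n * ‖legFun y (Complex.exp (-1)) * e - 1‖ ≤ E)
    (hk : ‖(kern (t / sqrtC n))⁻¹‖ ≤ 5 / 11) (hz : ‖z‖ ≤ 1 / 2)
    (hroot : z * legFun y z = (kern (t / sqrtC n))⁻¹)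
    (hDn : 147 * D / Real.sqrt n ≤ 1 / Real.pi ^ 2) :
    ‖legFun y z * e‖ ≤ 1 + (E + 331 * D ^ 2 + 1 / Real.pi ^ 2 * t ^ 2) / n := by
  have hs : 0 < Real.sqrt n := Real.sqrt_pos.2 (by positivity)
  have hn' : (0 : ℝ) < n := by positivity
  have hss : Real.sqrt n * Real.sqrt n = n := Real.mul_self_sqrt hn'.le
  have he1 : ‖Complex.exp (-1)‖ ≤ 1 / 2 := by
    rw [Complex.norm_exp, Complex.neg_re, Complex.one_re, Real.exp_neg]
    have := Real.exp_one_gt_d9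
    rw [inv_le_comm₀ (by positivity) (by norm_num)]
    linarith
  have h1 := norm_legFun_sub_le (by linarith : ‖y - 1‖ ≤ 1 / 2) hz he1
  have h2 := norm_root_sub_le hy hz hroot
  rw [ofReal_div_sqrtC] at h2 hk
  have h3 := norm_inv_kern_sub_le hk
  rw [div_pow, Real.sq_sqrt hn'.le] at h3
  have h4 := norm_sub_le_norm_sub_add_norm_sub z (kern ((t / Real.sqrt n : ℝ) : ℂ))⁻¹
    (Complex.exp (-1))
  have h5 : ‖legFun y z * e‖ ≤ 1 + ‖legFun y (Complex.exp (-1)) * e - 1‖ +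
      ‖legFun y z - legFun y (Complex.exp (-1))‖ * ‖e‖ := by
    have : legFun y z * e = 1 + (legFun y (Complex.exp (-1)) * e - 1) +
      (legFun y z - legFun y (Complex.exp (-1))) * e := by ring
    rw [this]
    refine (norm_add_le _ _).trans (add_le_add ((norm_add_le _ _).trans ?_) (norm_mul_le _ _))
    rw [norm_one]
  have hy' : ‖y - 1‖ ≤ D / Real.sqrt n := by
    rw [le_div_iff₀ hs]; linarith
  have hE' : ‖legFun y (Complex.exp (-1)) * e - 1‖ ≤ E / n := by
    rw [le_div_iff₀ hn']; linarith
  have h6 : ‖legFun y z - legFun y (Complex.exp (-1))‖ ≤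
      72 * (D / Real.sqrt n) * (9 / 2 * (D / Real.sqrt n) + 2 * (t ^ 2 / n)) := by
    refine h1.trans ?_
    gcongr
    linarith
  have h7 : 72 * (D / Real.sqrt n) * (9 / 2 * (D / Real.sqrt n) + 2 * (t ^ 2 / n)) * (51 / 50) ≤
      (331 * D ^ 2 + 1 / Real.pi ^ 2 * t ^ 2) / n := by
    have e1 : 72 * (D / Real.sqrt n) * (9 / 2 * (D / Real.sqrt n) + 2 * (t ^ 2 / n)) * (51 / 50) =
        (330.48 * D ^ 2 + 146.88 * D / Real.sqrt n * t ^ 2) / n := by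
      generalize Real.sqrt n = r at hs hss ⊢
      rw [← hss]
      field_simp
      ring
    rw [e1]
    have : 146.88 * D / Real.sqrt n ≤ 1 / Real.pi ^ 2 := by
      refine le_trans ?_ hDn
      gcongr
      norm_num
    gcongr
    norm_num
  calc _ ≤ 1 + E / n + 72 * (D / Real.sqrt n) *
        (9 / 2 * (D / Real.sqrt n) + 2 * (t ^ 2 / n)) * (51 / 50) := by
        refine h5.trans ?_
        gcongr
    _ ≤ 1 + E / n + (331 * D ^ 2 + 1 / Real.pi ^ 2 * t ^ 2) / n := by gcongr
    _ = _ := by ring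

lemma norm_integrand_le_of_root {s : ℂ} {n : ℕ} (hn : n ≠ 0) {t D E : ℝ} (hD : 0 ≤ D) (hE0 : 0 ≤ E)
    (hy : ‖Complex.exp (s / sqrtC n) - 1‖ ≤ 1 / 300)
    (hyD : Real.sqrt n * ‖Complex.exp (s / sqrtC n) - 1‖ ≤ D)
    (he : ‖Complex.exp (-(s / sqrtC n * dimMean))‖ ≤ 51 / 50)
    (hE : n * ‖legFun (Complex.exp (s / sqrtC n)) (Complex.exp (-1)) *
      Complex.exp (-(s / sqrtC n * dimMean)) - 1‖ ≤ E)
    (hDn : 147 * D / Real.sqrt n ≤ 1 / Real.pi ^ 2)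
    (ht : |t| ≤ Real.pi * Real.sqrt n) (hk : 11 / 5 ≤ ‖kern (t / sqrtC n)‖) :
    ‖integrand s n t‖ ≤ 2 * Real.exp (E + 331 * D ^ 2) *
      Real.exp (-(1 / Real.pi ^ 2 * t ^ 2)) := by
  have hk' : ‖(kern (t / sqrtC n))⁻¹‖ ≤ 5 / 11 := by
    rw [norm_inv, inv_le_comm₀ (by linarith) (by norm_num)]
    norm_num
    exact hk
  obtain ⟨z, hz, hroot⟩ := exists_root hy hk'
  have h0 : kern (t / sqrtC n) * z * legFun (Complex.exp (s / sqrtC n)) z = 1 := by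
    rw [mul_assoc, hroot, mul_inv_cancel₀ (kern_ne_zero _)]
  rw [integrand_eq h0, norm_mul, norm_mul]
  have h1 : ‖renewal (Complex.exp (s / sqrtC n)) (kern (t / sqrtC n)) n * z ^ n‖ ≤ 2 := by
    have h2 := norm_renewal_mul_pow_sub_one_le hy hz h0 n
    have h3 := norm_sub_norm_le
      (renewal (Complex.exp (s / sqrtC n)) (kern (t / sqrtC n)) n * z ^ n) 1
    rw [norm_one] at h3
    linarith
  have h2 := norm_kern_mul_pow_le hn ht
  have h3 : ‖(legFun (Complex.exp (s / sqrtC n)) z *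
      Complex.exp (-(s / sqrtC n * dimMean))) ^ n‖ ≤
      Real.exp (E + 331 * D ^ 2 + 1 / Real.pi ^ 2 * t ^ 2) := by
    rw [norm_pow]
    refine le_trans ?_ (one_add_div_pow_le_exp (n := n) (by positivity))
    exact pow_le_pow_left₀ (norm_nonneg _)
      (norm_legFun_mul_exp_le hn hD hy hyD he hE hk' hz hroot hDn) n
  calc _ ≤ 2 * Real.exp (-(2 / Real.pi ^ 2 * t ^ 2)) *
        Real.exp (E + 331 * D ^ 2 + 1 / Real.pi ^ 2 * t ^ 2) := by gcongr
    _ = _ := by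
      rw [mul_assoc, mul_assoc, ← Real.exp_add, ← Real.exp_add]
      ring_nf

lemma norm_integrand_le_of_norm_kern_le {s : ℂ} {n : ℕ} {t : ℝ}
    (hy : ‖Complex.exp (s / sqrtC n) - 1‖ ≤ 1 / 300)
    (he : ‖Complex.exp (-(s / sqrtC n * dimMean))‖ ≤ 51 / 50)
    (ht : |t| ≤ Real.pi * Real.sqrt n) (hk : ‖kern (t / sqrtC n)‖ ≤ 11 / 5) :
    ‖integrand s n t‖ ≤ Real.exp (-(1 / 20 / Real.pi ^ 2 * t ^ 2)) := by
  have h1 := norm_renewal_le hy hk n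
  have he1 : ‖Complex.exp (-1)‖ ≤ 46 / 125 := by
    rw [Complex.norm_exp, Complex.neg_re, Complex.one_re, Real.exp_neg]
    have := Real.exp_one_gt_d9
    rw [inv_le_comm₀ (by positivity) (by norm_num)]
    linarith
  rw [integrand, norm_mul, norm_mul, norm_pow, norm_pow]
  have ht2 : t ^ 2 ≤ Real.pi ^ 2 * n := by
    have := pow_le_pow_left₀ (abs_nonneg t) ht 2
    rwa [sq_abs, mul_pow, Real.sq_sqrt (Nat.cast_nonneg n)] at this
  calc _ ≤ (46 / 125 : ℝ) ^ n * (51 / 50) ^ n * (5 / 2) ^ n := by gcongr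
    _ ≤ (19 / 20) ^ n := by
      rw [← mul_pow, ← mul_pow]
      gcongr
      norm_num
    _ ≤ Real.exp (-(1 / 20)) ^ n := by
      gcongr
      have := Real.add_one_le_exp (-(1 / 20) : ℝ)
      linarith
    _ ≤ _ := by
      rw [← Real.exp_nat_mul, Real.exp_le_exp]
      have hpi : 0 < Real.pi ^ 2 := by positivity
      have : 1 / 20 / Real.pi ^ 2 * t ^ 2 ≤ 1 / 20 / Real.pi ^ 2 * (Real.pi ^ 2 * n) := by gcongr
      have e : 1 / 20 / Real.pi ^ 2 * (Real.pi ^ 2 * n) = (1 / 20) * (n : ℝ) := by field_simp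
      linarith

lemma exists_norm_integrand_le (s : ℂ) : ∃ C c : ℝ, 0 < c ∧ ∀ᶠ n : ℕ in atTop, ∀ t : ℝ,
    |t| ≤ Real.pi * Real.sqrt n → ‖integrand s n t‖ ≤ C * Real.exp (-c * t ^ 2) := by
  obtain ⟨E, hE0, hE⟩ := exists_norm_legFun_mul_exp_le s
  have hy' : Tendsto (fun n => ‖Complex.exp (s / sqrtC n) - 1‖) atTop (𝓝 0) := by
    simpa using ((tendsto_exp_div_sqrtC s).sub_const 1).norm
  have hD := (tendsto_sqrtC_mul_exp_sub_one s).norm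
  simp only [norm_mul, norm_sqrtC] at hD
  have he : Tendsto (fun n => ‖Complex.exp (-(s / sqrtC n * dimMean))‖) atTop (𝓝 1) := by
    have h1 := (tendsto_zero_of_sqrtC_mul (tendsto_sqrtC_mul_div s)).mul_const (dimMean : ℂ)
    simpa using h1.neg.cexp.norm
  have hs : Tendsto (fun n : ℕ => 147 * (‖s‖ + 1) / Real.sqrt n) atTop (𝓝 0) := by
    have := tendsto_norm_sqrtC
    simp only [norm_sqrtC] at this
    exact this.const_div_atTop _
  have hpi : 0 < Real.pi ^ 2 := by positivity
  refine ⟨2 * Real.exp (E + 331 * (‖s‖ + 1) ^ 2), 1 / 20 / Real.pi ^ 2, by positivity, ?_⟩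
  filter_upwards [hE, hy'.eventually_le_const (u := 1 / 300) (by norm_num),
    hD.eventually_le_const (lt_add_one ‖s‖), he.eventually_le_const (u := 51 / 50) (by norm_num),
    hs.eventually_le_const (u := 1 / Real.pi ^ 2) (by positivity), eventually_ne_atTop 0]
    with n h1 h2 h3 h4 h5 h6 t ht
  have hC : 1 ≤ 2 * Real.exp (E + 331 * (‖s‖ + 1) ^ 2) := by
    have := Real.add_one_le_exp (E + 331 * (‖s‖ + 1) ^ 2)
    nlinarith [sq_nonneg (‖s‖ + 1)]
  rw [neg_mul]
  rcases le_total (11 / 5) ‖kern (t / sqrtC n)‖ with hk | hk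
  · refine (norm_integrand_le_of_root h6 (by positivity) hE0 h2 h3 h4 h1 h5 ht hk).trans ?_
    gcongr
    norm_num
  · refine (norm_integrand_le_of_norm_kern_le h2 h4 ht hk).trans ?_
    exact le_mul_of_one_le_left (Real.exp_pos _).le hC

end Domination

section MomentGeneratingFunction
open MeasureTheory

/-- The integral of `integrand` over the (rescaled) period. -/
def integrandIntegral (s : ℂ) (n : ℕ) : ℂ :=
  ∫ t in Set.Ioc (-(Real.pi * Real.sqrt n)) (Real.pi * Real.sqrt n), integrand s n t

lemma continuous_integrand (s : ℂ) (n : ℕ) : Continuous (integrand s n) := by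
  unfold integrand renewal
  refine continuous_const.mul (continuous_finsetSum _ fun m _ => Continuous.mul ?_ continuous_const)
  exact (continuous_kern.comp (Complex.continuous_ofReal.div_const _)).pow m

lemma tendsto_integrandIntegral (s : ℂ) : Tendsto (integrandIntegral s) atTop
    (𝓝 (((Real.sqrt (2 * Real.pi) : ℝ) : ℂ) * Complex.exp (s ^ 2 * dimVar / 2))) := by
  obtain ⟨C, c, hc, hb⟩ := exists_norm_integrand_le s
  have hlim : ∫ t : ℝ, Complex.exp (-(t : ℂ) ^ 2 / 2) * Complex.exp (s ^ 2 * dimVar / 2) =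
      ((Real.sqrt (2 * Real.pi) : ℝ) : ℂ) * Complex.exp (s ^ 2 * dimVar / 2) := by
    rw [integral_mul_const]
    congr 1
    have h1 := integral_gaussian (1 / 2)
    have h2 : ∀ t : ℝ, Complex.exp (-(t : ℂ) ^ 2 / 2) =
        ((Real.exp (-(1 / 2) * t ^ 2) : ℝ) : ℂ) := by
      intro t
      push_cast
      congr 1
      ring
    simp only [h2]
    rw [integral_complex_ofReal, h1]
    congr 2
    ring
  rw [← hlim]
  refine Tendsto.congr (fun n => integral_indicator (f := integrand s n) (μ := volume)
    (measurableSet_Ioc (a := -(Real.pi * Real.sqrt n)) (b := Real.pi * Real.sqrt n))) ?_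
  refine tendsto_integral_filter_of_dominated_convergence (fun t => C * Real.exp (-c * t ^ 2))
    ?_ ?_ ((integrable_exp_neg_mul_sq hc).const_mul C) ?_
  · exact Eventually.of_forall fun n =>
      ((continuous_integrand s n).measurable.indicator measurableSet_Ioc).aestronglyMeasurable
  · filter_upwards [hb] with n hn
    refine Eventually.of_forall fun t => ?_
    by_cases ht : t ∈ Set.Ioc (-(Real.pi * Real.sqrt n)) (Real.pi * Real.sqrt n)
    · rw [Set.indicator_of_mem ht]
      exact hn t (abs_le.2 ⟨ht.1.le, ht.2⟩)
    · rw [Set.indicator_of_notMem ht, norm_zero]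
      have hC := (norm_nonneg _).trans (hn 0 (by rw [abs_zero]; positivity))
      exact mul_nonneg (by simpa using hC) (Real.exp_pos _).le
  · refine Eventually.of_forall fun t => ?_
    refine (tendsto_integrand s t).congr' ?_
    have h1 : Tendsto (fun n : ℕ => Real.pi * Real.sqrt n) atTop atTop := by
      have := tendsto_norm_sqrtC
      simp only [norm_sqrtC] at this
      exact this.const_mul_atTop Real.pi_pos
    filter_upwards [h1.eventually_gt_atTop |t|] with n hn
    rw [Set.indicator_of_mem]
    exact ⟨(abs_lt.1 hn).1, (abs_lt.1 hn).2.le⟩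

/-- The sum over rooted trees and base points whose normalisation is the moment generating function
of the centred and scaled dimension. -/
def expSum (s : ℂ) (n : ℕ) : ℂ := ∑ F ∈ rootedOn (Finset.univ : Finset (Fin n)), ∑ v₀ : Fin n,
  Complex.exp (s * ((betaF F v₀ - dimMean * n) / sqrtC n))

lemma expSum_eq (s : ℂ) {n : ℕ} (hn : n ≠ 0) : expSum s n =
    (n.factorial / (2 * Real.pi * sqrtC n * Complex.exp (-1) ^ n)) * integrandIntegral s n := by
  have h1 : ∀ (F : Fin n → Fin n) (v₀ : Fin n),
      Complex.exp (s * ((betaF F v₀ - dimMean * n) / sqrtC n)) =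
      Complex.exp (-(s / sqrtC n * dimMean)) ^ n * Complex.exp (s / sqrtC n) ^ betaF F v₀ := by
    intro F v₀
    rw [← Complex.exp_nat_mul, ← Complex.exp_nat_mul, ← Complex.exp_add]
    congr 1
    ring
  have h2 := sum_coeff_eq_integral (Complex.exp (s / sqrtC n)) n
  have hs : 0 < Real.sqrt n := Real.sqrt_pos.2 (by positivity)
  have h3 := intervalIntegral.integral_comp_div (a := -(Real.pi * Real.sqrt n))
    (b := Real.pi * Real.sqrt n)
    (fun θ : ℝ => renewal (Complex.exp (s / sqrtC n)) (kern θ) n) hs.ne'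
  rw [neg_div, mul_div_cancel_right₀ _ hs.ne', ← h2,
    intervalIntegral.integral_of_le (by linarith [mul_pos Real.pi_pos hs])] at h3
  rw [expSum, integrandIntegral]
  simp only [h1, integrand, ← Finset.mul_sum, integral_const_mul, ofReal_div_sqrtC]
  rw [sum_pow_betaF_eq (Fintype.card_fin n) hn (Complex.exp_ne_zero _), h3, Complex.real_smul,
    ← sqrtC]
  have a1 := sqrtC_ne_zero hn
  have a2 : (Real.pi : ℂ) ≠ 0 := Complex.ofReal_ne_zero.2 Real.pi_ne_zero
  have a3 := Complex.exp_ne_zero (-1)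
  field_simp

lemma expSum_zero {n : ℕ} (hn : n ≠ 0) : expSum 0 n = (n : ℂ) ^ n := by
  rw [← card_rootedOn_univ n hn]
  simp [expSum, mul_comm]

lemma tendsto_expSum (s : ℂ) : Tendsto (fun n : ℕ => expSum s n / (n : ℂ) ^ n) atTop
    (𝓝 (Complex.exp (s ^ 2 * dimVar / 2))) := by
  have h0 := tendsto_integrandIntegral 0
  have hpi : ((Real.sqrt (2 * Real.pi) : ℝ) : ℂ) ≠ 0 :=
    Complex.ofReal_ne_zero.2 (Real.sqrt_pos.2 (by positivity)).ne'
  have h1 := (tendsto_integrandIntegral s).div h0 (by simpa using hpi)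
  have e : ((Real.sqrt (2 * Real.pi) : ℝ) : ℂ) * Complex.exp (s ^ 2 * dimVar / 2) /
      (((Real.sqrt (2 * Real.pi) : ℝ) : ℂ) * Complex.exp (0 ^ 2 * dimVar / 2)) =
      Complex.exp (s ^ 2 * dimVar / 2) := by
    rw [mul_div_mul_left _ _ hpi]
    simp
  rw [e] at h1
  refine h1.congr' ?_
  filter_upwards [eventually_ne_atTop 0] with n hn
  rw [← expSum_zero hn, expSum_eq s hn, expSum_eq 0 hn, Pi.div_apply, mul_div_mul_left]
  have a1 := sqrtC_ne_zero hn
  have a2 : (Real.pi : ℂ) ≠ 0 := Complex.ofReal_ne_zero.2 Real.pi_ne_zero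
  have a3 := Complex.exp_ne_zero (-1)
  have a4 : (n.factorial : ℂ) ≠ 0 := Nat.cast_ne_zero.2 n.factorial_ne_zero
  simp [a1, a2, a3, a4]

end MomentGeneratingFunction

/-! ### Convergence of moments from convergence of moment generating functions -/

/-- A pointwise convergent, locally bounded sequence of entire functions has locally bounded and
pointwise convergent derivatives. -/
lemma tendsto_deriv_of_locally_bounded {f : ℕ → ℂ → ℂ} {g : ℂ → ℂ}
    (hf : ∀ n, Differentiable ℂ (f n)) (hg : Differentiable ℂ g)
    (hb : ∀ R : ℝ, ∃ B, ∀ n z, ‖z‖ ≤ R → ‖f n z‖ ≤ B)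
    (h : ∀ z, Tendsto (fun n => f n z) atTop (𝓝 (g z))) :
    (∀ R : ℝ, ∃ B, ∀ n z, ‖z‖ ≤ R → ‖deriv (f n) z‖ ≤ B) ∧
      ∀ z, Tendsto (fun n => deriv (f n) z) atTop (𝓝 (deriv g z)) := by
  constructor
  · intro R
    obtain ⟨B, hB⟩ := hb (R + 1)
    refine ⟨B / 1, fun n z hz => Complex.norm_deriv_le_of_forall_mem_sphere_norm_le one_pos
      (hf n).diffContOnCl fun w hw => hB n w ?_⟩
    have h1 : ‖w - z‖ = 1 := by simpa [dist_eq_norm] using hw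
    have h2 := norm_add_le (w - z) z
    rw [sub_add_cancel] at h2
    linarith
  · intro z
    obtain ⟨B, hB⟩ := hb (‖z‖ + 1)
    have key : ∀ F : ℂ → ℂ, Differentiable ℂ F → deriv F z =
        (2 * Real.pi * Complex.I : ℂ)⁻¹ • ∮ w in C(z, 1), (w - z)⁻¹ ^ 2 • F w := by
      intro F hF
      have := DiffContOnCl.deriv_eq_smul_circleIntegral (c := z) (R := 1) (f := F) one_pos
        hF.diffContOnCl
      rw [eq_inv_smul_iff₀ Complex.two_pi_I_ne_zero, ← this]
      simp only [one_div, inv_pow]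
    simp_rw [key _ (hf _), key g hg]
    refine Tendsto.const_smul ?_ _
    unfold circleIntegral
    refine intervalIntegral.tendsto_integral_filter_of_dominated_convergence (fun _ => B)
      ?_ ?_ ?_ ?_
    · refine Eventually.of_forall fun n => Continuous.aestronglyMeasurable ?_
      have hc : Continuous fun θ : ℝ => (circleMap z 1 θ - z)⁻¹ :=
        ((continuous_circleMap z 1).sub continuous_const).inv₀ fun θ => by
          simp [circleMap]
      have := (hf n).continuous.comp (continuous_circleMap z 1)
      have hd : Continuous (deriv (circleMap z 1)) := by
        have : deriv (circleMap z 1) = fun θ => circleMap 0 1 θ * Complex.I := by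
          ext θ; simp [deriv_circleMap]
        rw [this]
        exact (continuous_circleMap 0 1).mul continuous_const
      exact hd.smul ((hc.pow 2).smul this)
    · refine Eventually.of_forall fun n => Eventually.of_forall fun θ _ => ?_
      have h1 : ‖f n (circleMap z 1 θ)‖ ≤ B := by
        refine hB n _ ?_
        refine (norm_add_le _ _).trans ?_
        simp
      simpa [circleMap] using h1
    · exact intervalIntegrable_const
    · exact Eventually.of_forall fun θ _ => ((h _).const_smul _).const_smul _

section Moments

variable {ι : Type*} (s : Finset ι) (X : ι → ℝ)

/-- The `k`-th derivative of the moment generating function of `X` under the uniform law. -/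
def momentFun (k : ℕ) (z : ℂ) : ℂ := 𝔼 i ∈ s, (X i : ℂ) ^ k * Complex.exp (z * X i)

lemma hasDerivAt_momentFun (k : ℕ) (z : ℂ) :
    HasDerivAt (momentFun s X k) (momentFun s X (k + 1) z) z := by
  unfold momentFun
  simp only [Finset.expect_eq_sum_div_card]
  refine HasDerivAt.div_const (HasDerivAt.fun_sum fun i _ => ?_) _
  have h := (((hasDerivAt_id z).mul_const (X i : ℂ)).cexp).const_mul ((X i : ℂ) ^ k)
  refine h.congr_deriv ?_
  simp only [id]
  ring

lemma norm_momentFun_zero_le {R : ℝ} {z : ℂ} (hz : ‖z‖ ≤ R) :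
    ‖momentFun s X 0 z‖ ≤ ‖momentFun s X 0 R‖ + ‖momentFun s X 0 (-R)‖ := by
  have hreal : ∀ r : ℝ, ‖momentFun s X 0 r‖ = 𝔼 i ∈ s, Real.exp (r * X i) := by
    intro r
    have : momentFun s X 0 r = ((𝔼 i ∈ s, Real.exp (r * X i) : ℝ) : ℂ) := by
      simp [momentFun, Finset.expect_eq_sum_div_card]
    rw [this, Complex.norm_real, Real.norm_of_nonneg]
    exact Finset.expect_nonneg fun i _ => (Real.exp_pos _).le
  rw [← Complex.ofReal_neg, hreal, hreal, ← Finset.expect_add_distrib]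
  refine (RCLike.norm_expect_le (K := ℂ)).trans (Finset.expect_le_expect fun i _ => ?_)
  rw [pow_zero, one_mul, Complex.norm_exp]
  have hre : |z.re| ≤ R := (Complex.abs_re_le_norm z).trans hz
  have h1 : (z * (X i : ℂ)).re = z.re * X i := by simp
  rw [h1]
  have h2 : z.re * X i ≤ R * |X i| :=
    (le_abs_self _).trans (by rw [abs_mul]; gcongr)
  rcases abs_cases (X i) with ⟨h, _⟩ | ⟨h, _⟩ <;> rw [h] at h2
  · have := Real.exp_le_exp.2 h2
    have := Real.exp_pos (-R * X i)
    linarith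
  · have := Real.exp_le_exp.2 h2
    have := Real.exp_pos (R * X i)
    rw [show -R * X i = R * -X i by ring]
    linarith

end Moments

section Clt

variable {ι : ℕ → Type} {s : ∀ n, Finset (ι n)} {X : ∀ n, ι n → ℝ} {v : ℝ}

/-- Convergence of the moment generating function to a Gaussian one implies convergence of the
first two moments. -/
lemma tendsto_moments
    (h : ∀ z : ℂ, Tendsto (fun n => 𝔼 i ∈ s n, Complex.exp (z * X n i)) atTop
      (𝓝 (Complex.exp (z ^ 2 * v / 2)))) :
    Tendsto (fun n => 𝔼 i ∈ s n, X n i) atTop (𝓝 0) ∧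
      Tendsto (fun n => 𝔼 i ∈ s n, X n i ^ 2) atTop (𝓝 v) := by
  set f : ℕ → ℕ → ℂ → ℂ := fun k n => momentFun (s n) (X n) k with hf
  have hdiff : ∀ k n, Differentiable ℂ (f k n) := fun k n z =>
    (hasDerivAt_momentFun (s n) (X n) k z).differentiableAt
  have hderiv : ∀ k n, deriv (f k n) = f (k + 1) n := fun k n =>
    funext fun z => (hasDerivAt_momentFun (s n) (X n) k z).deriv
  have h0 : ∀ z, Tendsto (fun n => f 0 n z) atTop (𝓝 (Complex.exp (z ^ 2 * v / 2))) := by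
    simpa [hf, momentFun] using h
  have hb0 : ∀ R : ℝ, ∃ B, ∀ n z, ‖z‖ ≤ R → ‖f 0 n z‖ ≤ B := by
    intro R
    obtain ⟨B₁, hB₁⟩ := (h0 R).norm.bddAbove_range
    obtain ⟨B₂, hB₂⟩ := (h0 (-R)).norm.bddAbove_range
    refine ⟨B₁ + B₂, fun n z hz => (norm_momentFun_zero_le (s n) (X n) hz).trans ?_⟩
    exact add_le_add (hB₁ ⟨n, rfl⟩) (hB₂ ⟨n, rfl⟩)
  have hg0 : ∀ z : ℂ, HasDerivAt (fun z : ℂ => Complex.exp (z ^ 2 * v / 2))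
      (z * v * Complex.exp (z ^ 2 * v / 2)) z := by
    intro z
    refine ((((hasDerivAt_pow 2 z).mul_const (v : ℂ)).div_const 2).cexp).congr_deriv ?_
    push_cast
    ring
  have hg1 : ∀ z : ℂ, HasDerivAt (fun z : ℂ => z * v * Complex.exp (z ^ 2 * v / 2))
      (v * Complex.exp (z ^ 2 * v / 2) + z * v * (z * v * Complex.exp (z ^ 2 * v / 2))) z := by
    intro z
    refine (((hasDerivAt_id z).mul_const (v : ℂ)).mul (hg0 z)).congr_deriv ?_
    simp
  obtain ⟨hb1, h1⟩ := tendsto_deriv_of_locally_bounded (hdiff 0)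
    (fun z => (hg0 z).differentiableAt) hb0 h0
  simp only [hderiv, (hg0 _).deriv] at hb1 h1
  obtain ⟨-, h2⟩ := tendsto_deriv_of_locally_bounded (hdiff 1)
    (fun z => (hg1 z).differentiableAt) hb1 h1
  simp only [hderiv, (hg1 _).deriv] at h2
  have hcast : ∀ k n, f k n 0 = ((𝔼 i ∈ s n, X n i ^ k : ℝ) : ℂ) := by
    intro k n
    simp [hf, momentFun, Finset.expect_eq_sum_div_card]
  have e1 := h1 0
  have e2 := h2 0
  simp only [hcast] at e1 e2
  constructor
  · have := (Complex.continuous_re.tendsto _).comp e1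
    simpa [Function.comp_def] using this
  · have := (Complex.continuous_re.tendsto _).comp e2
    simpa only [Function.comp_def, Complex.ofReal_re, Nat.reduceAdd, zero_mul, add_zero, ne_eq,
      OfNat.ofNat_ne_zero, not_false_eq_true, zero_pow, zero_div, Complex.exp_zero, mul_one]
      using this

end Clt

section

/-! ### From moment generating functions to convergence in distribution -/

lemma norm_exp_mul_I_sub_le (a b : ℝ) :
    ‖Complex.exp (a * Complex.I) - Complex.exp (b * Complex.I)‖ ≤ |a - b| := by
  have h : Complex.exp (a * Complex.I) - Complex.exp (b * Complex.I) =
      Complex.exp (b * Complex.I) * (Complex.exp (Complex.I * ((a - b : ℝ) : ℂ)) - 1) := by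
    rw [mul_sub, ← Complex.exp_add, mul_one]
    congr 2
    push_cast
    ring
  rw [h, norm_mul, Complex.norm_exp_ofReal_mul_I, one_mul]
  exact Real.norm_exp_I_mul_ofReal_sub_one_le

variable {ι : ℕ → Type} {s : ∀ n, Finset (ι n)}

/-- The normalization of `Y` under the uniform law on `s`. -/
def standardize {κ : Type*} (s : Finset κ) (Y : κ → ℝ) (i : κ) : ℝ :=
  (Y i - 𝔼 j ∈ s, Y j) / √(𝔼 j ∈ s, (Y j - 𝔼 k ∈ s, Y k) ^ 2)

/-- Convergence of the moment generating functions of `X` implies convergence of the characteristic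
functions of the normalizations of any `Y` uniformly close to `X`. -/
lemma tendsto_charFun_standardize (hs : ∀ n, (s n).Nonempty) {X Y : ∀ n, ι n → ℝ} {v : ℝ}
    (hv : 0 < v) {ε : ℕ → ℝ} (hε : Tendsto ε atTop (𝓝 0))
    (hXY : ∀ n, ∀ i ∈ s n, |Y n i - X n i| ≤ ε n)
    (h : ∀ z : ℂ, Tendsto (fun n => 𝔼 i ∈ s n, Complex.exp (z * X n i)) atTop
      (𝓝 (Complex.exp (z ^ 2 * v / 2)))) (u : ℝ) :
    Tendsto (fun n => 𝔼 i ∈ s n,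
      Complex.exp ((u * standardize (s n) (Y n) i : ℝ) * Complex.I)) atTop
      (𝓝 (Complex.exp (-(u ^ 2) / 2))) := by
  obtain ⟨hX1, hX2⟩ := tendsto_moments h
  have hε0 : ∀ n, 0 ≤ ε n := fun n => by
    obtain ⟨i, hi⟩ := hs n
    exact (abs_nonneg _).trans (hXY n i hi)
  have habs : ∀ n, 𝔼 i ∈ s n, |X n i| ≤ 1 + 𝔼 i ∈ s n, X n i ^ 2 := by
    intro n
    have h1 : (1 : ℝ) = 𝔼 _i ∈ s n, (1 : ℝ) := (Finset.expect_const (hs n) 1).symm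
    rw [h1, ← Finset.expect_add_distrib]
    refine Finset.expect_le_expect fun i _ => ?_
    have := sq_abs (X n i)
    nlinarith [sq_nonneg (|X n i| - 1)]
  have hY1 : Tendsto (fun n => 𝔼 i ∈ s n, Y n i) atTop (𝓝 0) := by
    have hd : Tendsto (fun n => 𝔼 i ∈ s n, Y n i - 𝔼 i ∈ s n, X n i) atTop (𝓝 0) := by
      refine squeeze_zero_norm (fun n => ?_) hε
      rw [← Finset.expect_sub_distrib, Real.norm_eq_abs]
      exact (Finset.abs_expect_le _ _).trans (Finset.expect_le (hs n) (hXY n))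
    simpa using hd.add hX1
  have hY2 : Tendsto (fun n => 𝔼 i ∈ s n, Y n i ^ 2) atTop (𝓝 v) := by
    have hd : Tendsto (fun n => 𝔼 i ∈ s n, Y n i ^ 2 - 𝔼 i ∈ s n, X n i ^ 2) atTop (𝓝 0) := by
      have hlim : Tendsto (fun n => ε n * (2 * (1 + 𝔼 i ∈ s n, X n i ^ 2) + ε n)) atTop (𝓝 0) := by
        simpa using hε.mul ((((tendsto_const_nhds (x := (1 : ℝ))).add hX2).const_mul 2).add hε)
      refine squeeze_zero_norm (fun n => ?_) hlim
      rw [← Finset.expect_sub_distrib, Real.norm_eq_abs]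
      refine (Finset.abs_expect_le _ _).trans ?_
      have h1 : 𝔼 i ∈ s n, |Y n i ^ 2 - X n i ^ 2| ≤ 𝔼 i ∈ s n, ε n * (2 * |X n i| + ε n) := by
        refine Finset.expect_le_expect fun i hi => ?_
        have h2 := hXY n i hi
        rw [sq_sub_sq, abs_mul, mul_comm]
        have h3 : |Y n i + X n i| ≤ 2 * |X n i| + ε n := by
          have : Y n i + X n i = (Y n i - X n i) + 2 * X n i := by ring
          rw [this]
          refine (abs_add_le _ _).trans ?_
          rw [abs_mul, abs_two]
          linarith
        gcongr
        exact hε0 n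
      refine h1.trans ?_
      rw [← Finset.mul_expect, Finset.expect_add_distrib, ← Finset.mul_expect,
        Finset.expect_const (hs n)]
      have := habs n
      have := hε0 n
      gcongr
    simpa using hd.add hX2
  have hvar : ∀ n, 𝔼 j ∈ s n, (Y n j - 𝔼 k ∈ s n, Y n k) ^ 2 =
      𝔼 j ∈ s n, Y n j ^ 2 - (𝔼 k ∈ s n, Y n k) ^ 2 := by
    intro n
    set m := 𝔼 k ∈ s n, Y n k with hm
    have h1 : ∀ j, (Y n j - m) ^ 2 = (Y n j ^ 2 - (2 * m) * Y n j) + m ^ 2 := fun j => by ring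
    simp_rw [h1]
    rw [Finset.expect_add_distrib, Finset.expect_sub_distrib, ← Finset.mul_expect, ← hm,
      Finset.expect_const (hs n)]
    ring
  set σ : ℕ → ℝ := fun n => √(𝔼 j ∈ s n, (Y n j - 𝔼 k ∈ s n, Y n k) ^ 2) with hσ
  have hsv : 0 < √v := Real.sqrt_pos.2 hv
  have hσv : Tendsto σ atTop (𝓝 √v) := by
    simp only [hσ, hvar]
    refine (Real.continuous_sqrt.tendsto v).comp ?_
    simpa using hY2.sub (hY1.pow 2)
  have hinv : Tendsto (fun n => (σ n)⁻¹) atTop (𝓝 (√v)⁻¹) := hσv.inv₀ hsv.ne'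
  have hmain : Tendsto (fun n => 𝔼 i ∈ s n, Complex.exp ((u / √v * X n i : ℝ) * Complex.I)) atTop
      (𝓝 (Complex.exp (-(u ^ 2) / 2))) := by
    have h1 := h ((u / √v : ℝ) * Complex.I)
    have h2 : (((u / √v : ℝ) * Complex.I) ^ 2 * v / 2 : ℂ) = -(u ^ 2) / 2 := by
      have h3 : (u / √v) ^ 2 * v = u ^ 2 := by
        rw [div_pow, Real.sq_sqrt hv.le, div_mul_cancel₀ _ hv.ne']
      rw [mul_pow, Complex.I_sq, ← Complex.ofReal_pow, mul_neg_one, neg_mul,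
        ← Complex.ofReal_mul, h3]
      push_cast
      rfl
    rw [h2] at h1
    refine h1.congr fun n => Finset.expect_congr rfl fun i _ => ?_
    push_cast
    ring_nf
  have hdiff : Tendsto (fun n => 𝔼 i ∈ s n,
      Complex.exp ((u * standardize (s n) (Y n) i : ℝ) * Complex.I) -
      𝔼 i ∈ s n, Complex.exp ((u / √v * X n i : ℝ) * Complex.I)) atTop (𝓝 0) := by
    have hlim : Tendsto (fun n => |u| * (|(σ n)⁻¹ - (√v)⁻¹| * (1 + 𝔼 i ∈ s n, X n i ^ 2) +
        |(σ n)⁻¹| * (ε n + |𝔼 i ∈ s n, Y n i|))) atTop (𝓝 0) := by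
      have h1 : Tendsto (fun n => |(σ n)⁻¹ - (√v)⁻¹|) atTop (𝓝 0) := by
        simpa using (hinv.sub_const (√v)⁻¹).abs
      have h2 := ((h1.mul ((tendsto_const_nhds (x := (1 : ℝ))).add hX2)).add
        (hinv.abs.mul (hε.add hY1.abs))).const_mul |u|
      simpa using h2
    refine squeeze_zero_norm (fun n => ?_) hlim
    rw [← Finset.expect_sub_distrib]
    refine (RCLike.norm_expect_le (K := ℂ)).trans ?_
    have h1 : 𝔼 i ∈ s n, ‖Complex.exp ((u * standardize (s n) (Y n) i : ℝ) * Complex.I) -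
        Complex.exp ((u / √v * X n i : ℝ) * Complex.I)‖ ≤
        𝔼 i ∈ s n, |u| * (|(σ n)⁻¹ - (√v)⁻¹| * |X n i| +
          |(σ n)⁻¹| * (ε n + |𝔼 i ∈ s n, Y n i|)) := by
      refine Finset.expect_le_expect fun i hi => (norm_exp_mul_I_sub_le _ _).trans ?_
      have h2 : u * standardize (s n) (Y n) i - u / √v * X n i =
          u * (((σ n)⁻¹ - (√v)⁻¹) * X n i +
            (σ n)⁻¹ * ((Y n i - X n i) - 𝔼 i ∈ s n, Y n i)) := by
        simp only [standardize, div_eq_mul_inv]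
        change u * ((Y n i - 𝔼 j ∈ s n, Y n j) * (σ n)⁻¹) - _ = _
        ring
      rw [h2, abs_mul]
      gcongr
      refine (abs_add_le _ _).trans ?_
      rw [abs_mul, abs_mul]
      gcongr
      exact (abs_sub _ _).trans (by gcongr; exact hXY n i hi)
    refine h1.trans ?_
    rw [← Finset.mul_expect, Finset.expect_add_distrib, ← Finset.mul_expect,
      Finset.expect_const (hs n)]
    gcongr
    exact habs n
  simpa using hdiff.add hmain

open MeasureTheory ProbabilityTheory in
lemma gaussianReal_real_Iic (x : ℝ) :
    (gaussianReal 0 1).real (Set.Iic x) = stdGaussianCDF x := by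
  rw [Measure.real, gaussianReal_apply_eq_integral 0 one_ne_zero, ENNReal.toReal_ofReal
    (integral_nonneg fun _ => gaussianPDFReal_nonneg _ _ _)]
  simp [stdGaussianCDF, gaussianPDFReal, integral_const_mul]

open MeasureTheory ProbabilityTheory in
/-- Lévy's continuity theorem for uniform laws on finite sets with standard normal limit. -/
lemma tendsto_cdf_of_tendsto_charFun (hs : ∀ n, (s n).Nonempty) {W : ∀ n, ι n → ℝ}
    (h : ∀ u : ℝ, Tendsto (fun n => 𝔼 i ∈ s n, Complex.exp ((u * W n i : ℝ) * Complex.I)) atTop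
      (𝓝 (Complex.exp (-(u ^ 2) / 2)))) (x : ℝ) :
    Tendsto (fun n => 𝔼 i ∈ s n, if W n i ≤ x then (1 : ℝ) else 0) atTop
      (𝓝 (stdGaussianCDF x)) := by
  have hcard : ∀ n, ((s n).card : ENNReal) ≠ 0 := fun n => by
    simpa using (hs n).ne_empty
  let P : ∀ n, Measure ℝ := fun n =>
    ((s n).card : ENNReal)⁻¹ • ∑ i ∈ s n, Measure.dirac (W n i)
  have hP : ∀ n, IsProbabilityMeasure (P n) := fun n => ⟨by
    simp [P, ENNReal.inv_mul_cancel (hcard n) (ENNReal.natCast_ne_top _)]⟩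
  let μ : ℕ → ProbabilityMeasure ℝ := fun n => ⟨P n, hP n⟩
  have hintegral : ∀ n (f : ℝ → ℂ), Continuous f → ∫ y, f y ∂(P n) = 𝔼 i ∈ s n, f (W n i) := by
    intro n f hf
    rw [integral_smul_measure, integral_finsetSum_measure
      fun i _ => integrable_dirac (by simp)]
    simp [Finset.expect_eq_sum_div_card, div_eq_inv_mul]
  let ν : ProbabilityMeasure ℝ := ⟨gaussianReal 0 1, inferInstance⟩
  have hμ : Tendsto μ atTop (𝓝 ν) := by
    refine ProbabilityMeasure.tendsto_iff_tendsto_charFun.2 fun u => ?_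
    change Tendsto (fun n => charFun (P n) u) atTop (𝓝 (charFun (gaussianReal 0 1) u))
    rw [charFun_gaussianReal]
    simp only [charFun_apply_real]
    have h2 : Complex.exp (u * (0 : ℝ) * Complex.I - ((1 : NNReal) : ℝ) * u ^ 2 / 2) =
        Complex.exp (-(u ^ 2) / 2) := by
      congr 1
      push_cast
      ring
    rw [h2]
    refine (h u).congr fun n => ?_
    rw [hintegral n (fun y => Complex.exp (u * y * Complex.I)) (by fun_prop)]
    push_cast
    rfl
  have hfr : (ν : Measure ℝ) (frontier (Set.Iic x)) = 0 := by
    have : NullSingletonClass (gaussianReal 0 1) := nullSingletonClass_gaussianReal one_ne_zero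
    rw [frontier_Iic]
    exact measure_singleton (μ := gaussianReal 0 1) x
  have hlim := ProbabilityMeasure.tendsto_measure_of_null_frontier_of_tendsto' hμ hfr
  have hreal := (ENNReal.tendsto_toReal (measure_ne_top _ _)).comp hlim
  change Tendsto _ _ (𝓝 ((gaussianReal 0 1).real (Set.Iic x))) at hreal
  rw [gaussianReal_real_Iic] at hreal
  refine hreal.congr fun n => ?_
  change (P n (Set.Iic x)).toReal = _
  simp only [P, Measure.smul_apply, Measure.finsetSum_apply, smul_eq_mul, ENNReal.toReal_mul,
    measurableSet_Iic, Measure.dirac_apply', Finset.expect_eq_sum_div_card, ENNReal.toReal_inv,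
    ENNReal.toReal_natCast, div_eq_inv_mul]
  congr 1
  rw [ENNReal.toReal_sum fun i _ => by simp [Set.indicator]; split_ifs <;> simp]
  refine Finset.sum_congr rfl fun i _ => ?_
  by_cases hi : W n i ≤ x <;> simp [hi]

end

/-! ### The central limit theorem for random labelled trees -/

/-- Pairs of a rooted tree on `Fin n`, given by its parent function, and a marked vertex. -/
def markedRooted (n : ℕ) : Finset ((Fin n → Fin n) × Fin n) :=
  rootedOn (Finset.univ : Finset (Fin n)) ×ˢ Finset.univ

lemma markedRooted_card {n : ℕ} (hn : n ≠ 0) : ((markedRooted n).card : ℂ) = (n : ℂ) ^ n := by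
  rw [markedRooted, Finset.card_product, Finset.card_univ, Fintype.card_fin, Nat.cast_mul,
    mul_comm, card_rootedOn_univ n hn]

lemma markedRooted_nonempty {n : ℕ} (hn : n ≠ 0) : (markedRooted n).Nonempty := by
  rw [← Finset.card_ne_zero]
  have h : ((markedRooted n).card : ℂ) ≠ 0 := by
    rw [markedRooted_card hn]
    exact pow_ne_zero _ (Nat.cast_ne_zero.2 hn)
  exact_mod_cast h

lemma treeSet_eq_coe_filter (n : ℕ) :
    treeSet n = ((Finset.univ.filter fun T : SimpleGraph (Fin n) => T.IsTree :
      Finset (SimpleGraph (Fin n))) : Set (SimpleGraph (Fin n))) := by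
  ext T
  simp [treeSet, IsTree, SimpleGraph.isTree_iff]

lemma unifExp_treeSet {n : ℕ} (hn : n ≠ 0) (f : SimpleGraph (Fin n) → ℝ) :
    unifExp (treeSet n) f = 𝔼 p ∈ markedRooted n, f (parentGraph p.1) := by
  have hsum : ∀ g : SimpleGraph (Fin n) → ℝ, ∑ p ∈ markedRooted n, g (parentGraph p.1) =
      n * (n * ∑ T ∈ Finset.univ.filter (fun T : SimpleGraph (Fin n) => T.IsTree), g T) := by
    intro g
    rw [markedRooted, Finset.sum_product]
    simp only [Finset.sum_const, Finset.card_univ, Fintype.card_fin, nsmul_eq_mul]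
    rw [← Finset.mul_sum, sum_rootedOn_parentGraph, Fintype.card_fin, nsmul_eq_mul]
    congr!
  have hcard := hsum fun _ => 1
  have hn' : (n : ℝ) ≠ 0 := Nat.cast_ne_zero.2 hn
  simp only [Finset.sum_const, nsmul_eq_mul, mul_one] at hcard
  rw [Finset.expect_eq_sum_div_card, hsum, hcard, mul_div_mul_left _ _ hn',
    mul_div_mul_left _ _ hn', unifExp, treeSet_eq_coe_filter, finsum_mem_coe_finset,
    Nat.card_coe_set_eq, Set.ncard_coe_finset]

lemma unifPr_eq_unifExp {n : ℕ} (S A : Set (SimpleGraph (Fin n))) :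
    unifPr S A = unifExp S fun G => if G ∈ A then 1 else 0 := by
  rw [unifPr, unifExp]
  rw [finsum_mem_eq_finite_toFinset_sum _ S.toFinite, Finset.sum_boole, Nat.card_coe_set_eq,
    Set.ncard_eq_toFinset_card _ (Set.toFinite _)]
  congr 3
  ext G
  simp

lemma standardize_affine {κ : Type*} {s : Finset κ} (hs : s.Nonempty) (Y : κ → ℝ) (a : ℝ) {b : ℝ}
    (hb : 0 < b) (i : κ) : standardize s (fun j => (Y j - a) / b) i = standardize s Y i := by
  have hm : 𝔼 j ∈ s, (Y j - a) / b = (𝔼 j ∈ s, Y j - a) / b := by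
    rw [← Finset.expect_div, Finset.expect_sub_distrib, Finset.expect_const hs]
  have hc : ∀ j, (Y j - a) / b - (𝔼 k ∈ s, Y k - a) / b = (Y j - 𝔼 k ∈ s, Y k) / b := fun j => by
    ring
  simp only [standardize, hm, hc, div_pow]
  rw [← Finset.expect_div, Real.sqrt_div' _ (sq_nonneg b), Real.sqrt_sq hb.le,
    div_div_div_cancel_right₀ hb.ne']

lemma normβ_treeSet {n : ℕ} (hn : n ≠ 0) (p : (Fin n → Fin n) × Fin n) :
    normβ (treeSet n) (parentGraph p.1) =
      standardize (markedRooted n) (fun p => betaR (parentGraph p.1)) p := by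
  simp only [normβ, unifVar, unifExp_treeSet hn, standardize]

/-- For a uniformly random labelled tree on `{1,…,n}`, the normalized metric
dimension `(β(T_n) − E β(T_n))/sqrt(Var β(T_n))` converges in distribution to a standard
normal random variable (pointwise convergence of CDFs; the normal CDF is continuous). -/
theorem tree_metricDim_clt :
    ∀ x : ℝ,
      Tendsto (fun n : ℕ => unifPr (treeSet n) {G | normβ (treeSet n) G ≤ x})
        atTop (𝓝 (stdGaussianCDF x)) := by
  intro x
  rw [← tendsto_add_atTop_iff_nat 2]
  have hn : ∀ n : ℕ, n + 2 ≠ 0 := fun n => by omega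
  have hs : ∀ n : ℕ, (markedRooted (n + 2)).Nonempty := fun n => markedRooted_nonempty (hn n)
  have hpos : ∀ n : ℕ, 0 < √((n + 2 : ℕ) : ℝ) := fun n =>
    Real.sqrt_pos.2 (Nat.cast_pos.2 (Nat.pos_of_ne_zero (hn n)))
  have hε : Tendsto (fun n : ℕ => 2 / √((n + 2 : ℕ) : ℝ)) atTop (𝓝 0) :=
    ((Real.tendsto_sqrt_atTop.comp tendsto_natCast_atTop_atTop).comp
      (tendsto_add_atTop_nat 2)).const_div_atTop 2
  have hXY : ∀ n : ℕ, ∀ p ∈ markedRooted (n + 2),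
      |(betaR (parentGraph p.1) - dimMean * (n + 2 : ℕ)) / √((n + 2 : ℕ) : ℝ) -
        (betaF p.1 p.2 - dimMean * (n + 2 : ℕ)) / √((n + 2 : ℕ) : ℝ)| ≤
      2 / √((n + 2 : ℕ) : ℝ) := by
    intro n p hp
    obtain ⟨r, hr⟩ := mem_rootedOn_univ.1 (Finset.mem_product.1 hp).1
    obtain ⟨h1, h2⟩ := hr.metricDim_bounds p.2 (by simp)
    have h1' : (betaF p.1 p.2 : ℝ) ≤ betaR (parentGraph p.1) := by
      rw [betaR]
      exact_mod_cast h1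
    have h2' : betaR (parentGraph p.1) ≤ (betaF p.1 p.2 : ℝ) + 2 := by
      rw [betaR]
      exact_mod_cast h2
    rw [← sub_div, abs_div, abs_of_pos (hpos n)]
    gcongr
    rw [abs_le]
    constructor <;> linarith
  have hmgf : ∀ z : ℂ, Tendsto (fun n : ℕ => 𝔼 p ∈ markedRooted (n + 2),
      Complex.exp (z * (((betaF p.1 p.2 - dimMean * (n + 2 : ℕ)) / √((n + 2 : ℕ) : ℝ) : ℝ) : ℂ)))
      atTop (𝓝 (Complex.exp (z ^ 2 * dimVar / 2))) := by
    intro z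
    refine ((tendsto_expSum z).comp (tendsto_add_atTop_nat 2)).congr fun n => ?_
    rw [Finset.expect_eq_sum_div_card, markedRooted_card (hn n), markedRooted, Finset.sum_product]
    simp [expSum, sqrtC]
  have hclt := tendsto_cdf_of_tendsto_charFun hs
    (tendsto_charFun_standardize hs dimVar_pos hε hXY hmgf) x
  refine hclt.congr fun n => ?_
  rw [unifPr_eq_unifExp, unifExp_treeSet (hn n)]
  refine Finset.expect_congr rfl fun p _ => ?_
  simp only [Set.mem_ofPred_eq, normβ_treeSet (hn n),
    standardize_affine (hs n) (fun p => betaR (parentGraph p.1)) _ (hpos n)]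

end MetricDimPaper
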